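/- Let 1 ≤ n < N be integers and let K : (ℝ^N)^{n+2} → [0,∞). There exists k > 2 such that for every C_0 ≥ 10 there exists η = η(N,n,K,C_0,k) ∈ (0, ω_n·2^{-(2n+2)}] with the following property: if μ is a Borel measure on ℝ^N with compact support such that K is symmetric, K^2 is a μ-proper integrand, and (A) μ(B(0,5)) ≥ 1 and μ(ℝ^N ∖ B(0,5)) = 0; (B) μ(B) ≤ C_0 (diam B)^n for every closed ball B; (C) M_{K^2}(μ) ≤ η; (D) β_{1;k;μ}^{P_0}(0,5) ≤ η for some n-dimensional linear subspace P_0 of ℝ^N; then there exists a Lipschitz function A : P_0 → P_0^⊥ such that its graph G(A) := {u + A(u) : u ∈ P_0} ⊂ ℝ^N satisfies μ(G(A)) ≥ (99/100)·μ(ℝ^N). Here ω_n is the n-dimensional volume of the n-dimensional unit ball and P_0^⊥ is the orthogonal complement of P_0. -/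

import Mathlib

open MeasureTheory Metric Set
open scoped NNReal ENNReal

noncomputable section

/-- `x 0, …, x m` span an `(m,σ)`-simplex: the distance from each vertex to the affine
span of the remaining vertices is at least `σ`. -/
def IsHSimplex (N : ℕ) {m : ℕ} (σ : ℝ) (x : Fin (m + 1) → EuclideanSpace ℝ (Fin N)) : Prop :=
  ∀ i : Fin (m + 1),
    σ ≤ Metric.infDist (x i)
      (affineSpan ℝ (x '' ({i}ᶜ : Set (Fin (m + 1)))) : Set (EuclideanSpace ℝ (Fin N)))

/-- The integral Menger curvature `M_{K^p}(μ) = ∫⋯∫ K^p dμ ⋯ dμ`. -/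
def MengerEnergy (N n : ℕ) (p : ℝ) (K : (Fin (n + 2) → EuclideanSpace ℝ (Fin N)) → ℝ)
    (μ : Measure (EuclideanSpace ℝ (Fin N))) : ℝ≥0∞ :=
  ∫⁻ z, ENNReal.ofReal (K z ^ p) ∂(Measure.pi fun _ : Fin (n + 2) => μ)

/-- `K^p` is a `μ`-proper integrand. -/
def MuProperIntegrand (N n : ℕ) (p : ℝ)
    (K : (Fin (n + 2) → EuclideanSpace ℝ (Fin N)) → ℝ)
    (μ : Measure (EuclideanSpace ℝ (Fin N))) : Prop :=
  (∀ z, 0 ≤ K z) ∧ AEMeasurable K (Measure.pi fun _ : Fin (n + 2) => μ) ∧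
  (∃ c : ℝ, 1 ≤ c ∧ ∃ l : ℝ, 1 ≤ l ∧
    ∀ t : ℝ, 0 < t → ∀ C : ℝ, 1 ≤ C → ∀ x : EuclideanSpace ℝ (Fin N),
      ∀ y : Fin (n + 1) → EuclideanSpace ℝ (Fin N),
        IsHSimplex N (t / C) y →
        convexHull ℝ (Set.range y) ⊆ Metric.closedBall x (C * t) →
        ∀ w ∈ Metric.closedBall x (C * t),
          (Metric.infDist w (affineSpan ℝ (Set.range y) : Set (EuclideanSpace ℝ (Fin N))) / t) ^ p
            ≤ c * C ^ l * t ^ (n * (n + 1)) * K (Fin.snoc y w) ^ p) ∧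
  (∀ t : ℝ, 0 < t → ∀ z : Fin (n + 2) → EuclideanSpace ℝ (Fin N),
      t ^ (n * (n + 1)) * K (fun i => t • z i) ^ p = K z ^ p) ∧
  (∀ b : EuclideanSpace ℝ (Fin N), ∀ z : Fin (n + 2) → EuclideanSpace ℝ (Fin N),
      K (fun i => z i + b) = K z)

/-- `K` is symmetric: invariant under every permutation of its `n+2` arguments. -/
def SymmetricKernel (N n : ℕ) (K : (Fin (n + 2) → EuclideanSpace ℝ (Fin N)) → ℝ) : Prop :=
  ∀ (σ : Equiv.Perm (Fin (n + 2))) (z : Fin (n + 2) → EuclideanSpace ℝ (Fin N)), K (z ∘ σ) = K z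

/-- The (topological) support of a measure on `ℝ^N`. -/
def msupport (N : ℕ) (μ : Measure (EuclideanSpace ℝ (Fin N))) :
    Set (EuclideanSpace ℝ (Fin N)) :=
  {x | ∀ ε : ℝ, 0 < ε → 0 < μ (Metric.ball x ε)}

/-- `P` is (the carrier of) an `n`-dimensional affine subspace of `ℝ^N`. -/
def IsAffDim (N n : ℕ) (P : AffineSubspace ℝ (EuclideanSpace ℝ (Fin N))) : Prop :=
  (P : Set (EuclideanSpace ℝ (Fin N))).Nonempty ∧ Module.finrank ℝ P.direction = n

/-- The `β`-number `β_{p;k;μ}^P(x,t)` relative to a set `P`. -/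
def betaP (N n : ℕ) (p k : ℝ) (μ : Measure (EuclideanSpace ℝ (Fin N)))
    (P : Set (EuclideanSpace ℝ (Fin N))) (x : EuclideanSpace ℝ (Fin N)) (t : ℝ) : ℝ≥0∞ :=
  ((ENNReal.ofReal (t ^ n))⁻¹ *
    ∫⁻ y in Metric.closedBall x (k * t),
      ENNReal.ofReal ((Metric.infDist y P / t) ^ p) ∂μ) ^ (1 / p)

/-- The `β`-number `β_{p;k;μ}(x,t)`: infimum of `β_{p;k;μ}^P(x,t)` over all
`n`-dimensional affine subspaces `P`. -/
def beta (N n : ℕ) (p k : ℝ) (μ : Measure (EuclideanSpace ℝ (Fin N)))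
    (x : EuclideanSpace ℝ (Fin N)) (t : ℝ) : ℝ≥0∞ :=
  ⨅ (P : AffineSubspace ℝ (EuclideanSpace ℝ (Fin N))) (_ : IsAffDim N n P),
    betaP N n p k μ (P : Set (EuclideanSpace ℝ (Fin N))) x t

/-- `ω_m`, the `m`-dimensional volume of the `m`-dimensional unit ball. -/
def unitBallVol (m : ℕ) : ℝ :=
  (MeasureTheory.volume (Metric.closedBall (0 : EuclideanSpace ℝ (Fin m)) 1)).toReal

namespace MengerGraph

/-- A splitting of `ℝ^N` into `n` horizontal coordinates `p` and a vertical part `q`. -/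
structure Splitting (N n : ℕ) (W : Type*) [NormedAddCommGroup W] [NormedSpace ℝ W] where
  p : EuclideanSpace ℝ (Fin N) →L[ℝ] (Fin n → ℝ)
  q : EuclideanSpace ℝ (Fin N) →L[ℝ] W
  norm_p_le : ∀ x, ‖p x‖ ≤ ‖x‖
  norm_q_le : ∀ x, ‖q x‖ ≤ ‖x‖
  norm_le : ∀ x, ‖x‖ ≤ n * ‖p x‖ + ‖q x‖

/-- The index of the dyadic cube of generation `j` that contains `y`. -/
def idx {n : ℕ} (j : ℕ) (y : Fin n → ℝ) : Fin n → ℤ := fun i => ⌊(2 : ℝ) ^ j * y i⌋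

/-- The side length of the dyadic cubes of generation `j`. -/
def side (j : ℕ) : ℝ := ((2 : ℝ) ^ j)⁻¹

/-- The index of the dyadic parent. -/
def par {n : ℕ} (k : Fin n → ℤ) : Fin n → ℤ := fun i => k i / 2

/-- All partial derivatives of the affine map `f` have norm at most `γ`. -/
def SlopeLE {n : ℕ} {W : Type*} [NormedAddCommGroup W] [NormedSpace ℝ W]
    (f : (Fin n → ℝ) →ᵃ[ℝ] W) (γ : ℝ) : Prop :=
  ∀ i, ‖f.linear (Pi.single i 1)‖ ≤ γ

lemma side_pos (j : ℕ) : 0 < side j := by unfold side; positivity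

lemma two_pow_mul_side (j : ℕ) : (2 : ℝ) ^ j * side j = 1 := by
  unfold side; field_simp

lemma side_succ (j : ℕ) : side (j + 1) = side j / 2 := by
  unfold side; rw [pow_succ]; field_simp

lemma side_le_one (j : ℕ) : side j ≤ 1 := by
  unfold side; exact inv_le_one_of_one_le₀ (one_le_pow₀ (by norm_num))

lemma par_idx {n : ℕ} (j : ℕ) (y : Fin n → ℝ) : par (idx (j + 1) y) = idx j y := by
  funext i
  simp only [par, idx]
  symm
  rw [Int.floor_eq_iff]
  have h1 := Int.floor_le ((2 : ℝ) ^ (j + 1) * y i)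
  have h2 := Int.lt_floor_add_one ((2 : ℝ) ^ (j + 1) * y i)
  set m := ⌊(2 : ℝ) ^ (j + 1) * y i⌋
  have e : (2 : ℝ) ^ (j + 1) * y i = 2 * (2 ^ j * y i) := by ring
  rw [e] at h1 h2
  have a1 : 2 * (m / 2) ≤ m := by omega
  have a2 : m + 1 ≤ 2 * (m / 2) + 2 := by omega
  have b1 : (2 : ℝ) * ((m / 2 : ℤ) : ℝ) ≤ m := by exact_mod_cast a1
  have b2 : (m : ℝ) + 1 ≤ 2 * ((m / 2 : ℤ) : ℝ) + 2 := by exact_mod_cast a2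
  constructor <;> linarith

lemma measurable_idx {n : ℕ} (j : ℕ) : Measurable (idx j : (Fin n → ℝ) → (Fin n → ℤ)) := by
  unfold idx
  fun_prop

lemma abs_sub_le_of_idx {n : ℕ} {j : ℕ} {k : Fin n → ℤ} {y : Fin n → ℝ} (h : idx j y = k) (i : Fin n) :
    (k i : ℝ) ≤ 2 ^ j * y i ∧ 2 ^ j * y i < k i + 1 := by
  subst h
  exact ⟨Int.floor_le _, Int.lt_floor_add_one _⟩

section Affine

variable {n : ℕ} {W : Type*} [NormedAddCommGroup W] [NormedSpace ℝ W]

lemma norm_linear_le {f : (Fin n → ℝ) →ᵃ[ℝ] W} {γ : ℝ} (hf : SlopeLE f γ) (v : Fin n → ℝ) :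
    ‖f.linear v‖ ≤ n * γ * ‖v‖ := by
  have e : f.linear v = ∑ i, v i • f.linear (Pi.single i 1) := by
    conv_lhs => rw [pi_eq_sum_univ' v]
    simp [map_sum, map_smul]
  rw [e]
  calc ‖∑ i, v i • f.linear (Pi.single i 1)‖ ≤ ∑ i : Fin n, ‖v i • f.linear (Pi.single i 1)‖ :=
        norm_sum_le _ _
    _ ≤ ∑ _i : Fin n, ‖v‖ * γ := by
        refine Finset.sum_le_sum fun i _ => ?_
        rw [norm_smul]
        exact mul_le_mul (norm_le_pi_norm v i) (hf i) (norm_nonneg _) (norm_nonneg _)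
    _ = n * γ * ‖v‖ := by simp; ring

lemma apply_sub_apply (f : (Fin n → ℝ) →ᵃ[ℝ] W) (y z : Fin n → ℝ) :
    f y - f z = f.linear (y - z) := by
  rw [← vsub_eq_sub, ← f.linearMap_vsub, vsub_eq_sub]

lemma norm_apply_sub_le {f : (Fin n → ℝ) →ᵃ[ℝ] W} {γ : ℝ} (hf : SlopeLE f γ)
    (y z : Fin n → ℝ) : ‖f y - f z‖ ≤ n * γ * ‖y - z‖ := by
  rw [apply_sub_apply]; exact norm_linear_le hf _

end Affine

lemma pi_norm_sub_le_of_abs {n : ℕ} {j : ℕ} {y z : Fin n → ℝ} {c : ℝ} (hc : 0 ≤ c)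
    (h : ∀ i, |2 ^ j * y i - 2 ^ j * z i| ≤ c) : ‖y - z‖ ≤ c * side j := by
  rw [pi_norm_le_iff_of_nonneg (mul_nonneg hc (side_pos j).le)]
  intro i
  have := h i
  rw [← mul_sub, abs_mul, abs_of_pos (by positivity : (0 : ℝ) < 2 ^ j)] at this
  rw [Pi.sub_apply, Real.norm_eq_abs, side, ← div_eq_mul_inv, le_div_iff₀ (by positivity)]
  linarith

lemma norm_sub_le_of_idx_near {n : ℕ} {j : ℕ} {y z : Fin n → ℝ} {d : ℕ}
    (h : ∀ i, |idx j y i - idx j z i| ≤ d) : ‖y - z‖ ≤ (d + 1) * side j := by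
  refine pi_norm_sub_le_of_abs (by positivity) fun i => ?_
  obtain ⟨a1, a2⟩ := abs_sub_le_of_idx (rfl : idx j y = _) i
  obtain ⟨b1, b2⟩ := abs_sub_le_of_idx (rfl : idx j z = _) i
  have h' : |((idx j y i : ℤ) : ℝ) - idx j z i| ≤ d := by exact_mod_cast h i
  rw [abs_le] at h' ⊢
  constructor <;> linarith [h'.1, h'.2]

lemma norm_sub_le_of_idx {n : ℕ} {j : ℕ} {y z : Fin n → ℝ} (h : idx j y = idx j z) :
    ‖y - z‖ ≤ side j := by
  simpa using norm_sub_le_of_idx_near (d := 0) (j := j) (y := y) (z := z) (by simp [h])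

section Strip

variable {N n : ℕ} {W : Type*} [NormedAddCommGroup W] [NormedSpace ℝ W]

/-- The points above the dyadic cube `(j, k)` at vertical distance at most `r` from the graph
of `a`. -/
def win (S : Splitting N n W) (a : (Fin n → ℝ) →ᵃ[ℝ] W) (r : ℝ) (j : ℕ) (k : Fin n → ℤ) :
    Set (EuclideanSpace ℝ (Fin N)) :=
  {x | idx j (S.p x) = k ∧ ‖S.q x - a (S.p x)‖ ≤ r}

lemma continuous_gap (S : Splitting N n W) (a : (Fin n → ℝ) →ᵃ[ℝ] W) :
    Continuous fun x => ‖S.q x - a (S.p x)‖ :=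
  (S.q.continuous.sub (a.continuous_of_finiteDimensional.comp S.p.continuous)).norm

lemma measurableSet_win (S : Splitting N n W) (a : (Fin n → ℝ) →ᵃ[ℝ] W) (r : ℝ) (j : ℕ)
    (k : Fin n → ℤ) : MeasurableSet (win S a r j k) := by
  refine MeasurableSet.inter ?_ ?_
  · exact ((measurable_idx j).comp S.p.continuous.measurable) (measurableSet_singleton k)
  · exact measurableSet_le (continuous_gap S a).measurable measurable_const

/-- Two points of (possibly different) windows: distance from horizontal distance. -/
lemma norm_sub_le_of_gap (S : Splitting N n W) {a : (Fin n → ℝ) →ᵃ[ℝ] W} (ha : SlopeLE a 1)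
    {r r' : ℝ} {x x' : EuclideanSpace ℝ (Fin N)} (hx : ‖S.q x - a (S.p x)‖ ≤ r)
    (hx' : ‖S.q x' - a (S.p x')‖ ≤ r') :
    ‖x - x'‖ ≤ 2 * n * ‖S.p x - S.p x'‖ + r + r' := by
  have h1 := S.norm_le (x - x')
  rw [map_sub, map_sub] at h1
  have h2 := norm_apply_sub_le ha (S.p x) (S.p x')
  have e : S.q x - S.q x' = (S.q x - a (S.p x)) + (a (S.p x) - a (S.p x')) -
      (S.q x' - a (S.p x')) := by abel
  have h3 : ‖S.q x - S.q x'‖ ≤ r + n * 1 * ‖S.p x - S.p x'‖ + r' := by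
    rw [e]
    exact (norm_sub_le _ _).trans (add_le_add ((norm_add_le _ _).trans (add_le_add hx h2)) hx')
  linarith

/-- Lebesgue measure of a slab inside a cube. -/
lemma volume_slab_le {V : Type*} [NormedAddCommGroup V] [NormedSpace ℝ V]
    (f : (Fin n → ℝ) →ᵃ[ℝ] V) {γ : ℝ} (hγ : 0 < γ) (i : Fin n)
    (hi : ‖f.linear (Pi.single i 1)‖ = γ) (z : Fin n → ℝ) {l : ℝ} (hl : 0 < l) (M : ℕ)
    (hM : 0 < M) :
    volume ({y | ‖f y‖ ≤ (n + 1) * γ * l / M} ∩ closedBall z (2 * l)) ≤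
      ENNReal.ofReal ((6 * n + 10) ^ n * l ^ n / M) := by
  set E : Set (Fin n → ℝ) := {y | ‖f y‖ ≤ (n + 1) * γ * l / M} ∩ closedBall z (2 * l) with hE
  set t : ℝ := 3 * (n + 1) * l / M with ht
  have hMR : (0 : ℝ) < M := by exact_mod_cast hM
  have htpos : 0 < t := by positivity
  have hEm : MeasurableSet E := by
    refine MeasurableSet.inter ?_ isClosed_closedBall.measurableSet
    exact (isClosed_le f.continuous_of_finiteDimensional.norm continuous_const).measurableSet
  let v : Fin n → ℝ := Pi.single i 1
  have hv : ‖v‖ ≤ 1 := by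
    rw [pi_norm_le_iff_of_nonneg zero_le_one]
    intro i'
    by_cases h : i' = i
    · subst h; simp [v]
    · simp [v, h]
  let T : ℕ → Set (Fin n → ℝ) := fun m => (fun y => (-(m * t)) • v + y) ⁻¹' E
  have hTm : ∀ m, MeasurableSet (T m) := fun m => (measurable_const_add _) hEm
  have hTvol : ∀ m, volume (T m) = volume E := fun m => measure_preimage_add _ _ _
  have hdisj : ((Finset.range M : Finset ℕ) : Set ℕ).PairwiseDisjoint T := by
    intro m _ m' _ hmm
    rw [Function.onFun, Set.disjoint_left]
    intro y hy hy'
    have h1 : ‖f ((-(m * t)) • v + y)‖ ≤ (n + 1) * γ * l / M := hy.1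
    have h2 : ‖f ((-(m' * t)) • v + y)‖ ≤ (n + 1) * γ * l / M := hy'.1
    have h3 : f ((-(m * t)) • v + y) - f ((-(m' * t)) • v + y) = (((m' : ℝ) - m) * t) • f.linear v := by
      rw [apply_sub_apply, ← map_smul]; congr 1; module
    have h4 : ‖(((m' : ℝ) - m) * t) • f.linear v‖ ≤ 2 * ((n + 1) * γ * l / M) := by
      rw [← h3]; exact (norm_sub_le _ _).trans (by linarith)
    rw [norm_smul, hi, Real.norm_eq_abs, abs_mul, abs_of_pos htpos] at h4
    have h5 : (1 : ℝ) ≤ |(m' : ℝ) - m| := by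
      have : (1 : ℤ) ≤ |(m' : ℤ) - m| := Int.one_le_abs (by omega)
      exact_mod_cast this
    have h6 : t * γ ≤ |(m' : ℝ) - m| * t * γ := by
      have := mul_le_mul_of_nonneg_right h5 (mul_pos htpos hγ).le
      linarith
    have h7 : t * γ = 3 * ((n + 1) * γ * l / M) := by rw [ht]; ring
    have h8 : 0 < (n + 1) * γ * l / M := by positivity
    linarith
  have hsub : (⋃ m ∈ Finset.range M, T m) ⊆ closedBall z ((3 * n + 5) * l) := by
    intro y hy
    simp only [Set.mem_iUnion, Finset.mem_range] at hy
    obtain ⟨m, hm, hy⟩ := hy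
    have h1 : (-(m * t)) • v + y ∈ closedBall z (2 * l) := hy.2
    rw [mem_closedBall, dist_eq_norm] at h1 ⊢
    have e : y - z = ((-(m * t)) • v + y - z) + (m * t) • v := by module
    have h2 : ‖((m : ℝ) * t) • v‖ ≤ (3 * n + 3) * l := by
      rw [norm_smul, Real.norm_eq_abs, abs_of_nonneg (by positivity)]
      have h3 : (m : ℝ) * t ≤ M * t := by gcongr
      have h4 : M * t = (3 * n + 3) * l := by rw [ht]; field_simp
      calc (m : ℝ) * t * ‖v‖ ≤ m * t * 1 := by gcongr
        _ ≤ _ := by linarith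
    rw [e]
    exact (norm_add_le _ _).trans (by linarith)
  have key : (M : ℝ≥0∞) * volume E ≤ ENNReal.ofReal ((2 * ((3 * n + 5) * l)) ^ n) := by
    calc (M : ℝ≥0∞) * volume E = ∑ m ∈ Finset.range M, volume (T m) := by
          simp [hTvol]
      _ = volume (⋃ m ∈ Finset.range M, T m) :=
          (measure_biUnion_finset hdisj fun m _ => hTm m).symm
      _ ≤ volume (closedBall z ((3 * n + 5) * l)) := measure_mono hsub
      _ = _ := by
        rw [Real.volume_pi_closedBall _ (by positivity)]; simp
  have e2 : (2 * ((3 * n + 5) * l)) ^ n = (6 * n + 10) ^ n * l ^ n := by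
    rw [← mul_pow]; congr 1; ring
  rw [e2] at key
  rw [ENNReal.ofReal_div_of_pos hMR, ENNReal.ofReal_natCast,
    ENNReal.le_div_iff_mul_le (Or.inl (by exact_mod_cast hM.ne')) (Or.inl (ENNReal.natCast_ne_top M)),
    mul_comm]
  exact key

/-- The constant in the slab estimate. -/
def slabConst (n : ℕ) (C₀ : ℝ) : ℝ := C₀ * (4 * n + 2) ^ n * (6 * n + 10) ^ n

/-- Slabs in a window carry little mass. -/
lemma measure_slab_le (S : Splitting N n W) {μ : Measure (EuclideanSpace ℝ (Fin N))}
    [IsFiniteMeasure μ] {C₀ : ℝ} (hC₀ : 0 ≤ C₀)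
    (hμ : ∀ c r, 0 ≤ r → μ (closedBall c r) ≤ ENNReal.ofReal (C₀ * (2 * r) ^ n))
    {a : (Fin n → ℝ) →ᵃ[ℝ] W} (ha : SlopeLE a 1) {j : ℕ} {k : Fin n → ℤ} {M : ℕ} (hM : 0 < M)
    {r : ℝ} (hr : r ≤ side j / M)
    {V : Type*} [NormedAddCommGroup V] [NormedSpace ℝ V]
    (f : (Fin n → ℝ) →ᵃ[ℝ] V) {γ : ℝ} (hγ : 0 < γ) (i : Fin n)
    (hi : ‖f.linear (Pi.single i 1)‖ = γ) (hf : SlopeLE f γ) :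
    μ (win S a r j k ∩ {x | ‖f (S.p x)‖ ≤ γ * side j / M}) ≤
      ENNReal.ofReal (slabConst n C₀ * side j ^ n / M) := by
  set l := side j with hl
  have hlpos : 0 < l := side_pos j
  have hMR : (0 : ℝ) < M := by exact_mod_cast hM
  have hM1 : (1 : ℝ) ≤ M := by exact_mod_cast hM
  set ρ : ℝ := l / M with hρ
  have hρpos : 0 < ρ := by positivity
  have hρl : ρ ≤ l := div_le_self hlpos.le hM1
  set E := win S a r j k ∩ {x | ‖f (S.p x)‖ ≤ γ * l / M} with hE
  have hEm : MeasurableSet E := (measurableSet_win S a r j k).inter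
    (measurableSet_le ((f.continuous_of_finiteDimensional.comp S.p.continuous).norm).measurable
      measurable_const)
  let z : Fin n → ℝ := fun i => k i * l
  let E' : Set (Fin n → ℝ) := {y | ‖f y‖ ≤ (n + 1) * γ * l / M} ∩ closedBall z (2 * l)
  have hE'm : MeasurableSet E' := by
    refine MeasurableSet.inter ?_ isClosed_closedBall.measurableSet
    exact (isClosed_le f.continuous_of_finiteDimensional.norm continuous_const).measurableSet
  let D : Set (EuclideanSpace ℝ (Fin N) × (Fin n → ℝ)) := {w | w.1 ∈ E ∧ ‖S.p w.1 - w.2‖ ≤ ρ}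
  have hDm : MeasurableSet D := by
    refine MeasurableSet.inter (measurable_fst hEm) ?_
    have hc : Continuous fun w : EuclideanSpace ℝ (Fin N) × (Fin n → ℝ) => ‖S.p w.1 - w.2‖ := by
      fun_prop
    exact measurableSet_le hc.measurable measurable_const
  have h1 : μ E * ENNReal.ofReal ((2 * ρ) ^ n) = (μ.prod volume) D := by
    rw [Measure.prod_apply hDm]
    have : ∀ x, volume (Prod.mk x ⁻¹' D) = E.indicator (fun _ => ENNReal.ofReal ((2 * ρ) ^ n)) x := by
      intro x
      by_cases hx : x ∈ E
      · rw [Set.indicator_of_mem hx]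
        have : Prod.mk x ⁻¹' D = closedBall (S.p x) ρ := by
          ext y
          simp only [D, Set.mem_preimage, Set.mem_ofPred_eq, hx, true_and, mem_closedBall,
            dist_eq_norm]
          rw [norm_sub_rev]
        rw [this, Real.volume_pi_closedBall _ hρpos.le, Fintype.card_fin]
      · rw [Set.indicator_of_notMem hx]
        have : Prod.mk x ⁻¹' D = ∅ := by
          ext y; simp [D, hx]
        rw [this, measure_empty]
    simp_rw [this]
    rw [lintegral_indicator hEm, lintegral_const, Measure.restrict_apply_univ, mul_comm]
  have h2 : (μ.prod volume) D ≤
      ENNReal.ofReal (C₀ * (2 * ((4 * n + 2) * ρ)) ^ n) * volume E' := by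
    rw [Measure.prod_apply_symm hDm, ← setLIntegral_const, ← lintegral_indicator hE'm]
    refine lintegral_mono fun y => ?_
    rcases Set.eq_empty_or_nonempty ((fun x => (x, y)) ⁻¹' D) with h | ⟨x₀, hx₀⟩
    · rw [h, measure_empty]; exact zero_le
    · have hx₀E : x₀ ∈ E := hx₀.1
      have hx₀d : ‖S.p x₀ - y‖ ≤ ρ := hx₀.2
      have hy : y ∈ E' := by
        constructor
        · have h3 : ‖f (S.p x₀)‖ ≤ γ * l / M := hx₀E.2
          have h4 := norm_apply_sub_le hf y (S.p x₀)
          rw [norm_sub_rev y] at h4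
          have h5 : (n : ℝ) * γ * ‖S.p x₀ - y‖ ≤ n * γ * ρ := by gcongr
          have h6 : ‖f y‖ ≤ ‖f (S.p x₀)‖ + ‖f y - f (S.p x₀)‖ := by
            calc ‖f y‖ = ‖f (S.p x₀) + (f y - f (S.p x₀))‖ := by congr 1; abel
              _ ≤ _ := norm_add_le _ _
          have h7 : (n + 1) * γ * l / M = γ * l / M + n * γ * ρ := by rw [hρ]; ring
          show ‖f y‖ ≤ _
          linarith
        · rw [mem_closedBall, dist_eq_norm]
          have h3 : ‖S.p x₀ - z‖ ≤ 1 * l := by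
            refine pi_norm_sub_le_of_abs zero_le_one fun i' => ?_
            obtain ⟨a1, a2⟩ := abs_sub_le_of_idx hx₀E.1.1 i'
            have : (2 : ℝ) ^ j * z i' = k i' := by
              simp only [z]; rw [mul_left_comm, hl, two_pow_mul_side, mul_one]
            rw [this, abs_le]
            constructor <;> linarith
          have : y - z = (S.p x₀ - z) - (S.p x₀ - y) := by abel
          rw [this]
          exact (norm_sub_le _ _).trans (by linarith)
      rw [Set.indicator_of_mem hy]
      refine (measure_mono ?_).trans (hμ x₀ _ (by positivity))
      intro x hx
      have hxE : x ∈ E := hx.1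
      have hxd : ‖S.p x - y‖ ≤ ρ := hx.2
      have h3 := norm_sub_le_of_gap S ha hxE.1.2 hx₀E.1.2
      have h4 : ‖S.p x - S.p x₀‖ ≤ 2 * ρ := by
        have : S.p x - S.p x₀ = (S.p x - y) - (S.p x₀ - y) := by abel
        rw [this]
        exact (norm_sub_le _ _).trans (by linarith)
      rw [mem_closedBall, dist_eq_norm]
      have h5 : 2 * (n : ℝ) * ‖S.p x - S.p x₀‖ ≤ 2 * n * (2 * ρ) := by gcongr
      linarith
  have h3 := volume_slab_le f hγ i hi z hlpos M hM
  have h4 : μ E * ENNReal.ofReal ((2 * ρ) ^ n) ≤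
      ENNReal.ofReal (slabConst n C₀ * l ^ n / M) * ENNReal.ofReal ((2 * ρ) ^ n) := by
    rw [h1]
    refine h2.trans ((mul_le_mul_right h3 _).trans ?_)
    rw [← ENNReal.ofReal_mul (by positivity), ← ENNReal.ofReal_mul (by unfold slabConst; positivity)]
    apply ENNReal.ofReal_le_ofReal
    have e : (2 * ((4 * n + 2) * ρ)) ^ n = (4 * n + 2) ^ n * (2 * ρ) ^ n := by
      rw [← mul_pow]; congr 1; ring
    rw [e, slabConst]
    exact le_of_eq (by ring)
  rwa [ENNReal.mul_le_mul_iff_left (by simp; positivity) ENNReal.ofReal_ne_top] at h4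

end Strip

lemma sq_mul_le_of_lintegral_le {α : Type*} [MeasurableSpace α] {μ : Measure α} {U V : Set α}
    (hUV : U ⊆ V) (hU : MeasurableSet U) {g : α → ℝ} {c m A : ℝ} (hc : 0 ≤ c) (hA : 0 ≤ A)
    (hg : ∀ x ∈ U, c ≤ g x) (hm : ENNReal.ofReal m ≤ μ U)
    (h : ∫⁻ x in V, ENNReal.ofReal (g x ^ 2) ∂μ ≤ ENNReal.ofReal A) : c ^ 2 * m ≤ A := by
  have h1 : ENNReal.ofReal (c ^ 2) * ENNReal.ofReal m ≤ ENNReal.ofReal A := by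
    calc ENNReal.ofReal (c ^ 2) * ENNReal.ofReal m ≤ ENNReal.ofReal (c ^ 2) * μ U := by gcongr
      _ = ∫⁻ _ in U, ENNReal.ofReal (c ^ 2) ∂μ := by rw [setLIntegral_const]
      _ ≤ ∫⁻ x in U, ENNReal.ofReal (g x ^ 2) ∂μ := by
          refine setLIntegral_mono' hU fun x hx => ENNReal.ofReal_le_ofReal ?_
          exact pow_le_pow_left₀ hc (hg x hx) 2
      _ ≤ ∫⁻ x in V, ENNReal.ofReal (g x ^ 2) ∂μ := lintegral_mono_set hUV
      _ ≤ _ := h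
  rw [← ENNReal.ofReal_mul (by positivity)] at h1
  exact (ENNReal.ofReal_le_ofReal_iff hA).1 h1

/-- `y` is within `c` side lengths (in the maximum norm) of the corner of the cube `(j, k)`. -/
def NearCube {n : ℕ} (j : ℕ) (k : Fin n → ℤ) (c : ℝ) (y : Fin n → ℝ) : Prop :=
  ∀ i, |2 ^ j * y i - k i| ≤ c

lemma nearCube_of_idx {n j : ℕ} {k : Fin n → ℤ} {y : Fin n → ℝ} (h : idx j y = k) :
    NearCube j k 1 y := by
  intro i
  obtain ⟨h1, h2⟩ := abs_sub_le_of_idx h i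
  rw [abs_le]; constructor <;> linarith

lemma NearCube.norm_sub_le {n j : ℕ} {k : Fin n → ℤ} {y z : Fin n → ℝ} {c d : ℝ}
    (hcd : 0 ≤ c + d) (hy : NearCube j k c y) (hz : NearCube j k d z) :
    ‖y - z‖ ≤ (c + d) * side j := by
  refine pi_norm_sub_le_of_abs hcd fun i => ?_
  have h1 := abs_le.1 (hy i)
  have h2 := abs_le.1 (hz i)
  rw [abs_le]; constructor <;> linarith [h1.1, h1.2, h2.1, h2.2]

/-- The constant in the comparison of two affine maps. -/
def cmpConst (n M : ℕ) (δ : ℝ) : ℝ := (2 + 42 * n * M) / δ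

section Compare

variable {N n : ℕ} {W : Type*} [NormedAddCommGroup W] [NormedSpace ℝ W]

/-- Two affine maps that both approximate `μ` in `L²` on a window of substantial mass are close. -/
lemma compare_affine (hn : 1 ≤ n) (S : Splitting N n W) {μ : Measure (EuclideanSpace ℝ (Fin N))}
    [IsFiniteMeasure μ] {C₀ : ℝ} (hC₀ : 0 ≤ C₀)
    (hμ : ∀ c r, 0 ≤ r → μ (closedBall c r) ≤ ENNReal.ofReal (C₀ * (2 * r) ^ n))
    {aR : (Fin n → ℝ) →ᵃ[ℝ] W} (haR : SlopeLE aR 1) {j : ℕ} {k : Fin n → ℤ} {M : ℕ} (hM : 0 < M)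
    {r : ℝ} (hr : r ≤ side j / M) {δ : ℝ} (hδ : 0 < δ) (hδ1 : δ ≤ 1)
    (hMδ : slabConst n C₀ / M ≤ δ / 2)
    (hdens : ENNReal.ofReal (δ * side j ^ n) ≤ μ (win S aR r j k))
    {a b : (Fin n → ℝ) →ᵃ[ℝ] W} {e₁ e₂ : ℝ} (he₁ : 0 ≤ e₁) (he₂ : 0 ≤ e₂)
    (ha : ∫⁻ x in win S aR r j k, ENNReal.ofReal (‖S.q x - a (S.p x)‖ ^ 2) ∂μ ≤
      ENNReal.ofReal (e₁ ^ 2 * side j ^ 2 * side j ^ n))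
    (hb : ∫⁻ x in win S aR r j k, ENNReal.ofReal (‖S.q x - b (S.p x)‖ ^ 2) ∂μ ≤
      ENNReal.ofReal (e₂ ^ 2 * side j ^ 2 * side j ^ n)) :
    SlopeLE (a - b) (cmpConst n M δ * (e₁ + e₂)) ∧
      ∀ y, NearCube j k 20 y → ‖a y - b y‖ ≤ cmpConst n M δ * (e₁ + e₂) * side j := by
  set l := side j with hl
  have hlpos : 0 < l := side_pos j
  have hMR : (0 : ℝ) < M := by exact_mod_cast hM
  have hM1 : (1 : ℝ) ≤ M := by exact_mod_cast hM
  have hn1 : (1 : ℝ) ≤ n := by exact_mod_cast hn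
  set e := e₁ + e₂ with he
  have he0 : 0 ≤ e := add_nonneg he₁ he₂
  set f := a - b with hf
  set Wd := win S aR r j k with hWd
  have hWm : MeasurableSet Wd := measurableSet_win ..
  have hfc : Continuous fun x => ‖f (S.p x)‖ :=
    (f.continuous_of_finiteDimensional.comp S.p.continuous).norm
  have hintegral : ∫⁻ x in Wd, ENNReal.ofReal (‖f (S.p x)‖ ^ 2) ∂μ ≤
      ENNReal.ofReal (2 * e ^ 2 * l ^ 2 * l ^ n) := by
    calc ∫⁻ x in Wd, ENNReal.ofReal (‖f (S.p x)‖ ^ 2) ∂μ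
        ≤ ∫⁻ x in Wd, (ENNReal.ofReal 2 * ENNReal.ofReal (‖S.q x - a (S.p x)‖ ^ 2) +
            ENNReal.ofReal 2 * ENNReal.ofReal (‖S.q x - b (S.p x)‖ ^ 2)) ∂μ := by
          refine lintegral_mono fun x => ?_
          rw [← ENNReal.ofReal_mul (by norm_num), ← ENNReal.ofReal_mul (by norm_num),
            ← ENNReal.ofReal_add (by positivity) (by positivity)]
          apply ENNReal.ofReal_le_ofReal
          have e1 : f (S.p x) = (S.q x - b (S.p x)) - (S.q x - a (S.p x)) := by
            simp [hf]
          have h3 : ‖f (S.p x)‖ ≤ ‖S.q x - b (S.p x)‖ + ‖S.q x - a (S.p x)‖ := by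
            rw [e1]; exact norm_sub_le _ _
          nlinarith [norm_nonneg (f (S.p x)), sq_nonneg (‖S.q x - b (S.p x)‖ - ‖S.q x - a (S.p x)‖),
            pow_le_pow_left₀ (norm_nonneg _) h3 2]
      _ = ENNReal.ofReal 2 * (∫⁻ x in Wd, ENNReal.ofReal (‖S.q x - a (S.p x)‖ ^ 2) ∂μ) +
            ENNReal.ofReal 2 * ∫⁻ x in Wd, ENNReal.ofReal (‖S.q x - b (S.p x)‖ ^ 2) ∂μ := by
          have hma : Measurable fun x => ENNReal.ofReal (‖S.q x - a (S.p x)‖ ^ 2) :=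
            ENNReal.measurable_ofReal.comp ((continuous_gap S a).pow 2).measurable
          have hmb : Measurable fun x => ENNReal.ofReal (‖S.q x - b (S.p x)‖ ^ 2) :=
            ENNReal.measurable_ofReal.comp ((continuous_gap S b).pow 2).measurable
          rw [lintegral_add_left (hma.const_mul _), lintegral_const_mul _ hma,
            lintegral_const_mul _ hmb]
      _ ≤ ENNReal.ofReal 2 * ENNReal.ofReal (e₁ ^ 2 * l ^ 2 * l ^ n) +
            ENNReal.ofReal 2 * ENNReal.ofReal (e₂ ^ 2 * l ^ 2 * l ^ n) := by gcongr
      _ ≤ ENNReal.ofReal (2 * e ^ 2 * l ^ 2 * l ^ n) := by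
          rw [← ENNReal.ofReal_mul (by norm_num), ← ENNReal.ofReal_mul (by norm_num),
            ← ENNReal.ofReal_add (by positivity) (by positivity)]
          apply ENNReal.ofReal_le_ofReal
          have h3 : 0 ≤ 4 * (e₁ * e₂) * (l ^ 2 * l ^ n) := by positivity
          rw [he]; nlinarith [h3]
  have : Nonempty (Fin n) := ⟨⟨0, hn⟩⟩
  obtain ⟨i, hi⟩ := Finite.exists_max fun i => ‖f.linear (Pi.single i 1)‖
  set γ := ‖f.linear (Pi.single i 1)‖ with hγ
  have hγ0 : 0 ≤ γ := norm_nonneg _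
  have hslope : SlopeLE f γ := hi
  have hγle : γ ≤ 2 * M * e / δ := by
    rcases hγ0.eq_or_lt with h0 | hpos
    · rw [← h0]; positivity
    · have hslab := measure_slab_le S hC₀ hμ haR hM hr f hpos i hγ.symm hslope (k := k)
      set B := Wd ∩ {x | ‖f (S.p x)‖ ≤ γ * l / M} with hB
      have hBm : MeasurableSet B := hWm.inter (measurableSet_le hfc.measurable measurable_const)
      have hmass : ENNReal.ofReal (δ / 2 * l ^ n) ≤ μ (Wd \ B) := by
        rw [measure_sdiff Set.inter_subset_left hBm.nullMeasurableSet (measure_ne_top _ _)]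
        have h1 : ENNReal.ofReal (δ / 2 * l ^ n) =
            ENNReal.ofReal (δ * l ^ n) - ENNReal.ofReal (δ / 2 * l ^ n) := by
          rw [← ENNReal.ofReal_sub _ (by positivity)]; congr 1; ring
        rw [h1]
        refine tsub_le_tsub hdens (hslab.trans (ENNReal.ofReal_le_ofReal ?_))
        have : slabConst n C₀ * l ^ n / M = slabConst n C₀ / M * l ^ n := by ring
        rw [this]; gcongr
      have h2 := sq_mul_le_of_lintegral_le (U := Wd \ B) (V := Wd) (c := γ * l / M)
        Set.sdiff_subset (hWm.diff hBm) (by positivity) (by positivity)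
        (fun x hx => by
          have : ¬ ‖f (S.p x)‖ ≤ γ * l / M := fun h => hx.2 ⟨hx.1, h⟩
          exact (not_le.1 this).le) hmass hintegral
      have h3 : γ ^ 2 * δ ≤ 4 * M ^ 2 * e ^ 2 := by
        have hpos' : 0 < l ^ 2 * l ^ n / (2 * M ^ 2) := by positivity
        have e1 : (γ * l / M) ^ 2 * (δ / 2 * l ^ n) = γ ^ 2 * δ * (l ^ 2 * l ^ n / (2 * M ^ 2)) := by
          field_simp
        have e2 : 2 * e ^ 2 * l ^ 2 * l ^ n = 4 * M ^ 2 * e ^ 2 * (l ^ 2 * l ^ n / (2 * M ^ 2)) := by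
          field_simp; ring
        rw [e1, e2] at h2
        exact le_of_mul_le_mul_right h2 hpos'
      rw [le_div_iff₀ hδ]
      refine abs_le_of_sq_le_sq' ?_ (by positivity) |>.2
      calc (γ * δ) ^ 2 = γ ^ 2 * δ * δ := by ring
        _ ≤ 4 * M ^ 2 * e ^ 2 * δ := by gcongr
        _ ≤ 4 * M ^ 2 * e ^ 2 * 1 := by gcongr
        _ = (2 * M * e) ^ 2 := by ring
  have hWpos : μ Wd ≠ 0 := by
    intro h
    rw [h] at hdens
    have : 0 < ENNReal.ofReal (δ * l ^ n) := ENNReal.ofReal_pos.2 (by positivity)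
    exact absurd (this.trans_le hdens) (by simp)
  obtain ⟨x₀, hx₀, hx₀le⟩ := exists_le_setLAverage hWpos (measure_ne_top μ Wd)
    (ENNReal.measurable_ofReal.comp (hfc.pow 2).measurable).aemeasurable
  have hval : ‖f (S.p x₀)‖ ≤ 2 * e * l / δ := by
    rw [setLAverage_eq, ENNReal.le_div_iff_mul_le (Or.inl hWpos)
      (Or.inl (measure_ne_top μ Wd))] at hx₀le
    have h1 : ENNReal.ofReal (‖f (S.p x₀)‖ ^ 2) * ENNReal.ofReal (δ * l ^ n) ≤
        ENNReal.ofReal (2 * e ^ 2 * l ^ 2 * l ^ n) :=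
      (mul_le_mul_right hdens _).trans (hx₀le.trans hintegral)
    rw [← ENNReal.ofReal_mul (by positivity), ENNReal.ofReal_le_ofReal_iff (by positivity)] at h1
    have h2 : ‖f (S.p x₀)‖ ^ 2 * δ ≤ 2 * e ^ 2 * l ^ 2 := by
      refine le_of_mul_le_mul_right (a := l ^ n) ?_ (by positivity)
      linarith
    rw [le_div_iff₀ hδ]
    refine abs_le_of_sq_le_sq' ?_ (by positivity) |>.2
    calc (‖f (S.p x₀)‖ * δ) ^ 2 = ‖f (S.p x₀)‖ ^ 2 * δ * δ := by ring
      _ ≤ 2 * e ^ 2 * l ^ 2 * δ := by gcongr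
      _ ≤ 2 * e ^ 2 * l ^ 2 * 1 := by gcongr
      _ ≤ (2 * e * l) ^ 2 := by nlinarith [sq_nonneg (e * l)]
  constructor
  · intro i'
    refine (hi i').trans (hγle.trans ?_)
    rw [cmpConst, div_mul_eq_mul_div]
    gcongr
    nlinarith
  · intro y hy
    have h1 : ‖y - S.p x₀‖ ≤ (20 + 1) * l :=
      hy.norm_sub_le (by norm_num) (nearCube_of_idx hx₀.1)
    have h2 := norm_apply_sub_le hslope y (S.p x₀)
    have h3 : (n : ℝ) * γ * ‖y - S.p x₀‖ ≤ n * (2 * M * e / δ) * ((20 + 1) * l) := by gcongr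
    have h4 : ‖f y‖ ≤ ‖f (S.p x₀)‖ + ‖f y - f (S.p x₀)‖ := by
      calc ‖f y‖ = ‖f (S.p x₀) + (f y - f (S.p x₀))‖ := by congr 1; abel
        _ ≤ _ := norm_add_le _ _
    have h5 : cmpConst n M δ * e * l = 2 * e * l / δ + n * (2 * M * e / δ) * ((20 + 1) * l) := by
      rw [cmpConst]; ring
    have h6 : a y - b y = f y := by simp [hf]
    rw [h6, h5]
    linarith

end Compare

section Simplex

variable {E : Type*} [NormedAddCommGroup E] [NormedSpace ℝ E]

/-- The height of a vertex is upper semicontinuous in the vertices. -/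
lemma isOpen_height_lt {m : ℕ} (hm : 1 ≤ m) (i : Fin (m + 1)) (σ : ℝ) :
    IsOpen {x : Fin (m + 1) → E |
      infDist (x i) (affineSpan ℝ (x '' ({i}ᶜ : Set (Fin (m + 1)))) : Set E) < σ} := by
  have hne : (({i}ᶜ : Set (Fin (m + 1)))).Nonempty := by
    have : Nontrivial (Fin (m + 1)) := Fin.nontrivial_iff_two_le.2 (by omega)
    obtain ⟨j, hj⟩ := exists_ne i
    exact ⟨j, hj⟩
  have key : {x : Fin (m + 1) → E |
      infDist (x i) (affineSpan ℝ (x '' ({i}ᶜ : Set (Fin (m + 1)))) : Set E) < σ} =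
      ⋃ sw : {sw : Finset ({i}ᶜ : Set (Fin (m + 1))) × (({i}ᶜ : Set (Fin (m + 1))) → ℝ) //
        ∑ j ∈ sw.1, sw.2 j = 1},
        {x | ‖x i - ∑ j ∈ sw.1.1, sw.1.2 j • x j‖ < σ} := by
    ext x
    simp only [Set.mem_ofPred_eq, Set.mem_iUnion]
    rw [infDist_lt_iff ((affineSpan_nonempty ℝ).2 (hne.image x))]
    constructor
    · rintro ⟨y, hy, hd⟩
      rw [Set.image_eq_range, SetLike.mem_coe, mem_affineSpan_iff_eq_affineCombination] at hy
      obtain ⟨s, w, hw, rfl⟩ := hy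
      refine ⟨⟨(s, w), hw⟩, ?_⟩
      rw [s.affineCombination_eq_linear_combination _ _ hw, dist_eq_norm] at hd
      exact hd
    · rintro ⟨⟨⟨s, w⟩, hw⟩, hd⟩
      refine ⟨∑ j ∈ s, w j • x j, ?_, by rw [dist_eq_norm]; exact hd⟩
      rw [Set.image_eq_range, SetLike.mem_coe, mem_affineSpan_iff_eq_affineCombination]
      exact ⟨s, w, hw, by rw [s.affineCombination_eq_linear_combination _ _ hw]⟩
  rw [key]
  refine isOpen_iUnion fun sw => isOpen_lt ?_ continuous_const
  fun_prop

/-- Heights do not increase under linear contractions. -/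
lemma height_map_le {F : Type*} [NormedAddCommGroup F] [NormedSpace ℝ F] {m : ℕ} (hm : 1 ≤ m)
    (p : E →L[ℝ] F) (hp : ∀ x, ‖p x‖ ≤ ‖x‖) (x : Fin (m + 1) → E) (i : Fin (m + 1)) :
    infDist (p (x i)) (affineSpan ℝ ((fun j => p (x j)) '' ({i}ᶜ : Set (Fin (m + 1)))) : Set F) ≤
      infDist (x i) (affineSpan ℝ (x '' ({i}ᶜ : Set (Fin (m + 1)))) : Set E) := by
  have hne : (({i}ᶜ : Set (Fin (m + 1)))).Nonempty := by
    have : Nontrivial (Fin (m + 1)) := Fin.nontrivial_iff_two_le.2 (by omega)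
    obtain ⟨j, hj⟩ := exists_ne i
    exact ⟨j, hj⟩
  refine (le_infDist ((affineSpan_nonempty ℝ).2 (hne.image x))).2 fun y hy => ?_
  have hmem : p y ∈ affineSpan ℝ ((fun j => p (x j)) '' ({i}ᶜ : Set (Fin (m + 1)))) := by
    have h1 : (fun j => p (x j)) '' ({i}ᶜ : Set (Fin (m + 1))) =
        (p : E →ₗ[ℝ] F).toAffineMap '' (x '' ({i}ᶜ : Set (Fin (m + 1)))) := by
      rw [Set.image_image]; rfl
    rw [h1, ← AffineSubspace.map_span]
    exact ⟨y, hy, rfl⟩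
  refine (infDist_le_dist_of_mem hmem).trans ?_
  rw [dist_eq_norm, dist_eq_norm, ← map_sub]
  exact hp _

end Simplex

section Interpolation

variable {n : ℕ} {W : Type*} [NormedAddCommGroup W] [NormedSpace ℝ W]

/-- Affine interpolation on a fat simplex of full dimension. -/
lemma exists_affine_interpolation (v : Fin (n + 1) → (Fin n → ℝ)) {h : ℝ} (hh : 0 < h)
    (hv : ∀ i, h ≤ infDist (v i)
      (affineSpan ℝ (v '' ({i}ᶜ : Set (Fin (n + 1)))) : Set (Fin n → ℝ)))
    (u : Fin (n + 1) → W) {t : ℝ} (ht : ∀ i, ‖u i‖ ≤ t) :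
    ∃ a : (Fin n → ℝ) →ᵃ[ℝ] W, (∀ i, a (v i) = u i) ∧ SlopeLE a ((n + 1) * t / h) ∧
      ∀ y d, (∀ i, ‖y - v i‖ ≤ d) → ‖a y‖ ≤ (n + 1) * t * (1 + d / h) := by
  have hind : AffineIndependent ℝ v := by
    rw [affineIndependent_iff]
    intro s w hw hwv i his
    by_contra hne
    have hi : v i ∈ affineSpan ℝ (v '' ({i}ᶜ : Set (Fin (n + 1)))) := by
      have h1 : ∑ j ∈ s.erase i, (-(w i)⁻¹ * w j) = 1 := by
        rw [← Finset.mul_sum]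
        have := Finset.add_sum_erase s w his
        have e : ∑ j ∈ s.erase i, w j = - w i := by linarith
        rw [e]; field_simp
      have h2 : v i = ∑ j ∈ s.erase i, (-(w i)⁻¹ * w j) • v j := by
        have h3 := Finset.add_sum_erase s (fun j => w j • v j) his
        rw [hwv] at h3
        have e : ∑ j ∈ s.erase i, w j • v j = - (w i • v i) := by
          rw [eq_neg_iff_add_eq_zero, add_comm]; exact h3
        simp only [mul_smul]
        rw [← Finset.smul_sum, e, smul_neg, neg_smul, neg_neg, inv_smul_smul₀ hne]
      rw [h2, ← Finset.affineCombination_eq_linear_combination _ _ _ h1]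
      refine affineCombination_mem_affineSpan_image h1 (fun j hj hj' => ?_) v
      exact absurd (Finset.ne_of_mem_erase hj) hj'
    have := hv i
    rw [infDist_zero_of_mem hi] at this
    linarith
  have htop : affineSpan ℝ (Set.range v) = ⊤ := by
    rw [hind.affineSpan_eq_top_iff_card_eq_finrank_add_one]; simp
  let b : AffineBasis (Fin (n + 1)) ℝ (Fin n → ℝ) := ⟨v, hind, htop⟩
  have hbv : ∀ i, b i = v i := fun i => rfl
  have hcoord : ∀ i (w : Fin n → ℝ), |(b.coord i).linear w| ≤ ‖w‖ / h := by
    intro i w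
    rcases eq_or_ne ((b.coord i).linear w) 0 with h0 | h0
    · rw [h0, abs_zero]; positivity
    · set s := (b.coord i).linear w
      let z : Fin n → ℝ := v i - s⁻¹ • w
      have hz0 : b.coord i z = 0 := by
        have h1 : b.coord i z = b.coord i (v i) + (b.coord i).linear (z - v i) := by
          have := (b.coord i).linearMap_vsub z (v i)
          simp only [vsub_eq_sub] at this
          rw [this]; ring
        have h2 : z - v i = -(s⁻¹ • w) := by simp [z]
        rw [h1, h2, map_neg, map_smul, ← hbv, b.coord_apply_eq]
        rw [smul_eq_mul, inv_mul_cancel₀ h0, add_neg_cancel]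
      have hz : z ∈ affineSpan ℝ (v '' ({i}ᶜ : Set (Fin (n + 1)))) := by
        have hlin := b.linear_combination_coord_eq_self z
        rw [Set.image_eq_range, mem_affineSpan_iff_eq_affineCombination]
        have hsum : ∑ j : ({i}ᶜ : Set (Fin (n + 1))), b.coord j z = 1 := by
          have h1 := b.sum_coord_apply_eq_one z
          rw [← Finset.add_sum_erase _ _ (Finset.mem_univ i), hz0, zero_add] at h1
          rw [← h1]
          refine (Finset.sum_subtype _ (fun x => ?_) fun j => b.coord j z).symm
          simp
        refine ⟨Finset.univ, fun j => b.coord j z, hsum, ?_⟩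
        rw [Finset.affineCombination_eq_linear_combination _ _ _ hsum]
        rw [← Finset.add_sum_erase _ _ (Finset.mem_univ i), hz0, zero_smul, zero_add] at hlin
        conv_lhs => rw [← hlin]
        refine Finset.sum_subtype _ (fun x => ?_) fun j => b.coord j z • b j
        simp
      have h3 := (hv i).trans (infDist_le_dist_of_mem hz)
      rw [dist_eq_norm] at h3
      have h4 : v i - z = s⁻¹ • w := by simp [z]
      rw [h4, norm_smul, norm_inv, Real.norm_eq_abs] at h3
      rw [le_div_iff₀ hh]
      have h5 : 0 < |s| := abs_pos.2 h0
      rw [inv_mul_eq_div, le_div_iff₀ h5] at h3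
      linarith
  have ht0 : 0 ≤ t := (norm_nonneg _).trans (ht 0)
  let a : (Fin n → ℝ) →ᵃ[ℝ] W :=
    ∑ i, (LinearMap.toSpanSingleton ℝ W (u i)).toAffineMap.comp (b.coord i)
  have ha : ∀ y, a y = ∑ i, b.coord i y • u i := by
    intro y
    have h : ∀ s : Finset (Fin (n + 1)),
        (∑ i ∈ s, (LinearMap.toSpanSingleton ℝ W (u i)).toAffineMap.comp (b.coord i)) y =
          ∑ i ∈ s, b.coord i y • u i := by
      intro s
      induction s using Finset.induction_on with
      | empty => simp
      | insert i s hi ih => rw [Finset.sum_insert hi, Finset.sum_insert hi, ← ih]; simp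
    exact h _
  have hal : ∀ w, a.linear w = ∑ i, (b.coord i).linear w • u i := by
    intro w
    have h1 : a.linear w = a w - a 0 := by rw [apply_sub_apply, sub_zero]
    rw [h1, ha, ha, ← Finset.sum_sub_distrib]
    refine Finset.sum_congr rfl fun i _ => ?_
    rw [← sub_smul]
    congr 1
    have := (b.coord i).linearMap_vsub w 0
    simp only [vsub_eq_sub, sub_zero] at this
    exact this.symm
  refine ⟨a, fun i => ?_, fun i => ?_, fun y d hd => ?_⟩
  · rw [ha, ← hbv, Finset.sum_eq_single i]
    · simp
    · intro j _ hj; rw [b.coord_apply_ne hj, zero_smul]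
    · simp
  · rw [hal]
    calc ‖∑ i', (b.coord i').linear (Pi.single i 1) • u i'‖
        ≤ ∑ i', ‖(b.coord i').linear (Pi.single i 1) • u i'‖ := norm_sum_le _ _
      _ ≤ ∑ _i' : Fin (n + 1), (1 / h) * t := by
          refine Finset.sum_le_sum fun i' _ => ?_
          rw [norm_smul, Real.norm_eq_abs]
          refine mul_le_mul ((hcoord _ _).trans ?_) (ht i') (norm_nonneg _) (by positivity)
          gcongr
          rw [pi_norm_le_iff_of_nonneg zero_le_one]
          intro i''
          by_cases hi : i'' = i
          · subst hi; simp
          · simp [hi]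
      _ = (n + 1) * t / h := by simp; ring
  · rw [ha]
    have hd0 : 0 ≤ d := (norm_nonneg _).trans (hd 0)
    calc ‖∑ i', b.coord i' y • u i'‖
        ≤ ∑ i', ‖b.coord i' y • u i'‖ := norm_sum_le _ _
      _ ≤ ∑ _i' : Fin (n + 1), (1 + d / h) * t := by
          refine Finset.sum_le_sum fun i' _ => ?_
          rw [norm_smul, Real.norm_eq_abs]
          refine mul_le_mul ?_ (ht i') (norm_nonneg _) (by positivity)
          have h1 : b.coord i' y = 1 + (b.coord i').linear (y - v i') := by
            have := (b.coord i').linearMap_vsub y (v i')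
            simp only [vsub_eq_sub] at this
            rw [this, ← hbv, b.coord_apply_eq]; ring
          rw [h1]
          refine (abs_add_le _ _).trans ?_
          rw [abs_one]
          have := (hcoord i' (y - v i')).trans (div_le_div_of_nonneg_right (hd i') hh.le)
          linarith
      _ = (n + 1) * t * (1 + d / h) := by simp; ring

end Interpolation

section Fat

variable {N n : ℕ} {W : Type*} [NormedAddCommGroup W] [NormedSpace ℝ W]

/-- Neighbourhoods of the affine span of `n` points carry little mass in a window. -/
lemma measure_infDist_lt_le (hn : 1 ≤ n) (S : Splitting N n W)
    {μ : Measure (EuclideanSpace ℝ (Fin N))} [IsFiniteMeasure μ] {C₀ : ℝ} (hC₀ : 0 ≤ C₀)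
    (hμ : ∀ c r, 0 ≤ r → μ (closedBall c r) ≤ ENNReal.ofReal (C₀ * (2 * r) ^ n))
    {a : (Fin n → ℝ) →ᵃ[ℝ] W} (ha : SlopeLE a 1) {j : ℕ} {k : Fin n → ℤ} {M : ℕ} (hM : 0 < M)
    {r : ℝ} (hr : r ≤ side j / M) {V : Set (Fin n → ℝ)} (hV : V.Nonempty) (hVf : V.Finite)
    (hVc : V.ncard ≤ n) :
    μ (win S a r j k ∩ {x | infDist (S.p x) (affineSpan ℝ V : Set (Fin n → ℝ)) <
      side j / (n * M)}) ≤ ENNReal.ofReal (slabConst n C₀ * side j ^ n / M) := by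
  have hn0 : (0 : ℝ) < n := by exact_mod_cast hn
  have hMR : (0 : ℝ) < M := by exact_mod_cast hM
  have hlt : vectorSpan ℝ V < ⊤ := by
    rw [lt_top_iff_ne_top]
    intro h
    obtain ⟨v₀, hv₀⟩ := hV
    have hc := Set.ncard_pos hVf |>.2 ⟨v₀, hv₀⟩
    have h2 : Module.finrank ℝ (vectorSpan ℝ V) ≤ n - 1 := by
      classical
      have h3 := finrank_vectorSpan_image_finset_le ℝ (id : (Fin n → ℝ) → _) hVf.toFinset
        (n := V.ncard - 1) (by rw [← Set.ncard_eq_toFinset_card V hVf]; omega)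
      have e : ((hVf.toFinset.image id : Finset (Fin n → ℝ)) : Set (Fin n → ℝ)) = V := by simp
      rw [e] at h3
      omega
    rw [h] at h2
    simp at h2
    omega
  obtain ⟨f, hf0, hfk⟩ := Submodule.exists_le_ker_of_lt_top _ hlt
  obtain ⟨v₀, hv₀⟩ := hV
  let g : (Fin n → ℝ) →ᵃ[ℝ] ℝ := f.toAffineMap - AffineMap.const ℝ _ (f v₀)
  have hgl : ∀ w, g.linear w = f w := by intro w; simp [g]
  have hg0 : ∀ z ∈ affineSpan ℝ V, g z = 0 := by
    intro z hz
    have h1 : z - v₀ ∈ vectorSpan ℝ V := by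
      have := AffineSubspace.vsub_mem_direction hz (subset_affineSpan ℝ V hv₀)
      rwa [direction_affineSpan, vsub_eq_sub] at this
    have h2 := LinearMap.mem_ker.1 (hfk h1)
    rw [map_sub] at h2
    simpa [g] using h2
  have : Nonempty (Fin n) := ⟨⟨0, hn⟩⟩
  obtain ⟨i, hi⟩ := Finite.exists_max fun i => ‖g.linear (Pi.single i 1)‖
  have hslope : SlopeLE g ‖g.linear (Pi.single i 1)‖ := hi
  have hpos : 0 < ‖g.linear (Pi.single i 1)‖ := by
    by_contra hcon
    apply hf0
    ext i'
    have h1 : ‖g.linear (Pi.single i' 1)‖ ≤ 0 := (hi i').trans (not_lt.1 hcon)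
    rw [hgl] at h1
    simpa using h1
  refine le_trans (measure_mono ?_) (measure_slab_le S hC₀ hμ ha hM hr g hpos i rfl hslope (k := k))
  rintro x ⟨hx, hx'⟩
  refine ⟨hx, ?_⟩
  obtain ⟨z, hz, hd⟩ := (infDist_lt_iff ((affineSpan_nonempty ℝ).2 ⟨v₀, hv₀⟩)).1 hx'
  have h1 := norm_apply_sub_le hslope (S.p x) z
  rw [hg0 z hz, sub_zero, ← dist_eq_norm] at h1
  refine h1.trans ?_
  calc n * ‖g.linear (Pi.single i 1)‖ * dist (S.p x) z
      ≤ n * ‖g.linear (Pi.single i 1)‖ * (side j / (n * M)) := by gcongr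
    _ = ‖g.linear (Pi.single i 1)‖ * side j / M := by field_simp

/-- Tuples of points of a window whose projections form a fat simplex. -/
def fatSet (S : Splitting N n W) (a : (Fin n → ℝ) →ᵃ[ℝ] W) (r : ℝ) (j : ℕ) (k : Fin n → ℤ)
    (M : ℕ) : Set (Fin (n + 1) → EuclideanSpace ℝ (Fin N)) :=
  {y | (∀ i, y i ∈ win S a r j k) ∧ ∀ i, side j / (n * M) ≤ infDist (S.p (y i))
    (affineSpan ℝ ((fun i' => S.p (y i')) '' ({i}ᶜ : Set (Fin (n + 1)))) : Set (Fin n → ℝ))}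

/-- Most tuples of points of a window of substantial mass are fat. -/
lemma le_measure_fatSet (hn : 1 ≤ n) (S : Splitting N n W)
    {μ : Measure (EuclideanSpace ℝ (Fin N))} [IsFiniteMeasure μ] {C₀ : ℝ} (hC₀ : 0 ≤ C₀)
    (hμ : ∀ c r, 0 ≤ r → μ (closedBall c r) ≤ ENNReal.ofReal (C₀ * (2 * r) ^ n))
    {a : (Fin n → ℝ) →ᵃ[ℝ] W} (ha : SlopeLE a 1) {j : ℕ} {k : Fin n → ℤ} {M : ℕ} (hM : 0 < M)
    {r : ℝ} (hr : r ≤ side j / M) {δ : ℝ} (hδ : 0 < δ)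
    (hMδ : slabConst n C₀ / M ≤ δ / (2 * (n + 1)))
    (hdens : ENNReal.ofReal (δ * side j ^ n) ≤ μ (win S a r j k)) :
    ENNReal.ofReal ((δ * side j ^ n) ^ (n + 1) / 2) ≤
      Measure.pi (fun _ : Fin (n + 1) => μ) (fatSet S a r j k M) := by
  set l := side j with hl
  have hlpos : 0 < l := side_pos j
  set Wd := win S a r j k with hWd
  have hWm : MeasurableSet Wd := measurableSet_win ..
  set ν := Measure.pi (fun _ : Fin (n + 1) => μ) with hν
  let thin : Fin (n + 1) → Set (Fin (n + 1) → EuclideanSpace ℝ (Fin N)) := fun i =>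
    {y | infDist (S.p (y i)) (affineSpan ℝ ((fun i' => S.p (y i')) '' ({i}ᶜ : Set (Fin (n + 1)))) :
      Set (Fin n → ℝ)) < l / (n * M)}
  have hthin : ∀ i, MeasurableSet (thin i) := by
    intro i
    have h1 := isOpen_height_lt (E := Fin n → ℝ) hn i (l / (n * M))
    have h2 : Continuous fun (y : Fin (n + 1) → EuclideanSpace ℝ (Fin N)) (i' : Fin (n + 1)) =>
        S.p (y i') := by fun_prop
    exact (h1.preimage h2).measurableSet
  let P : Set (Fin (n + 1) → EuclideanSpace ℝ (Fin N)) := Set.univ.pi fun _ => Wd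
  have hP : MeasurableSet P := MeasurableSet.univ_pi fun _ => hWm
  have hνP : ν P = μ Wd ^ (n + 1) := by rw [hν, Measure.pi_pi]; simp
  have hbad : ∀ i, ν (P ∩ thin i) ≤ ENNReal.ofReal (slabConst n C₀ * l ^ n / M) * μ Wd ^ n := by
    intro i
    have hmp := measurePreserving_piFinSuccAbove (fun _ : Fin (n + 1) => μ) i
    have h1 := hmp.symm.measure_preimage (hP.inter (hthin i)).nullMeasurableSet
    rw [← h1, Measure.prod_apply_symm
      ((MeasurableEquiv.measurable _) (hP.inter (hthin i)))]
    let P' : Set (Fin n → EuclideanSpace ℝ (Fin N)) := Set.univ.pi fun _ => Wd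
    have hP' : MeasurableSet P' := MeasurableSet.univ_pi fun _ => hWm
    calc _ ≤ ∫⁻ y : Fin n → EuclideanSpace ℝ (Fin N), P'.indicator
            (fun _ => ENNReal.ofReal (slabConst n C₀ * l ^ n / M)) y
            ∂(Measure.pi fun _ : Fin n => μ) := by
          refine lintegral_mono fun y => ?_
          by_cases hy : y ∈ P'
          · rw [Set.indicator_of_mem hy]
            have himg : ∀ x : EuclideanSpace ℝ (Fin N),
                (fun i' => S.p ((i.insertNth x y : Fin (n + 1) → EuclideanSpace ℝ (Fin N)) i')) ''
                ({i}ᶜ : Set (Fin (n + 1))) = Set.range fun i' => S.p (y i') := by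
              intro x
              rw [← Fin.range_succAbove, ← Set.range_comp]
              congr 1
              funext i'
              simp
            have hVn : (Set.range fun i' => S.p (y i')).Nonempty := ⟨_, ⟨⟨0, hn⟩, rfl⟩⟩
            have hVc : (Set.range fun i' => S.p (y i')).ncard ≤ n := by
              rw [← Set.image_univ]
              refine (Set.ncard_image_le Set.finite_univ).trans ?_
              simp
            refine le_trans (measure_mono ?_) (measure_infDist_lt_le hn S hC₀ hμ ha hM hr hVn
              (Set.finite_range _) hVc (k := k))
            rintro x ⟨hx1, hx2⟩
            refine ⟨?_, ?_⟩
            · have h3 : (i.insertNth x y : Fin (n + 1) → EuclideanSpace ℝ (Fin N)) i ∈ Wd :=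
                hx1 i (Set.mem_univ i)
              rwa [Fin.insertNth_apply_same] at h3
            · have h3 : infDist (S.p ((i.insertNth x y : Fin (n + 1) → EuclideanSpace ℝ (Fin N)) i))
                (affineSpan ℝ ((fun i' => S.p ((i.insertNth x y : Fin (n + 1) → EuclideanSpace ℝ (Fin N)) i')) ''
                  ({i}ᶜ : Set (Fin (n + 1)))) : Set (Fin n → ℝ)) < l / (n * M) := hx2
              rw [himg x, Fin.insertNth_apply_same] at h3
              exact h3
          · rw [Set.indicator_of_notMem hy]
            refine le_of_eq ?_
            convert measure_empty (μ := μ)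
            ext x
            simp only [Set.mem_empty_iff_false, iff_false]
            rintro ⟨hx1, -⟩
            refine hy fun i' _ => ?_
            have h3 : (i.insertNth x y : Fin (n + 1) → EuclideanSpace ℝ (Fin N)) (i.succAbove i') ∈
              Wd := hx1 (i.succAbove i') (Set.mem_univ _)
            rwa [Fin.insertNth_apply_succAbove] at h3
      _ = _ := by
          rw [lintegral_indicator_const hP', Measure.pi_pi]; simp
  have hsub : P \ (⋃ i, P ∩ thin i) ⊆ fatSet S a r j k M := by
    rintro y ⟨hy, hy'⟩
    refine ⟨fun i => hy i (Set.mem_univ i), fun i => ?_⟩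
    by_contra hcon
    exact hy' (Set.mem_iUnion.2 ⟨i, hy, not_le.1 hcon⟩)
  have hunion : ν (⋃ i, P ∩ thin i) ≤ ENNReal.ofReal (1 / 2) * μ Wd ^ (n + 1) := by
    calc ν (⋃ i, P ∩ thin i) ≤ ∑ i, ν (P ∩ thin i) := measure_iUnion_fintype_le _ _
      _ ≤ ∑ _i : Fin (n + 1), ENNReal.ofReal (slabConst n C₀ * l ^ n / M) * μ Wd ^ n :=
          Finset.sum_le_sum fun i _ => hbad i
      _ = ENNReal.ofReal ((n + 1) * (slabConst n C₀ * l ^ n / M)) * μ Wd ^ n := by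
          rw [Finset.sum_const, nsmul_eq_mul, ← mul_assoc, ENNReal.ofReal_mul (by positivity)]
          congr 2
          simp only [Finset.card_univ, Fintype.card_fin]
          rw [← ENNReal.ofReal_natCast]; push_cast; rfl
      _ ≤ ENNReal.ofReal (1 / 2 * (δ * l ^ n)) * μ Wd ^ n := by
          refine mul_le_mul' (ENNReal.ofReal_le_ofReal ?_) le_rfl
          have h1 : (n + 1) * (slabConst n C₀ * l ^ n / M) =
            (slabConst n C₀ / M) * ((n + 1) * l ^ n) := by ring
          rw [h1]
          calc (slabConst n C₀ / M) * ((n + 1) * l ^ n) ≤ δ / (2 * (n + 1)) * ((n + 1) * l ^ n) := by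
                gcongr
            _ = 1 / 2 * (δ * l ^ n) := by field_simp
      _ ≤ ENNReal.ofReal (1 / 2) * μ Wd ^ (n + 1) := by
          rw [ENNReal.ofReal_mul (by norm_num), pow_succ', mul_assoc]
          gcongr
  calc ENNReal.ofReal ((δ * l ^ n) ^ (n + 1) / 2)
      = ENNReal.ofReal (1 / 2) * ENNReal.ofReal (δ * l ^ n) ^ (n + 1) := by
        rw [← ENNReal.ofReal_pow (by positivity), ← ENNReal.ofReal_mul (by norm_num)]
        congr 1; ring
    _ ≤ ENNReal.ofReal (1 / 2) * μ Wd ^ (n + 1) := by gcongr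
    _ = μ Wd ^ (n + 1) - ENNReal.ofReal (1 / 2) * μ Wd ^ (n + 1) := by
        have hfin : ENNReal.ofReal (1 / 2) * μ Wd ^ (n + 1) ≠ ∞ :=
          ENNReal.mul_ne_top ENNReal.ofReal_ne_top (ENNReal.pow_ne_top (measure_ne_top _ _))
        have h1 : ENNReal.ofReal (1 / 2) * μ Wd ^ (n + 1) + ENNReal.ofReal (1 / 2) * μ Wd ^ (n + 1)
            = μ Wd ^ (n + 1) := by
          rw [← add_mul, ← ENNReal.ofReal_add (by norm_num) (by norm_num)]; norm_num
        exact ENNReal.eq_sub_of_add_eq hfin h1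
    _ ≤ ν P - ν (⋃ i, P ∩ thin i) := by rw [hνP]; exact tsub_le_tsub_left hunion _
    _ ≤ ν (P \ (⋃ i, P ∩ thin i)) := le_measure_sdiff
    _ ≤ ν (fatSet S a r j k M) := measure_mono hsub

end Fat

section Fit

variable {N n : ℕ} {W : Type*} [NormedAddCommGroup W] [NormedSpace ℝ W]

/-- The fatness ratio of the simplices used for the fit. -/
def ratio (n M : ℕ) : ℝ := 24 * n * M

/-- The tuples that enter the energy attached to the cube `(j, k)`. -/
def tupleSet (S : Splitting N n W) (C : ℝ) (j : ℕ) (k : Fin n → ℤ) :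
    Set (Fin (n + 2) → EuclideanSpace ℝ (Fin N)) :=
  {z | idx j (S.p (z 0)) = k ∧ IsHSimplex N (side j / C) (Fin.init z : Fin (n + 1) → _) ∧
    ∀ i, z i ∈ closedBall (z 0) (C * side j)}

lemma measurableSet_tupleSet (hn : 1 ≤ n) (S : Splitting N n W) (C : ℝ) (j : ℕ) (k : Fin n → ℤ) :
    MeasurableSet (tupleSet S C j k) := by
  refine MeasurableSet.inter ?_ (MeasurableSet.inter ?_ ?_)
  · have h1 : Measurable fun z : Fin (n + 2) → EuclideanSpace ℝ (Fin N) => idx j (S.p (z 0)) :=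
      (measurable_idx j).comp (S.p.continuous.measurable.comp (measurable_pi_apply 0))
    exact h1 (measurableSet_singleton k)
  · have h1 : {z : Fin (n + 2) → EuclideanSpace ℝ (Fin N) |
        IsHSimplex N (side j / C) (Fin.init z : Fin (n + 1) → _)} =
        ⋂ i : Fin (n + 1), ((fun z (i' : Fin (n + 1)) => z i'.castSucc) ⁻¹'
          {x : Fin (n + 1) → EuclideanSpace ℝ (Fin N) | infDist (x i)
            (affineSpan ℝ (x '' ({i}ᶜ : Set (Fin (n + 1)))) : Set _) < side j / C})ᶜ := by
      ext z
      simp only [IsHSimplex, Set.mem_ofPred_eq, Set.mem_iInter, Set.mem_compl_iff,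
        Set.mem_preimage, not_lt]
      rfl
    change MeasurableSet {z : Fin (n + 2) → EuclideanSpace ℝ (Fin N) |
        IsHSimplex N (side j / C) (Fin.init z : Fin (n + 1) → _)}
    rw [h1]
    refine MeasurableSet.iInter fun i => MeasurableSet.compl ?_
    refine ((isOpen_height_lt hn i _).preimage ?_).measurableSet
    fun_prop
  · have h1 : {z : Fin (n + 2) → EuclideanSpace ℝ (Fin N) |
        ∀ i, z i ∈ closedBall (z 0) (C * side j)} =
        ⋂ i, {z | dist (z i) (z 0) ≤ C * side j} := by
      ext z; simp
    change MeasurableSet {z : Fin (n + 2) → EuclideanSpace ℝ (Fin N) |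
        ∀ i, z i ∈ closedBall (z 0) (C * side j)}
    rw [h1]
    refine MeasurableSet.iInter fun i => (isClosed_le ?_ continuous_const).measurableSet
    fun_prop

/-- The part of the Menger energy attached to the cube `(j, k)`. -/
def cubeEnergy (S : Splitting N n W) (C : ℝ) (K : (Fin (n + 2) → EuclideanSpace ℝ (Fin N)) → ℝ)
    (μ : Measure (EuclideanSpace ℝ (Fin N))) (j : ℕ) (k : Fin n → ℤ) : ℝ≥0∞ :=
  ∫⁻ z in tupleSet S C j k, ENNReal.ofReal (K z ^ (2 : ℝ)) ∂(Measure.pi fun _ => μ)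

/-- Choice of a fat simplex with small local energy. -/
lemma exists_mem_fatSet_lintegral_le (hn : 1 ≤ n) (S : Splitting N n W)
    {μ : Measure (EuclideanSpace ℝ (Fin N))} [IsFiniteMeasure μ]
    {K : (Fin (n + 2) → EuclideanSpace ℝ (Fin N)) → ℝ}
    (hK : AEMeasurable K (Measure.pi fun _ : Fin (n + 2) => μ))
    {a : (Fin n → ℝ) →ᵃ[ℝ] W} {j : ℕ} {k : Fin n → ℤ} {M : ℕ} {r C m : ℝ} (hm : 0 < m)
    (hF : ENNReal.ofReal m ≤ Measure.pi (fun _ : Fin (n + 1) => μ) (fatSet S a r j k M))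
    (hC : side j / C ≤ side j / (n * M))
    (hball : ∀ x ∈ win S a r j k, ∀ y ∈ win S a r j k, dist x y ≤ C * side j) :
    ∃ y ∈ fatSet S a r j k M, IsHSimplex N (side j / C) y ∧
      ∫⁻ w in closedBall (y 0) (C * side j), ENNReal.ofReal (K (Fin.snoc y w) ^ (2 : ℝ)) ∂μ ≤
        cubeEnergy S C K μ j k / ENNReal.ofReal m := by
  set ν := Measure.pi (fun _ : Fin (n + 1) => μ) with hν
  set F := fatSet S a r j k M with hFdef
  set f : (Fin (n + 2) → EuclideanSpace ℝ (Fin N)) → ℝ≥0∞ :=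
    (tupleSet S C j k).indicator fun z => ENNReal.ofReal (K z ^ (2 : ℝ)) with hf
  have hfm : AEMeasurable f (Measure.pi fun _ : Fin (n + 2) => μ) :=
    ((hK.pow_const _).ennreal_ofReal).indicator (measurableSet_tupleSet hn S C j k)
  have hmp := (measurePreserving_piFinSuccAbove (fun _ : Fin (n + 2) => μ) (Fin.last (n + 1))).symm
  have hsnoc : ∀ (w : EuclideanSpace ℝ (Fin N)) (y : Fin (n + 1) → EuclideanSpace ℝ (Fin N)),
      (MeasurableEquiv.piFinSuccAbove (fun _ : Fin (n + 2) => EuclideanSpace ℝ (Fin N))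
        (Fin.last (n + 1))).symm (w, y) = Fin.snoc y w := by
    intro w y
    exact Fin.insertNth_last' w y
  have hfm' := hfm.comp_quasiMeasurePreserving hmp.quasiMeasurePreserving
  have hen : ∫⁻ y, ∫⁻ w, f (Fin.snoc y w) ∂μ ∂ν = cubeEnergy S C K μ j k := by
    rw [cubeEnergy, ← lintegral_indicator (measurableSet_tupleSet hn S C j k), ← hf,
      ← hmp.lintegral_comp_emb (MeasurableEquiv.measurableEmbedding _)]
    have h2 := lintegral_prod_symm (μ := μ) (ν := ν) _ hfm'
    simp only [Function.comp_def, hsnoc] at h2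
    rw [← h2]
    exact lintegral_congr fun z => by rw [← hsnoc]
  have hgm : AEMeasurable (fun y => ∫⁻ w, f (Fin.snoc y w) ∂μ) ν := by
    have h2 := hfm'.prod_swap.lintegral_prod_right'
    simp only [Function.comp_def, Prod.swap_prod_mk, hsnoc] at h2
    exact h2
  have hmpos : 0 < ENNReal.ofReal m := ENNReal.ofReal_pos.2 hm
  have hF0 : ν F ≠ 0 := (hmpos.trans_le hF).ne'
  obtain ⟨y, hyF, hy⟩ := exists_le_setLAverage hF0 (measure_ne_top ν F) hgm.restrict
  have hsimp : IsHSimplex N (side j / C) y := by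
    intro i
    exact hC.trans ((hyF.2 i).trans (height_map_le hn S.p S.norm_p_le y i))
  refine ⟨y, hyF, hsimp, ?_⟩
  calc ∫⁻ w in closedBall (y 0) (C * side j), ENNReal.ofReal (K (Fin.snoc y w) ^ (2 : ℝ)) ∂μ
      ≤ ∫⁻ w in closedBall (y 0) (C * side j), f (Fin.snoc y w) ∂μ := by
        refine setLIntegral_mono' measurableSet_closedBall fun w hw => ?_
        have h0 : (Fin.snoc y w : Fin (n + 2) → EuclideanSpace ℝ (Fin N)) 0 = y 0 := by
          exact Fin.snoc_castSucc (α := fun _ => EuclideanSpace ℝ (Fin N)) w y 0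
        have hmem : (Fin.snoc y w : Fin (n + 2) → EuclideanSpace ℝ (Fin N)) ∈ tupleSet S C j k := by
          refine ⟨?_, ?_, fun i => ?_⟩
          · rw [h0]; exact (hyF.1 0).1
          · rw [Fin.init_snoc]; exact hsimp
          · rw [h0]
            refine Fin.lastCases ?_ (fun i => ?_) i
            · rw [Fin.snoc_last]; exact hw
            · rw [Fin.snoc_castSucc]; exact hball _ (hyF.1 i) _ (hyF.1 0)
        rw [hf, Set.indicator_of_mem hmem]
    _ ≤ ∫⁻ w, f (Fin.snoc y w) ∂μ := setLIntegral_le_lintegral _ _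
    _ ≤ (∫⁻ y in F, ∫⁻ w, f (Fin.snoc y w) ∂μ ∂ν) / ν F := by
        rw [setLAverage_eq] at hy; exact hy
    _ ≤ cubeEnergy S C K μ j k / ENNReal.ofReal m := by
        refine ENNReal.div_le_div ?_ hF
        rw [← hen]
        exact setLIntegral_le_lintegral _ _

/-- The constant of the fit. -/
def fitConst (n M : ℕ) (δ c lam : ℝ) : ℝ :=
  (1 + 2 * n) ^ 2 * (c * ratio n M ^ lam) * (2 / δ ^ (n + 1))

/-- A window of substantial mass has an affine fit controlled by the energy of its cube. -/
lemma exists_fit (hn : 1 ≤ n) (S : Splitting N n W)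
    {μ : Measure (EuclideanSpace ℝ (Fin N))} [IsFiniteMeasure μ] {C₀ : ℝ} (hC₀ : 0 ≤ C₀)
    (hμ : ∀ c r, 0 ≤ r → μ (closedBall c r) ≤ ENNReal.ofReal (C₀ * (2 * r) ^ n))
    {K : (Fin (n + 2) → EuclideanSpace ℝ (Fin N)) → ℝ}
    (hK : AEMeasurable K (Measure.pi fun _ : Fin (n + 2) => μ)) {c lam : ℝ} (hc : 0 ≤ c)
    (hprop : ∀ t : ℝ, 0 < t → ∀ C : ℝ, 1 ≤ C → ∀ x : EuclideanSpace ℝ (Fin N),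
      ∀ y : Fin (n + 1) → EuclideanSpace ℝ (Fin N),
        IsHSimplex N (t / C) y →
        convexHull ℝ (Set.range y) ⊆ Metric.closedBall x (C * t) →
        ∀ w ∈ Metric.closedBall x (C * t),
          (Metric.infDist w (affineSpan ℝ (Set.range y) : Set (EuclideanSpace ℝ (Fin N))) / t) ^
            (2 : ℝ) ≤ c * C ^ lam * t ^ (n * (n + 1)) * K (Fin.snoc y w) ^ (2 : ℝ))
    {a : (Fin n → ℝ) →ᵃ[ℝ] W} (ha : SlopeLE a 1) {j : ℕ} {k : Fin n → ℤ} {M : ℕ} (hM : 0 < M)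
    {r : ℝ} (hr0 : 0 ≤ r) (hr : 2 * (n + 1) * n * M * r ≤ side j) {δ : ℝ} (hδ : 0 < δ)
    (hMδ : slabConst n C₀ / M ≤ δ / (2 * (n + 1)))
    (hdens : ENNReal.ofReal (δ * side j ^ n) ≤ μ (win S a r j k)) :
    ∃ b : (Fin n → ℝ) →ᵃ[ℝ] W,
      (∀ x ∈ win S a r j k, ∫⁻ w in closedBall x (20 * n * side j),
        ENNReal.ofReal (‖S.q w - b (S.p w)‖ ^ 2) ∂μ ≤
          ENNReal.ofReal (fitConst n M δ c lam * side j ^ 2) *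
            cubeEnergy S (ratio n M) K μ j k) ∧
      ∀ y, idx j y = k → ‖b y - a y‖ ≤ side j := by
  set l := side j with hl
  have hlpos : 0 < l := side_pos j
  have hn1 : (1 : ℝ) ≤ n := by exact_mod_cast hn
  have hM1 : (1 : ℝ) ≤ M := by exact_mod_cast hM
  have hnM : (1 : ℝ) ≤ n * M := one_le_mul_of_one_le_of_one_le hn1 hM1
  have hr4 : 4 * r ≤ l := by
    calc 4 * r = 2 * (1 + 1) * 1 * 1 * r := by ring
      _ ≤ 2 * (n + 1) * n * M * r := by gcongr
      _ ≤ l := hr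
  have hrM : r ≤ l / M := by
    rw [le_div_iff₀ (by linarith)]
    calc r * M = 1 * 1 * M * r := by ring
      _ ≤ 2 * (n + 1) * n * M * r := by gcongr; linarith
      _ ≤ l := hr
  set C := ratio n M with hCdef
  have hCn : 24 * (n : ℝ) ≤ C := by
    rw [hCdef, ratio]; nlinarith
  have hCpos : 0 < C := by linarith
  have hball : ∀ x ∈ win S a r j k, ∀ y ∈ win S a r j k, dist x y ≤ 3 * n * l := by
    intro x hx y hy
    rw [dist_eq_norm]
    have h1 := norm_sub_le_of_gap S ha hx.2 hy.2
    have h2 := norm_sub_le_of_idx (hx.1.trans hy.1.symm)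
    have h3 : 2 * n * ‖S.p x - S.p y‖ ≤ 2 * n * l := by gcongr
    nlinarith
  have hm : 0 < (δ * l ^ n) ^ (n + 1) / 2 := by positivity
  obtain ⟨y, hyF, hys, hyint⟩ := exists_mem_fatSet_lintegral_le hn S hK hm
    (le_measure_fatSet hn S hC₀ hμ ha hM hrM hδ hMδ hdens) (C := C)
    (by
      rw [hCdef, ratio]
      gcongr
      nlinarith)
    (fun x hx y hy => (hball x hx y hy).trans (by gcongr; linarith))
  have hσ : 0 < l / (n * M) := by positivity
  obtain ⟨g, hgv, hgs, hgb⟩ := exists_affine_interpolation (fun i => S.p (y i)) hσ hyF.2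
    (fun i => S.q (y i) - a (S.p (y i))) (fun i => (hyF.1 i).2)
  let b := a + g
  have hbl : ∀ w, b.linear w = a.linear w + g.linear w := by intro w; simp [b]
  have hbs : SlopeLE b 2 := by
    intro i
    rw [hbl]
    refine (norm_add_le _ _).trans ?_
    have h1 := ha i
    have h2 := hgs i
    have h3 : (n + 1) * r / (l / (n * M)) ≤ 1 / 2 := by
      rw [div_le_iff₀ hσ, div_mul_div_comm, one_mul, le_div_iff₀ (by positivity)]
      linarith
    linarith
  have hbv : ∀ i, S.q (y i) = b (S.p (y i)) := by
    intro i
    have h : b (S.p (y i)) = a (S.p (y i)) + g (S.p (y i)) := rfl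
    rw [h, hgv i]; abel
  have hspan : ∀ z ∈ affineSpan ℝ (Set.range y), S.q z = b (S.p z) := by
    intro z hz
    refine affineSpan_induction (p := fun z => S.q z = b (S.p z)) hz ?_ ?_
    · rintro _ ⟨i, rfl⟩; exact hbv i
    · intro s u v w hu hv hw
      have h1 : b (S.p (s • (u -ᵥ v) +ᵥ w)) - b (S.p w) =
          s • (b (S.p u) - b (S.p v)) := by
        rw [apply_sub_apply, apply_sub_apply, ← map_smul]
        congr 1
        simp [vsub_eq_sub, vadd_eq_add, map_add, map_smul, map_sub]
      have h2 : b (S.p (s • (u -ᵥ v) +ᵥ w)) = s • (b (S.p u) - b (S.p v)) + b (S.p w) := by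
        rw [← h1]; abel
      rw [h2, ← hu, ← hv, ← hw]
      simp [vsub_eq_sub, vadd_eq_add, map_add, map_smul, map_sub]
  have hdist : ∀ w, ‖S.q w - b (S.p w)‖ ≤
      (1 + 2 * n) * infDist w (affineSpan ℝ (Set.range y) : Set (EuclideanSpace ℝ (Fin N))) := by
    intro w
    have hne : ((affineSpan ℝ (Set.range y) : Set (EuclideanSpace ℝ (Fin N)))).Nonempty :=
      (affineSpan_nonempty ℝ).2 (Set.range_nonempty y)
    rw [← div_le_iff₀' (by positivity)]
    refine (le_infDist hne).2 fun z hz => ?_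
    rw [div_le_iff₀' (by positivity), dist_eq_norm]
    have h1 : S.q w - b (S.p w) = S.q (w - z) - (b (S.p w) - b (S.p z)) := by
      rw [map_sub, hspan z hz]; abel
    rw [h1]
    refine (norm_sub_le _ _).trans ?_
    have h2 := S.norm_q_le (w - z)
    have h3 := norm_apply_sub_le hbs (S.p w) (S.p z)
    have h4 := S.norm_p_le (w - z)
    rw [map_sub] at h4
    have h5 : (n : ℝ) * 2 * ‖S.p w - S.p z‖ ≤ n * 2 * ‖w - z‖ := by gcongr
    linarith
  refine ⟨b, fun x hx => ?_, fun z hz => ?_⟩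
  · have hy0 := hyF.1 0
    have hsub : closedBall x (20 * n * l) ⊆ closedBall (y 0) (C * l) := by
      refine closedBall_subset_closedBall' ?_
      have := hball x hx _ hy0
      nlinarith
    have hhull : convexHull ℝ (Set.range y) ⊆ closedBall (y 0) (C * l) := by
      refine convexHull_min ?_ (convex_closedBall _ _)
      rintro _ ⟨i, rfl⟩
      refine (hball _ (hyF.1 i) _ hy0).trans ?_
      gcongr; linarith
    set A : ℝ := (1 + 2 * n) ^ 2 * l ^ 2 * (c * C ^ lam * l ^ (n * (n + 1))) with hA
    have hA0 : 0 ≤ A := by positivity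
    calc ∫⁻ w in closedBall x (20 * n * l), ENNReal.ofReal (‖S.q w - b (S.p w)‖ ^ 2) ∂μ
        ≤ ∫⁻ w in closedBall (y 0) (C * l), ENNReal.ofReal (‖S.q w - b (S.p w)‖ ^ 2) ∂μ :=
          lintegral_mono_set hsub
      _ ≤ ∫⁻ w in closedBall (y 0) (C * l), ENNReal.ofReal A *
            ENNReal.ofReal (K (Fin.snoc y w) ^ (2 : ℝ)) ∂μ := by
          refine setLIntegral_mono' measurableSet_closedBall fun w hw => ?_
          rw [← ENNReal.ofReal_mul hA0]
          apply ENNReal.ofReal_le_ofReal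
          have h1 := hprop l hlpos C (by linarith) (y 0) y hys hhull w hw
          rw [Real.rpow_two, div_pow, div_le_iff₀ (by positivity)] at h1
          calc ‖S.q w - b (S.p w)‖ ^ 2 ≤ ((1 + 2 * n) * infDist w
                (affineSpan ℝ (Set.range y) : Set (EuclideanSpace ℝ (Fin N)))) ^ 2 := by
                gcongr; exact hdist w
            _ ≤ (1 + 2 * n) ^ 2 * (c * C ^ lam * l ^ (n * (n + 1)) *
                K (Fin.snoc y w) ^ (2 : ℝ) * l ^ 2) := by rw [mul_pow]; gcongr
            _ = _ := by rw [hA]; ring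
      _ = ENNReal.ofReal A * ∫⁻ w in closedBall (y 0) (C * l),
            ENNReal.ofReal (K (Fin.snoc y w) ^ (2 : ℝ)) ∂μ :=
          lintegral_const_mul' _ _ ENNReal.ofReal_ne_top
      _ ≤ ENNReal.ofReal A * (cubeEnergy S C K μ j k /
            ENNReal.ofReal ((δ * l ^ n) ^ (n + 1) / 2)) := by gcongr
      _ = ENNReal.ofReal (fitConst n M δ c lam * l ^ 2) * cubeEnergy S C K μ j k := by
          rw [div_eq_mul_inv, mul_comm (cubeEnergy S C K μ j k), ← mul_assoc,
            ← ENNReal.ofReal_inv_of_pos hm, ← ENNReal.ofReal_mul hA0]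
          congr 2
          rw [hA, fitConst, mul_pow, ← pow_mul, ← hCdef]
          field_simp
  · have h1 : b z - a z = g z := by simp [b]
    rw [h1]
    refine (hgb z l fun i => ?_).trans ?_
    · exact norm_sub_le_of_idx (hz.trans (hyF.1 i).1.symm)
    · have h2 : l / (l / (n * M)) = n * M := by field_simp
      rw [h2]
      nlinarith

end Fit

section Overlap

variable {N n : ℕ} {W : Type*} [NormedAddCommGroup W] [NormedSpace ℝ W]

lemma side_div_le_dist_of_mem_tupleSet (hn : 1 ≤ n) {S : Splitting N n W} {C : ℝ} {j : ℕ}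
    {k : Fin n → ℤ} {z : Fin (n + 2) → EuclideanSpace ℝ (Fin N)} (hz : z ∈ tupleSet S C j k) :
    side j / C ≤ dist (z 1) (z 0) ∧ dist (z 1) (z 0) ≤ C * side j := by
  refine ⟨?_, hz.2.2 1⟩
  refine (hz.2.1 0).trans ?_
  rw [dist_comm]
  have : NeZero n := ⟨by omega⟩
  have h1 : z 1 ∈ affineSpan ℝ ((Fin.init z : Fin (n + 1) → _) '' ({0}ᶜ : Set (Fin (n + 1)))) := by
    refine subset_affineSpan ℝ _ ⟨⟨1, by omega⟩, ?_, ?_⟩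
    · simp [Fin.ext_iff]
    · exact congrArg z (Fin.ext (by simp))
  exact infDist_le_dist_of_mem h1

lemma generation_lt_of_mem_tupleSet (hn : 1 ≤ n) {S : Splitting N n W} {C : ℝ} (hC : 0 < C)
    {m : ℕ} (hm : C ^ 2 < 2 ^ m) {j j' : ℕ} {k k' : Fin n → ℤ}
    {z : Fin (n + 2) → EuclideanSpace ℝ (Fin N)} (hz : z ∈ tupleSet S C j k)
    (hz' : z ∈ tupleSet S C j' k') : j' < j + m := by
  by_contra hcon
  have h1 := (side_div_le_dist_of_mem_tupleSet hn hz).1.trans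
    (side_div_le_dist_of_mem_tupleSet hn hz').2
  rw [div_le_iff₀ hC] at h1
  obtain ⟨d, rfl⟩ : ∃ d, j' = j + m + d := ⟨j' - (j + m), by omega⟩
  have h2 : side (j + m + d) = side j * (side m * side d) := by
    simp only [side, pow_add, mul_inv]; ring
  have h3 := side_le_one d
  have h4 := two_pow_mul_side m
  rw [h2] at h1
  have h5 : side m * C ^ 2 < 1 := by
    rw [← h4, mul_comm]
    exact mul_lt_mul_of_pos_right hm (side_pos m)
  have h6 : C * (side j * (side m * side d)) * C ≤ side j * (side m * C ^ 2) := by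
    have : C * (side j * (side m * side d)) * C = side j * (side m * C ^ 2) * side d := by ring
    rw [this]
    refine mul_le_of_le_one_right ?_ h3
    have := side_pos j; have := side_pos m; positivity
  have h7 : side j * (side m * C ^ 2) < side j := by
    have := side_pos j
    nlinarith
  linarith

/-- The cube energies have bounded overlap. -/
lemma sum_cubeEnergy_le (hn : 1 ≤ n) (S : Splitting N n W) {C : ℝ} (hC : 0 < C) {m : ℕ}
    (hm : C ^ 2 < 2 ^ m) {K : (Fin (n + 2) → EuclideanSpace ℝ (Fin N)) → ℝ}
    {μ : Measure (EuclideanSpace ℝ (Fin N))}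
    (hK : AEMeasurable K (Measure.pi fun _ : Fin (n + 2) => μ)) (T : Finset (ℕ × (Fin n → ℤ))) :
    ∑ t ∈ T, cubeEnergy S C K μ t.1 t.2 ≤ m * MengerEnergy N n 2 K μ := by
  classical
  have hfm : AEMeasurable (fun z => ENNReal.ofReal (K z ^ (2 : ℝ)))
      (Measure.pi fun _ : Fin (n + 2) => μ) := (hK.pow_const _).ennreal_ofReal
  have h1 : ∀ t ∈ T, cubeEnergy S C K μ t.1 t.2 = ∫⁻ z, (tupleSet S C t.1 t.2).indicator
      (fun z => ENNReal.ofReal (K z ^ (2 : ℝ))) z ∂(Measure.pi fun _ : Fin (n + 2) => μ) :=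
    fun t _ => (lintegral_indicator (measurableSet_tupleSet hn S C t.1 t.2) _).symm
  rw [Finset.sum_congr rfl h1, ← lintegral_finsetSum' _
    fun t _ => hfm.indicator (measurableSet_tupleSet hn S C t.1 t.2), MengerEnergy,
    ← lintegral_const_mul' _ _ (ENNReal.natCast_ne_top m)]
  refine lintegral_mono fun z => ?_
  let T' := T.filter fun t => z ∈ tupleSet S C t.1 t.2
  have h2 : ∑ t ∈ T, (tupleSet S C t.1 t.2).indicator (fun z => ENNReal.ofReal (K z ^ (2 : ℝ))) z =
      T'.card * ENNReal.ofReal (K z ^ (2 : ℝ)) := by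
    rw [← nsmul_eq_mul, ← Finset.sum_const, Finset.sum_filter]
    refine Finset.sum_congr rfl fun t _ => ?_
    rw [Set.indicator_apply]
  rw [h2]
  gcongr
  rcases T'.eq_empty_or_nonempty with h0 | hne
  · rw [h0]; simp
  obtain ⟨t₀, ht₀, hmin⟩ := T'.exists_min_image Prod.fst hne
  have hz₀ := (Finset.mem_filter.1 ht₀).2
  have hinj : Set.InjOn Prod.fst (T' : Set (ℕ × (Fin n → ℤ))) := by
    intro t ht t' ht' h
    have e1 := (Finset.mem_filter.1 ht).2.1
    have e2 := (Finset.mem_filter.1 ht').2.1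
    rw [h] at e1
    exact Prod.ext h (e1.symm.trans e2)
  rw [← Finset.card_image_of_injOn hinj]
  calc (T'.image Prod.fst).card ≤ (Finset.Ico t₀.1 (t₀.1 + m)).card := by
        refine Finset.card_le_card fun j hj => ?_
        obtain ⟨t, ht, rfl⟩ := Finset.mem_image.1 hj
        rw [Finset.mem_Ico]
        exact ⟨hmin t ht, generation_lt_of_mem_tupleSet hn hC hm hz₀ (Finset.mem_filter.1 ht).2⟩
    _ = m := by simp

end Overlap

section Bump

/-- A smooth step from `0` to `1` across `[-1/4, 1/4]`. -/
def step (t : ℝ) : ℝ := Real.smoothTransition (2 * t + 1 / 2)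

/-- A smooth bump whose integer translates form a partition of unity. -/
def bump (t : ℝ) : ℝ := step t - step (t - 1)

lemma contDiff_bump : ContDiff ℝ 2 bump := by
  unfold bump step
  have h : ContDiff ℝ 2 Real.smoothTransition := Real.smoothTransition.contDiff
  fun_prop

lemma step_of_le {t : ℝ} (h : t ≤ -(1 / 4)) : step t = 0 :=
  Real.smoothTransition.zero_of_nonpos (by linarith)

lemma step_of_ge {t : ℝ} (h : 1 / 4 ≤ t) : step t = 1 :=
  Real.smoothTransition.one_of_one_le (by linarith)

lemma bump_nonneg (t : ℝ) : 0 ≤ bump t := by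
  unfold bump
  rcases le_total t (1 / 2) with h | h
  · rw [step_of_le (t := t - 1) (by linarith), sub_zero]
    exact Real.smoothTransition.nonneg _
  · rw [step_of_ge (t := t) (by linarith)]
    exact sub_nonneg.2 (Real.smoothTransition.le_one _)

lemma bump_le_one (t : ℝ) : bump t ≤ 1 := by
  unfold bump step
  have h1 := Real.smoothTransition.le_one (2 * t + 1 / 2)
  have h2 := Real.smoothTransition.nonneg (2 * (t - 1) + 1 / 2)
  linarith

lemma mem_of_bump_ne_zero {t : ℝ} (h : bump t ≠ 0) : -(1 / 4) < t ∧ t < 5 / 4 := by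
  unfold bump at h
  constructor
  · by_contra hc
    apply h
    rw [step_of_le (not_lt.1 hc), step_of_le (by linarith), sub_zero]
  · by_contra hc
    apply h
    rw [step_of_ge (by linarith), step_of_ge (by linarith), sub_self]

lemma sum_bump (t : ℝ) : ∑ m ∈ Finset.Icc (⌊t⌋ - 1) (⌊t⌋ + 1), bump (t - m) = 1 := by
  have h1 := Int.floor_le t
  have h2 := Int.lt_floor_add_one t
  set z := ⌊t⌋
  have h3 : Finset.Icc (z - 1) (z + 1) = {z - 1, z, z + 1} := by
    ext x; simp only [Finset.mem_Icc, Finset.mem_insert, Finset.mem_singleton]; omega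
  rw [h3, Finset.sum_insert (by simp; omega), Finset.sum_insert (by simp), Finset.sum_singleton]
  push_cast
  unfold bump
  have e1 : t - (z - 1 : ℝ) - 1 = t - z := by ring
  have e2 : t - (z + 1 : ℝ) = t - z - 1 := by ring
  rw [e1, e2, step_of_ge (t := t - (z - 1 : ℝ)) (by linarith),
    step_of_le (t := t - z - 1 - 1) (by linarith)]
  ring

/-- First and second differences of the bump. -/
lemma exists_bump_bounds : ∃ L : ℝ, 1 ≤ L ∧ (∀ t h, |bump (t + h) - bump t| ≤ L * |h|) ∧
    ∀ t h, |bump (t + h) - 2 * bump t + bump (t - h)| ≤ L * h ^ 2 := by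
  have hsupp : HasCompactSupport bump := by
    refine HasCompactSupport.intro (isCompact_Icc (a := -(1 / 4 : ℝ)) (b := 5 / 4)) fun t ht => ?_
    by_contra h
    have := mem_of_bump_ne_zero h
    exact ht ⟨this.1.le, this.2.le⟩
  have hd1 : Differentiable ℝ bump := contDiff_bump.differentiable (by norm_num)
  have hc1 : ContDiff ℝ 1 (deriv bump) := by
    have := (contDiff_succ_iff_deriv (n := 1) (f := bump)).1 contDiff_bump
    exact this.2.2
  have hd2 : Differentiable ℝ (deriv bump) := hc1.differentiable (by norm_num)
  have hc2 : Continuous (deriv (deriv bump)) := hc1.continuous_deriv (by norm_num)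
  obtain ⟨L₁, hL₁⟩ := hc1.continuous.bounded_above_of_compact_support hsupp.deriv
  obtain ⟨L₂, hL₂⟩ := hc2.bounded_above_of_compact_support hsupp.deriv.deriv
  have hlip2 : ∀ t s, |deriv bump t - deriv bump s| ≤ L₂ * |t - s| := by
    intro t s
    have := convex_univ.norm_image_sub_le_of_norm_deriv_le (f := deriv bump) (C := L₂)
      (fun x _ => hd2 x) (fun x _ => hL₂ x) (Set.mem_univ s) (Set.mem_univ t)
    simpa using this
  have hlip1 : ∀ t s, |bump t - bump s| ≤ L₁ * |t - s| := by
    intro t s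
    have := convex_univ.norm_image_sub_le_of_norm_deriv_le (f := bump) (C := L₁)
      (fun x _ => hd1 x) (fun x _ => hL₁ x) (Set.mem_univ s) (Set.mem_univ t)
    simpa using this
  have hL₂0 : 0 ≤ L₂ := (norm_nonneg _).trans (hL₂ 0)
  refine ⟨max 1 (max L₁ (2 * L₂)), le_max_left _ _, fun t h => ?_, fun t h => ?_⟩
  · refine (hlip1 _ _).trans ?_
    rw [add_sub_cancel_left]
    gcongr
    exact (le_max_left _ _).trans (le_max_right _ _)
  · have key : |bump (t + h) - 2 * bump t + bump (t - h)| ≤ 2 * L₂ * h ^ 2 := by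
      let g : ℝ → ℝ := fun u => bump (t + u) + bump (t - u)
      have hg : ∀ u, HasDerivAt g (deriv bump (t + u) - deriv bump (t - u)) u := by
        intro u
        have h1 : HasDerivAt (fun u => bump (t + u)) (deriv bump (t + u)) u :=
          HasDerivAt.comp_const_add t u (hd1 (t + u)).hasDerivAt
        have h2 : HasDerivAt (fun u => bump (t - u)) (-deriv bump (t - u)) u :=
          HasDerivAt.comp_const_sub t u (hd1 (t - u)).hasDerivAt
        exact h1.add h2
      have h3 := (convex_uIcc (0 : ℝ) h).norm_image_sub_le_of_norm_hasDerivWithin_le (f := g)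
        (C := 2 * L₂ * |h|) (fun u _ => (hg u).hasDerivWithinAt) (fun u hu => by
          rw [Real.norm_eq_abs]
          refine (hlip2 _ _).trans ?_
          have h4 : t + u - (t - u) = 2 * u := by ring
          rw [h4, abs_mul, abs_two]
          have h5 : |u| ≤ |h| := by
            have := Set.abs_sub_left_of_mem_uIcc hu
            simpa using this
          nlinarith) (Set.left_mem_uIcc) (Set.right_mem_uIcc)
      rw [Real.norm_eq_abs, sub_zero, Real.norm_eq_abs, mul_assoc, abs_mul_abs_self] at h3
      have h4 : bump (t + h) - 2 * bump t + bump (t - h) = g h - g 0 := by simp [g]; ring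
      rw [h4, pow_two]
      exact h3
    refine key.trans ?_
    gcongr
    exact (le_max_right _ _).trans (le_max_right _ _)

/-- The partition of unity of generation `j`. -/
def cbump {n : ℕ} (j : ℕ) (k : Fin n → ℤ) (y : Fin n → ℝ) : ℝ := ∏ i, bump (2 ^ j * y i - k i)

variable {n : ℕ}

lemma continuous_cbump (j : ℕ) (k : Fin n → ℤ) : Continuous (cbump j k) := by
  unfold cbump
  have := contDiff_bump.continuous
  fun_prop

lemma cbump_nonneg (j : ℕ) (k : Fin n → ℤ) (y : Fin n → ℝ) : 0 ≤ cbump j k y :=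
  Finset.prod_nonneg fun _ _ => bump_nonneg _

lemma cbump_le_one (j : ℕ) (k : Fin n → ℤ) (y : Fin n → ℝ) : cbump j k y ≤ 1 :=
  Finset.prod_le_one (fun _ _ => bump_nonneg _) fun _ _ => bump_le_one _

lemma mem_of_cbump_ne_zero {j : ℕ} {k : Fin n → ℤ} {y : Fin n → ℝ} (h : cbump j k y ≠ 0)
    (i : Fin n) : -(1 / 4) < 2 ^ j * y i - k i ∧ 2 ^ j * y i - k i < 5 / 4 :=
  mem_of_bump_ne_zero (Finset.prod_ne_zero_iff.1 h i (Finset.mem_univ i))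

lemma sum_cbump (j : ℕ) (y : Fin n → ℝ) (T : Finset (Fin n → ℤ))
    (hT : ∀ k, cbump j k y ≠ 0 → k ∈ T) : ∑ k ∈ T, cbump j k y = 1 := by
  let A := Fintype.piFinset fun i : Fin n =>
    Finset.Icc (⌊(2 : ℝ) ^ j * y i⌋ - 1) (⌊(2 : ℝ) ^ j * y i⌋ + 1)
  have hA : ∑ k ∈ A, cbump j k y = 1 := by
    have h1 := Finset.prod_univ_sum (fun i : Fin n =>
      Finset.Icc (⌊(2 : ℝ) ^ j * y i⌋ - 1) (⌊(2 : ℝ) ^ j * y i⌋ + 1))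
      (fun i m => bump (2 ^ j * y i - m))
    simp only [cbump, A]
    rw [← h1]
    exact Finset.prod_eq_one fun i _ => sum_bump _
  have hAm : ∀ k, cbump j k y ≠ 0 → k ∈ A := by
    intro k hk
    rw [Fintype.mem_piFinset]
    intro i
    obtain ⟨h1, h2⟩ := mem_of_cbump_ne_zero hk i
    rw [Finset.mem_Icc]
    constructor
    · have : (⌊(2 : ℝ) ^ j * y i⌋ : ℝ) - 2 < k i := by
        have := Int.floor_le ((2 : ℝ) ^ j * y i); linarith
      have : ⌊(2 : ℝ) ^ j * y i⌋ - 2 < k i := by exact_mod_cast this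
      omega
    · have : (k i : ℝ) < ⌊(2 : ℝ) ^ j * y i⌋ + 2 := by
        have := Int.lt_floor_add_one ((2 : ℝ) ^ j * y i); linarith
      have : k i < ⌊(2 : ℝ) ^ j * y i⌋ + 2 := by exact_mod_cast this
      omega
  classical
  rw [← hA, ← Finset.sum_filter_ne_zero, ← Finset.sum_filter_ne_zero (s := A)]
  congr 1
  ext k
  simp only [Finset.mem_filter]
  exact ⟨fun h => ⟨hAm k h.2, h.2⟩, fun h => ⟨hT k h.2, h.2⟩⟩

lemma cbump_add_single (j : ℕ) (k : Fin n → ℤ) (y : Fin n → ℝ) (i : Fin n) (h : ℝ) :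
    cbump j k (y + Pi.single i h) = bump (2 ^ j * y i - k i + 2 ^ j * h) *
      ∏ i' ∈ Finset.univ.erase i, bump (2 ^ j * y i' - k i') := by
  classical
  unfold cbump
  rw [← Finset.mul_prod_erase _ _ (Finset.mem_univ i)]
  congr 1
  · congr 1; simp; ring
  · refine Finset.prod_congr rfl fun i' hi' => ?_
    simp [Finset.ne_of_mem_erase hi']

/-- Bounds for the differences of the partition of unity in a coordinate direction. -/
lemma cbump_differences {L : ℝ} (h1 : ∀ t h, |bump (t + h) - bump t| ≤ L * |h|)
    (h2 : ∀ t h, |bump (t + h) - 2 * bump t + bump (t - h)| ≤ L * h ^ 2)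
    (j : ℕ) (k : Fin n → ℤ) (y : Fin n → ℝ) (i : Fin n) (h : ℝ) :
    |cbump j k (y + Pi.single i h) - cbump j k y| ≤ L * (|h| / side j) ∧
    |cbump j k (y + Pi.single i h) - 2 * cbump j k y + cbump j k (y - Pi.single i h)| ≤
      L * (h / side j) ^ 2 := by
  classical
  have hs : ∀ x : ℝ, x / side j = 2 ^ j * x := by intro x; unfold side; field_simp
  set R := ∏ i' ∈ Finset.univ.erase i, bump (2 ^ j * y i' - k i') with hR
  have hR0 : 0 ≤ R := Finset.prod_nonneg fun _ _ => bump_nonneg _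
  have hR1 : R ≤ 1 := Finset.prod_le_one (fun _ _ => bump_nonneg _) fun _ _ => bump_le_one _
  have e1 := cbump_add_single j k y i h
  have e2 := cbump_add_single j k y i (-h)
  have e0 := cbump_add_single j k y i 0
  rw [Pi.single_zero, add_zero, mul_zero, add_zero] at e0
  rw [Pi.single_neg, ← sub_eq_add_neg, mul_neg, ← sub_eq_add_neg] at e2
  rw [e0, e1, e2, ← hR, hs, hs]
  set u := (2 : ℝ) ^ j * y i - k i
  set v := (2 : ℝ) ^ j * h with hv
  have hva : (2 : ℝ) ^ j * |h| = |v| := by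
    rw [hv, abs_mul, abs_of_pos (by positivity : (0 : ℝ) < 2 ^ j)]
  rw [hva]
  constructor
  · rw [← sub_mul, abs_mul, abs_of_nonneg hR0]
    exact (mul_le_of_le_one_right (abs_nonneg _) hR1).trans (h1 _ _)
  · have e3 : bump (u + v) * R - 2 * (bump u * R) + bump (u - v) * R =
        (bump (u + v) - 2 * bump u + bump (u - v)) * R := by ring
    rw [e3, abs_mul, abs_of_nonneg hR0]
    exact (mul_le_of_le_one_right (abs_nonneg _) hR1).trans (h2 _ _)

end Bump

section Approx

variable {n : ℕ} {W : Type*} [NormedAddCommGroup W] [InnerProductSpace ℝ W]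

/-- The rescaled coordinates of `y` relative to the corner of the cube `(j, k)` lie in
`[lo, hi]`. -/
def InBox (j : ℕ) (k : Fin n → ℤ) (lo hi : ℝ) (y : Fin n → ℝ) : Prop :=
  ∀ i, lo ≤ 2 ^ j * y i - k i ∧ 2 ^ j * y i - k i ≤ hi

lemma InBox.mono {j : ℕ} {k : Fin n → ℤ} {lo hi lo' hi' : ℝ} {y : Fin n → ℝ}
    (h : InBox j k lo hi y) (h1 : lo' ≤ lo) (h2 : hi ≤ hi') : InBox j k lo' hi' y :=
  fun i => ⟨h1.trans (h i).1, (h i).2.trans h2⟩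

lemma InBox.nearCube {j : ℕ} {k : Fin n → ℤ} {lo hi c : ℝ} {y : Fin n → ℝ}
    (h : InBox j k lo hi y) (h1 : -c ≤ lo) (h2 : hi ≤ c) : NearCube j k c y :=
  fun i => abs_le.2 ⟨h1.trans (h i).1, (h i).2.trans h2⟩

lemma inBox_of_cbump {j : ℕ} {k : Fin n → ℤ} {y : Fin n → ℝ} (h : cbump j k y ≠ 0) :
    InBox j k (-(1 / 4)) (5 / 4) y :=
  fun i => ⟨(mem_of_cbump_ne_zero h i).1.le, (mem_of_cbump_ne_zero h i).2.le⟩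

lemma InBox.add_single {j : ℕ} {k : Fin n → ℤ} {lo hi d h : ℝ} {y : Fin n → ℝ}
    (hy : InBox j k lo hi y) (hh : |h| ≤ d * side j) (i : Fin n) :
    InBox j k (lo - d) (hi + d) (y + Pi.single i h) := by
  have hs := side_pos j
  have hd : 0 ≤ d := by
    by_contra hc
    nlinarith [abs_nonneg h]
  have h1 : |2 ^ j * h| ≤ d := by
    rw [abs_mul, abs_of_pos (by positivity : (0 : ℝ) < 2 ^ j)]
    calc (2 : ℝ) ^ j * |h| ≤ 2 ^ j * (d * side j) := by gcongr
      _ = d * (2 ^ j * side j) := by ring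
      _ = d := by rw [two_pow_mul_side, mul_one]
  rw [abs_le] at h1
  intro i'
  obtain ⟨a1, a2⟩ := hy i'
  by_cases hi : i' = i
  · subst hi
    simp only [Pi.add_apply, Pi.single_eq_same, mul_add]
    constructor <;> linarith [h1.1, h1.2]
  · simp only [Pi.add_apply, Pi.single_eq_of_ne hi, add_zero]
    constructor <;> linarith

lemma card_nearCube_le (j : ℕ) (y : Fin n → ℝ) (T : Finset (Fin n → ℤ)) (m : ℕ)
    (hT : ∀ k ∈ T, NearCube j k m y) : T.card ≤ (2 * m + 1) ^ n := by
  let A := Fintype.piFinset fun i : Fin n =>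
    Finset.Icc (⌈(2 : ℝ) ^ j * y i⌉ - m) (⌈(2 : ℝ) ^ j * y i⌉ - m + 2 * m)
  have h1 : T ⊆ A := by
    intro k hk
    rw [Fintype.mem_piFinset]
    intro i
    have h := abs_le.1 (hT k hk i)
    have c1 := Int.le_ceil ((2 : ℝ) ^ j * y i)
    have c2 := Int.ceil_lt_add_one ((2 : ℝ) ^ j * y i)
    rw [Finset.mem_Icc]
    constructor
    · have : (⌈(2 : ℝ) ^ j * y i⌉ : ℝ) - m - 1 < k i := by linarith [h.1, h.2]
      have : ⌈(2 : ℝ) ^ j * y i⌉ - m - 1 < k i := by exact_mod_cast this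
      omega
    · have : (k i : ℝ) ≤ ⌈(2 : ℝ) ^ j * y i⌉ - m + 2 * m := by linarith [h.1, h.2]
      exact_mod_cast this
  refine (Finset.card_le_card h1).trans ?_
  rw [Fintype.card_piFinset]
  simp only [Int.card_Icc]
  exact (Finset.prod_le_pow_card _ _ (2 * m + 1) fun i _ => by omega).trans (by simp)

/-- The smoothed piecewise affine approximations. -/
def approx (H : ℕ → Finset (Fin n → ℤ)) (b : ℕ → (Fin n → ℤ) → ((Fin n → ℝ) →ᵃ[ℝ] W)) :
    ℕ → (Fin n → ℝ) → W
  | 0 => fun _ => 0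
  | j + 1 => fun y => approx H b j y +
      ∑ k ∈ H (j + 1), cbump (j + 1) k y • (b (j + 1) k y - approx H b j y)

/-- The increment between consecutive approximations. -/
def corr (H : ℕ → Finset (Fin n → ℤ)) (b : ℕ → (Fin n → ℤ) → ((Fin n → ℝ) →ᵃ[ℝ] W))
    (j : ℕ) (y : Fin n → ℝ) : W :=
  ∑ k ∈ H (j + 1), cbump (j + 1) k y • (b (j + 1) k y - approx H b j y)

/-- Compatibility conditions for a multiscale family of affine maps. -/
structure Compatible (H : ℕ → Finset (Fin n → ℤ))
    (b : ℕ → (Fin n → ℤ) → ((Fin n → ℝ) →ᵃ[ℝ] W)) (ε : ℕ → (Fin n → ℤ) → ℝ) : Prop where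
  zero : ∀ k, b 0 k = 0
  nonneg : ∀ j k, 0 ≤ ε j k
  active : ∀ j, ∀ k ∈ H (j + 1), ∀ y, InBox (j + 1) k (-(5 / 16)) (21 / 16) y →
    ∀ k', cbump j k' y ≠ 0 → k' ∈ H j
  close : ∀ j, ∀ k ∈ H (j + 1), ∀ k' ∈ H j, ∀ y, NearCube (j + 1) k 2 y → NearCube j k' 2 y →
    SlopeLE (b (j + 1) k - b j k') (ε (j + 1) k) ∧
      ‖(b (j + 1) k - b j k') y‖ ≤ ε (j + 1) k * side j

variable {H : ℕ → Finset (Fin n → ℤ)} {b : ℕ → (Fin n → ℤ) → ((Fin n → ℝ) →ᵃ[ℝ] W)}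
  {ε : ℕ → (Fin n → ℤ) → ℝ}

lemma approx_succ (j : ℕ) (y : Fin n → ℝ) :
    approx H b (j + 1) y = approx H b j y + corr H b j y := rfl

/-- Where all active cubes belong to the family, the approximation is the partition of unity
average of the affine maps. -/
lemma approx_eq (hb : ∀ k, b 0 k = 0) {j : ℕ} {y : Fin n → ℝ}
    (hy : ∀ k, cbump j k y ≠ 0 → k ∈ H j) :
    approx H b j y = ∑ k ∈ H j, cbump j k y • b j k y := by
  cases j with
  | zero =>
    rw [Finset.sum_eq_zero fun k _ => by rw [hb k]; simp]
    rfl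
  | succ j =>
    have h1 := sum_cbump (j + 1) y (H (j + 1)) hy
    simp only [approx, smul_sub, Finset.sum_sub_distrib]
    rw [← Finset.sum_smul, h1, one_smul]
    abel

lemma continuous_approx (j : ℕ) : Continuous (approx H b j) := by
  induction j with
  | zero => exact continuous_const
  | succ j ih =>
    refine ih.add (continuous_finsetSum _ fun k _ => ?_)
    exact (continuous_cbump _ _).smul ((b (j + 1) k).continuous_of_finiteDimensional.sub ih)

lemma continuous_corr (j : ℕ) : Continuous (corr H b j) := by
  refine continuous_finsetSum _ fun k _ => ?_
  exact (continuous_cbump _ _).smul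
    ((b (j + 1) k).continuous_of_finiteDimensional.sub (continuous_approx j))

lemma setOf_nearCube (j : ℕ) (k : Fin n → ℤ) (c : ℝ) : {y : Fin n → ℝ | NearCube j k c y} =
    Set.univ.pi fun i => Set.Icc ((k i - c) * side j) ((k i + c) * side j) := by
  ext y
  simp only [Set.mem_ofPred_eq, Set.mem_univ_pi, NearCube, Set.mem_Icc]
  refine forall_congr' fun i => ?_
  rw [abs_le, side, ← div_eq_mul_inv, ← div_eq_mul_inv, div_le_iff₀ (by positivity),
    le_div_iff₀ (by positivity)]
  constructor <;> rintro ⟨h1, h2⟩ <;> constructor <;> linarith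

lemma isCompact_nearCube (j : ℕ) (k : Fin n → ℤ) (c : ℝ) : IsCompact {y | NearCube j k c y} := by
  rw [setOf_nearCube]
  exact isCompact_univ_pi fun i => isCompact_Icc

lemma volume_nearCube (j : ℕ) (k : Fin n → ℤ) (c : ℝ) (hc : 0 ≤ c) :
    volume {y : Fin n → ℝ | NearCube j k c y} = ENNReal.ofReal ((2 * c * side j) ^ n) := by
  rw [setOf_nearCube, volume_pi_pi]
  simp only [Real.volume_Icc]
  rw [Finset.prod_congr rfl fun i _ => by
    rw [show (k i + c) * side j - (k i - c) * side j = 2 * c * side j by ring]]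
  rw [Finset.prod_const, Finset.card_univ, Fintype.card_fin, ENNReal.ofReal_pow]
  exact mul_nonneg (by positivity) (side_pos j).le

lemma hasCompactSupport_corr (j : ℕ) : HasCompactSupport (corr H b j) := by
  have hK : IsCompact (⋃ k ∈ H (j + 1), {y | NearCube (j + 1) k 2 y}) :=
    (H (j + 1)).isCompact_biUnion fun k _ => isCompact_nearCube _ _ _
  refine HasCompactSupport.intro hK fun y hy => ?_
  refine Finset.sum_eq_zero fun k hk => ?_
  have : cbump (j + 1) k y = 0 := by
    by_contra h
    exact hy (Set.mem_biUnion hk ((inBox_of_cbump h).nearCube (by norm_num) (by norm_num)))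
  rw [this, zero_smul]

lemma hasCompactSupport_approx (j : ℕ) : HasCompactSupport (approx H b j) := by
  induction j with
  | zero => exact HasCompactSupport.zero
  | succ j ih => exact ih.add (hasCompactSupport_corr j)

end Approx

section Blend

variable {n : ℕ} {W : Type*} [NormedAddCommGroup W] [NormedSpace ℝ W]

lemma norm_sum_le_card_mul {ι W : Type*} [NormedAddCommGroup W] (T T' : Finset ι) (X : ι → W) {c : ℝ} {m : ℕ}
    (hT' : T'.card ≤ m) (hc : 0 ≤ c) (h0 : ∀ k ∈ T, k ∉ T' → X k = 0) (h1 : ∀ k ∈ T', ‖X k‖ ≤ c)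
    (hsub : T' ⊆ T) : ‖∑ k ∈ T, X k‖ ≤ m * c := by
  rw [← Finset.sum_subset hsub h0]
  refine (norm_sum_le_of_le _ h1).trans ?_
  rw [Finset.sum_const, nsmul_eq_mul]
  gcongr

lemma affine_add_single (β : (Fin n → ℝ) →ᵃ[ℝ] W) (y : Fin n → ℝ) (i : Fin n) (h : ℝ) :
    β (y + Pi.single i h) = β y + h • β.linear (Pi.single i 1) := by
  have h1 := apply_sub_apply β (y + Pi.single i h) y
  rw [add_sub_cancel_left] at h1
  have h2 : (Pi.single i h : Fin n → ℝ) = h • Pi.single i 1 := by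
    rw [← Pi.single_smul]; simp
  rw [h2, map_smul] at h1
  rw [← h1, ← h2]; abel

/-- Differences of a blend of affine maps that are small near their cubes. -/
lemma blend_differences {L : ℝ} (hL : 1 ≤ L) (h1 : ∀ t h, |bump (t + h) - bump t| ≤ L * |h|)
    (h2 : ∀ t h, |bump (t + h) - 2 * bump t + bump (t - h)| ≤ L * h ^ 2)
    {j : ℕ} {T : Finset (Fin n → ℤ)} {β : (Fin n → ℤ) → ((Fin n → ℝ) →ᵃ[ℝ] W)} {γ : ℝ}
    (hγ : 0 ≤ γ) {y : Fin n → ℝ}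
    (hβ : ∀ k ∈ T, NearCube j k 2 y → SlopeLE (β k) γ ∧ ‖β k y‖ ≤ γ * side j)
    {h : ℝ} (hh0 : 0 ≤ h) (hh : h ≤ 1 / 16 * side j) (i : Fin n) :
    ‖∑ k ∈ T, cbump j k y • β k y‖ ≤ 5 ^ n * (γ * side j) ∧
    (‖∑ k ∈ T, cbump j k (y + Pi.single i h) • β k (y + Pi.single i h) -
      ∑ k ∈ T, cbump j k y • β k y‖ ≤ 5 ^ n * ((L + 1) * γ * h)) ∧
    (‖∑ k ∈ T, cbump j k (y + Pi.single i h) • β k (y + Pi.single i h) -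
      (2 : ℝ) • ∑ k ∈ T, cbump j k y • β k y +
      ∑ k ∈ T, cbump j k (y - Pi.single i h) • β k (y - Pi.single i h)‖ ≤
        5 ^ n * (3 * L * γ * h ^ 2 / side j)) := by
  classical
  have hs := side_pos j
  set T' := T.filter fun k => InBox j k (-(5 / 16)) (21 / 16) y with hT'
  have hnear : ∀ k ∈ T', NearCube j k 2 y := fun k hk =>
    (Finset.mem_filter.1 hk).2.nearCube (by norm_num) (by norm_num)
  have hcard : T'.card ≤ 5 ^ n := card_nearCube_le j y T' 2 (by exact_mod_cast hnear)
  have hzero : ∀ t : ℝ, |t| ≤ h → ∀ k ∈ T, k ∉ T' → cbump j k (y + Pi.single i t) = 0 := by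
    intro t ht k hk hk'
    by_contra hc
    apply hk'
    refine Finset.mem_filter.2 ⟨hk, ?_⟩
    have := (inBox_of_cbump hc).add_single (d := 1 / 16) (h := -t)
      (by rw [abs_neg]; exact ht.trans hh) i
    rw [Pi.single_neg, add_neg_cancel_right] at this
    exact this.mono (by norm_num) (by norm_num)
  have hz0 : ∀ k ∈ T, k ∉ T' → cbump j k y = 0 := by
    intro k hk hk'
    simpa using hzero 0 (by simpa using hh0) k hk hk'
  have hzp := hzero h (abs_of_nonneg hh0).le
  have hzm : ∀ k ∈ T, k ∉ T' → cbump j k (y - Pi.single i h) = 0 := by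
    intro k hk hk'
    have := hzero (-h) (by rw [abs_neg, abs_of_nonneg hh0]) k hk hk'
    rwa [Pi.single_neg, ← sub_eq_add_neg] at this
  have hsub : T' ⊆ T := Finset.filter_subset _ _
  have hv : ∀ k ∈ T', ‖β k y‖ ≤ γ * side j := fun k hk => (hβ k (hsub hk) (hnear k hk)).2
  have hsl : ∀ k ∈ T', ‖h • (β k).linear (Pi.single i 1)‖ ≤ γ * h := by
    intro k hk
    rw [norm_smul, Real.norm_eq_abs, abs_of_nonneg hh0, mul_comm]
    exact mul_le_mul_of_nonneg_right ((hβ k (hsub hk) (hnear k hk)).1 i) hh0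
  have hd : ∀ k, |cbump j k (y + Pi.single i h) - cbump j k y| ≤ L * (h / side j) := by
    intro k
    have := (cbump_differences h1 h2 j k y i h).1
    rwa [abs_of_nonneg hh0] at this
  have hd' : ∀ k, |cbump j k (y - Pi.single i h) - cbump j k y| ≤ L * (h / side j) := by
    intro k
    have := (cbump_differences h1 h2 j k y i (-h)).1
    rwa [abs_neg, abs_of_nonneg hh0, Pi.single_neg, ← sub_eq_add_neg] at this
  have hdd := fun k => (cbump_differences h1 h2 j k y i h).2
  have hLp : 0 ≤ L := by linarith
  have hβm : ∀ k, β k (y - Pi.single i h) = β k y - h • (β k).linear (Pi.single i 1) := by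
    intro k
    have := affine_add_single (β k) y i (-h)
    rwa [Pi.single_neg, ← sub_eq_add_neg, neg_smul, ← sub_eq_add_neg] at this
  have h5 : ((5 ^ n : ℕ) : ℝ) = 5 ^ n := by push_cast; rfl
  refine ⟨?_, ?_, ?_⟩
  · rw [← h5]
    refine norm_sum_le_card_mul T T' _ hcard (by positivity) (fun k hk hk' => ?_) (fun k hk => ?_)
      hsub
    · rw [hz0 k hk hk', zero_smul]
    · rw [norm_smul, Real.norm_eq_abs, abs_of_nonneg (cbump_nonneg _ _ _)]
      exact (mul_le_of_le_one_left (norm_nonneg _) (cbump_le_one _ _ _)).trans (hv k hk)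
  · rw [← h5, ← Finset.sum_sub_distrib]
    refine norm_sum_le_card_mul T T' _ hcard (by positivity) (fun k hk hk' => ?_) (fun k hk => ?_)
      hsub
    · rw [hz0 k hk hk', hzp k hk hk', zero_smul, zero_smul, sub_zero]
    · have e : cbump j k (y + Pi.single i h) • β k (y + Pi.single i h) - cbump j k y • β k y =
          (cbump j k (y + Pi.single i h) - cbump j k y) • β k y +
          cbump j k (y + Pi.single i h) • (h • (β k).linear (Pi.single i 1)) := by
        rw [affine_add_single, smul_add, sub_smul]; abel
      rw [e]
      refine (norm_add_le _ _).trans ?_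
      rw [norm_smul, norm_smul _ (h • (β k).linear (Pi.single i 1)), Real.norm_eq_abs,
        Real.norm_eq_abs, abs_of_nonneg (cbump_nonneg j k _)]
      calc _ ≤ L * (h / side j) * (γ * side j) + 1 * (γ * h) := by
            gcongr
            · exact hd k
            · exact hv k hk
            · exact cbump_le_one _ _ _
            · exact hsl k hk
        _ = (L + 1) * γ * h := by field_simp
  · rw [← h5, Finset.smul_sum, ← Finset.sum_sub_distrib, ← Finset.sum_add_distrib]
    refine norm_sum_le_card_mul T T' _ hcard (by positivity) (fun k hk hk' => ?_) (fun k hk => ?_)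
      hsub
    · rw [hz0 k hk hk', hzp k hk hk', hzm k hk hk']; simp
    · have e : cbump j k (y + Pi.single i h) • β k (y + Pi.single i h) -
          (2 : ℝ) • cbump j k y • β k y + cbump j k (y - Pi.single i h) • β k (y - Pi.single i h) =
          (cbump j k (y + Pi.single i h) - 2 * cbump j k y + cbump j k (y - Pi.single i h)) • β k y
          + ((cbump j k (y + Pi.single i h) - cbump j k y) -
            (cbump j k (y - Pi.single i h) - cbump j k y)) •
            (h • (β k).linear (Pi.single i 1)) := by
        rw [affine_add_single, hβm]; module
      rw [e]
      refine (norm_add_le _ _).trans ?_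
      rw [norm_smul, norm_smul _ (h • (β k).linear (Pi.single i 1)), Real.norm_eq_abs,
        Real.norm_eq_abs]
      calc _ ≤ L * (h / side j) ^ 2 * (γ * side j) +
            (L * (h / side j) + L * (h / side j)) * (γ * h) := by
            gcongr
            · exact hdd k
            · exact hv k hk
            · exact (abs_sub _ _).trans (add_le_add (hd k) (hd' k))
            · exact hsl k hk
        _ = 3 * L * γ * h ^ 2 / side j := by field_simp; ring

end Blend

section Increment

variable {n : ℕ} {W : Type*} [NormedAddCommGroup W] [InnerProductSpace ℝ W]
  {H : ℕ → Finset (Fin n → ℤ)} {b : ℕ → (Fin n → ℤ) → ((Fin n → ℝ) →ᵃ[ℝ] W)}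
  {ε : ℕ → (Fin n → ℤ) → ℝ}

open scoped Classical in
/-- The total size of the increments near `y`. -/
def localSize (H : ℕ → Finset (Fin n → ℤ)) (ε : ℕ → (Fin n → ℤ) → ℝ) (j : ℕ) (y : Fin n → ℝ) : ℝ :=
  ∑ k ∈ (H (j + 1)).filter fun k => NearCube (j + 1) k 2 y, ε (j + 1) k

lemma norm_sum_le_localSize {W : Type*} [NormedAddCommGroup W]
    (hε : ∀ j k, 0 ≤ ε j k) {j : ℕ} {y : Fin n → ℝ}
    {X : (Fin n → ℤ) → W} {c : ℝ} (hc : 0 ≤ c)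
    (h : ∀ k ∈ H (j + 1), X k ≠ 0 → NearCube (j + 1) k 2 y ∧ ‖X k‖ ≤ c * ε (j + 1) k) :
    ‖∑ k ∈ H (j + 1), X k‖ ≤ c * localSize H ε j y := by
  classical
  unfold localSize
  rw [Finset.mul_sum, ← Finset.sum_subset (Finset.filter_subset
    (fun k => NearCube (j + 1) k 2 y) (H (j + 1)))]
  · refine norm_sum_le_of_le _ fun k hk => ?_
    by_cases hX : X k = 0
    · rw [hX, norm_zero]; exact mul_nonneg hc (hε _ _)
    · exact (h k (Finset.mem_filter.1 hk).1 hX).2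
  · intro k hk hk'
    by_contra hX
    exact hk' (Finset.mem_filter.2 ⟨hk, (h k hk hX).1⟩)

/-- The difference between an affine map and the approximation. -/
lemma affine_sub_approx (hb : ∀ k, b 0 k = 0) {j : ℕ} {y : Fin n → ℝ}
    (hy : ∀ k, cbump j k y ≠ 0 → k ∈ H j) (f : (Fin n → ℝ) →ᵃ[ℝ] W) :
    f y - approx H b j y = ∑ k ∈ H j, cbump j k y • (f - b j k) y := by
  rw [approx_eq hb hy]
  have h1 := sum_cbump j y (H j) hy
  have : f y = ∑ k ∈ H j, cbump j k y • f y := by rw [← Finset.sum_smul, h1, one_smul]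
  conv_lhs => rw [this]
  rw [← Finset.sum_sub_distrib]
  refine Finset.sum_congr rfl fun k _ => ?_
  rw [← smul_sub]
  rfl

/-- The constant of the increment estimates. -/
def incrConst (n : ℕ) (L : ℝ) : ℝ := 5 ^ n * (3 * L + 1)

lemma incrConst_pos {L : ℝ} (hL : 1 ≤ L) : 0 < incrConst n L := by
  unfold incrConst; have : 0 < L := by linarith
  positivity

/-- An affine map and its first and second differences compared with the approximation. -/
lemma affine_sub_approx_differences {L : ℝ} (hL : 1 ≤ L)
    (h1 : ∀ t h, |bump (t + h) - bump t| ≤ L * |h|)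
    (h2 : ∀ t h, |bump (t + h) - 2 * bump t + bump (t - h)| ≤ L * h ^ 2)
    (hb : ∀ k, b 0 k = 0) {j : ℕ} {y : Fin n → ℝ} {γ : ℝ}
    (hγ : 0 ≤ γ) (f : (Fin n → ℝ) →ᵃ[ℝ] W)
    (hf : ∀ k ∈ H j, NearCube j k 2 y → SlopeLE (f - b j k) γ ∧ ‖(f - b j k) y‖ ≤ γ * side j)
    {h : ℝ} (hh0 : 0 ≤ h) (hh : h ≤ 1 / 16 * side j) (i : Fin n)
    (hy : ∀ k, cbump j k y ≠ 0 → k ∈ H j) :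
    ‖f y - approx H b j y‖ ≤ 5 ^ n * (γ * side j) ∧
    ((∀ k, cbump j k (y + Pi.single i h) ≠ 0 → k ∈ H j) →
      ‖(f (y + Pi.single i h) - approx H b j (y + Pi.single i h)) - (f y - approx H b j y)‖ ≤
        5 ^ n * ((L + 1) * γ * h) ∧
      ((∀ k, cbump j k (y - Pi.single i h) ≠ 0 → k ∈ H j) →
        ‖approx H b j (y + Pi.single i h) - (2 : ℝ) • approx H b j y +
          approx H b j (y - Pi.single i h)‖ ≤ 5 ^ n * (3 * L * γ * h ^ 2 / side j))) := by
  obtain ⟨a1, a2, a3⟩ := blend_differences (W := W) hL h1 h2 hγ hf hh0 hh i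
  rw [affine_sub_approx hb hy f]
  refine ⟨a1, fun hp => ?_⟩
  rw [affine_sub_approx hb hp f]
  refine ⟨a2, fun hm => ?_⟩
  rw [← affine_sub_approx hb hy f, ← affine_sub_approx hb hp f,
    ← affine_sub_approx hb hm f, affine_add_single] at a3
  have e : f (y - Pi.single i h) = f y - h • f.linear (Pi.single i 1) := by
    have := affine_add_single f y i (-h)
    rwa [Pi.single_neg, ← sub_eq_add_neg, neg_smul, ← sub_eq_add_neg] at this
  rw [e] at a3
  refine le_trans (le_of_eq ?_) a3
  rw [← norm_neg]
  congr 1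
  module

/-- Size and differences of the increment. -/
lemma corr_bounds {L : ℝ} (hL : 1 ≤ L)
    (h1 : ∀ t h, |bump (t + h) - bump t| ≤ L * |h|)
    (h2 : ∀ t h, |bump (t + h) - 2 * bump t + bump (t - h)| ≤ L * h ^ 2)
    (hC : Compatible H b ε) {j : ℕ} (y : Fin n → ℝ) {h : ℝ} (hh0 : 0 ≤ h)
    (hh : h ≤ 1 / 16 * side (j + 1)) (i : Fin n) :
    ‖corr H b j y‖ ≤ incrConst n L * side j * localSize H ε j y ∧
    ‖corr H b j (y + Pi.single i h) - corr H b j y‖ ≤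
      incrConst n L * h * localSize H ε j y ∧
    (corr H b j y ≠ 0 → ‖approx H b j (y + Pi.single i h) - (2 : ℝ) • approx H b j y +
          approx H b j (y - Pi.single i h)‖ ≤
      incrConst n L * (h ^ 2 / side j) * localSize H ε j y) := by
  classical
  have hs := side_pos j
  have hs1 := side_pos (j + 1)
  have hss := side_succ j
  have hLp : 0 ≤ L := by linarith
  have hh' : h ≤ 1 / 16 * side j := by linarith
  have habs : |h| ≤ 1 / 16 * side (j + 1) := by rwa [abs_of_nonneg hh0]
  have habs' : |-h| ≤ 1 / 16 * side (j + 1) := by rwa [abs_neg]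
  have hclose : ∀ k ∈ H (j + 1), InBox (j + 1) k (-(5 / 16)) (21 / 16) y → ∀ k' ∈ H j,
      NearCube j k' 2 y → SlopeLE (b (j + 1) k - b j k') (ε (j + 1) k) ∧
      ‖(b (j + 1) k - b j k') y‖ ≤ ε (j + 1) k * side j := fun k hk hy k' hk' hy' =>
    hC.close j k hk k' hk' y (hy.nearCube (by norm_num) (by norm_num)) hy'
  have key := fun k (hk : k ∈ H (j + 1)) (hy : InBox (j + 1) k (-(5 / 16)) (21 / 16) y) =>
    affine_sub_approx_differences hL h1 h2 hC.zero (hC.nonneg (j + 1) k) (b (j + 1) k)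
      (hclose k hk hy) hh0 hh' i (hC.active j k hk y hy)
  refine ⟨?_, ?_, ?_⟩
  · refine norm_sum_le_localSize hC.nonneg (by have := incrConst_pos (n := n) hL; positivity) ?_
    intro k hk hX
    have hφ : cbump (j + 1) k y ≠ 0 := fun h => hX (by rw [h, zero_smul])
    have hbox := inBox_of_cbump hφ
    refine ⟨hbox.nearCube (by norm_num) (by norm_num), ?_⟩
    obtain ⟨a1, -⟩ := key k hk (hbox.mono (by norm_num) (by norm_num))
    rw [norm_smul, Real.norm_eq_abs, abs_of_nonneg (cbump_nonneg _ _ _)]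
    refine (mul_le_of_le_one_left (norm_nonneg _) (cbump_le_one _ _ _)).trans (a1.trans ?_)
    unfold incrConst
    have := hC.nonneg (j + 1) k
    calc 5 ^ n * (ε (j + 1) k * side j) = 5 ^ n * 1 * side j * ε (j + 1) k := by ring
      _ ≤ _ := by gcongr; linarith
  · unfold corr
    rw [← Finset.sum_sub_distrib]
    refine norm_sum_le_localSize hC.nonneg (by have := incrConst_pos (n := n) hL; positivity) ?_
    intro k hk hX
    have hbox : InBox (j + 1) k (-(5 / 16)) (21 / 16) y ∧
        InBox (j + 1) k (-(5 / 16)) (21 / 16) (y + Pi.single i h) := by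
      by_cases hφ : cbump (j + 1) k y = 0
      · have hφ' : cbump (j + 1) k (y + Pi.single i h) ≠ 0 := fun h => hX (by rw [h, hφ]; simp)
        have hb := inBox_of_cbump hφ'
        have hb' := hb.add_single habs' i
        rw [Pi.single_neg, add_neg_cancel_right] at hb'
        exact ⟨hb'.mono (by norm_num) (by norm_num), hb.mono (by norm_num) (by norm_num)⟩
      · have hb := inBox_of_cbump hφ
        exact ⟨hb.mono (by norm_num) (by norm_num),
          (hb.add_single habs i).mono (by norm_num) (by norm_num)⟩
    refine ⟨hbox.1.nearCube (by norm_num) (by norm_num), ?_⟩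
    obtain ⟨a1, a2⟩ := key k hk hbox.1
    obtain ⟨a2, -⟩ := a2 (hC.active j k hk _ hbox.2)
    set D := b (j + 1) k y - approx H b j y
    set D' := b (j + 1) k (y + Pi.single i h) - approx H b j (y + Pi.single i h)
    have e : cbump (j + 1) k (y + Pi.single i h) • D' - cbump (j + 1) k y • D =
        (cbump (j + 1) k (y + Pi.single i h) - cbump (j + 1) k y) • D +
        cbump (j + 1) k (y + Pi.single i h) • (D' - D) := by module
    rw [e]
    refine (norm_add_le _ _).trans ?_
    rw [norm_smul, norm_smul _ (D' - D), Real.norm_eq_abs, Real.norm_eq_abs,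
      abs_of_nonneg (cbump_nonneg (j + 1) k _)]
    have hd := (cbump_differences h1 h2 (j + 1) k y i h).1
    rw [abs_of_nonneg hh0] at hd
    have hεk := hC.nonneg (j + 1) k
    calc _ ≤ L * (h / side (j + 1)) * (5 ^ n * (ε (j + 1) k * side j)) +
          1 * (5 ^ n * ((L + 1) * ε (j + 1) k * h)) := by
          gcongr
          exact cbump_le_one _ _ _
      _ = incrConst n L * h * ε (j + 1) k := by
          rw [hss]; unfold incrConst; field_simp; ring
  · intro hne
    obtain ⟨k, hk, hX⟩ := Finset.exists_ne_zero_of_sum_ne_zero hne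
    have hφ : cbump (j + 1) k y ≠ 0 := fun h => hX (by rw [h, zero_smul])
    have hbox := inBox_of_cbump hφ
    have hp := (hbox.add_single habs i).mono (lo' := -(5 / 16)) (hi' := 21 / 16)
      (by norm_num) (by norm_num)
    have hm := (hbox.add_single habs' i).mono (lo' := -(5 / 16)) (hi' := 21 / 16)
      (by norm_num) (by norm_num)
    rw [Pi.single_neg, ← sub_eq_add_neg] at hm
    obtain ⟨-, a2⟩ := key k hk (hbox.mono (by norm_num) (by norm_num))
    refine ((a2 (hC.active j k hk _ hp)).2 (hC.active j k hk _ hm)).trans ?_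
    have hεk := hC.nonneg (j + 1) k
    have hsz : ε (j + 1) k ≤ localSize H ε j y := by
      unfold localSize
      exact Finset.single_le_sum (f := fun k => ε (j + 1) k) (fun _ _ => hC.nonneg _ _)
        (Finset.mem_filter.2 ⟨hk, hbox.nearCube (by norm_num) (by norm_num)⟩)
    calc 5 ^ n * (3 * L * ε (j + 1) k * h ^ 2 / side j) =
          5 ^ n * (3 * L) * (h ^ 2 / side j) * ε (j + 1) k := by ring
      _ ≤ 5 ^ n * (3 * L + 1) * (h ^ 2 / side j) * localSize H ε j y := by
          gcongr; linarith
      _ = _ := rfl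

end Increment

section Energy

variable {n : ℕ} {W : Type*} [NormedAddCommGroup W] [InnerProductSpace ℝ W]
  {H : ℕ → Finset (Fin n → ℤ)} {b : ℕ → (Fin n → ℤ) → ((Fin n → ℝ) →ᵃ[ℝ] W)}
  {ε : ℕ → (Fin n → ℤ) → ℝ}

/-- The energy of first differences. -/
def diffEnergy (A : (Fin n → ℝ) → W) (v : Fin n → ℝ) : ℝ := ∫ y, ‖A (y + v) - A y‖ ^ 2

lemma integrable_inner_translate {A B : (Fin n → ℝ) → W} (hA : Continuous A) (hB : Continuous B)
    (hBc : HasCompactSupport B) (u v : Fin n → ℝ) :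
    Integrable fun y => inner ℝ (A (y + u)) (B (y + v)) := by
  have hBv : HasCompactSupport fun y => B (y + v) :=
    hBc.comp_homeomorph (Homeomorph.addRight v)
  have hc : HasCompactSupport fun y => inner ℝ (A (y + u)) (B (y + v)) := by
    refine hBv.mono fun y hy hB0 => hy ?_
    simp only at hB0 ⊢
    rw [hB0, inner_zero_right]
  refine Continuous.integrable_of_hasCompactSupport ?_ hc
  exact (hA.comp (continuous_add_const u)).inner (hB.comp (continuous_add_const v))

/-- Summation by parts for first differences. -/
lemma integral_inner_differences {A B : (Fin n → ℝ) → W} (hA : Continuous A) (hB : Continuous B)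
    (hBc : HasCompactSupport B) (v : Fin n → ℝ) :
    ∫ y, inner ℝ (A (y + v) - A y) (B (y + v) - B y) =
      -∫ y, inner ℝ (A (y + v) - (2 : ℝ) • A y + A (y - v)) (B y) := by
  have I := fun u w => integrable_inner_translate hA hB hBc u w
  have i1 := I v v
  have i2 := I 0 v
  have i3 := I v 0
  have i4 := I 0 0
  have i5 := I (-v) 0
  simp only [add_zero, ← sub_eq_add_neg] at i1 i2 i3 i4 i5
  have s1 : ∫ y, inner ℝ (A (y + v)) (B (y + v)) = ∫ y, inner ℝ (A y) (B y) :=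
    integral_add_right_eq_self (fun y => inner ℝ (A y) (B y)) v
  have s2 : ∫ y, inner ℝ (A y) (B (y + v)) = ∫ y, inner ℝ (A (y - v)) (B y) := by
    have := integral_add_right_eq_self (μ := volume) (fun y => inner ℝ (A (y - v)) (B y)) v
    simpa only [add_sub_cancel_right] using this
  have e1 : (fun y => inner ℝ (A (y + v) - A y) (B (y + v) - B y)) = fun y =>
      (inner ℝ (A (y + v)) (B (y + v)) - inner ℝ (A y) (B (y + v))) -
      (inner ℝ (A (y + v)) (B y) - inner ℝ (A y) (B y)) := by
    funext y; rw [inner_sub_right, inner_sub_left, inner_sub_left]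
  have e2 : (fun y => inner ℝ (A (y + v) - (2 : ℝ) • A y + A (y - v)) (B y)) = fun y =>
      (inner ℝ (A (y + v)) (B y) - 2 * inner ℝ (A y) (B y)) + inner ℝ (A (y - v)) (B y) := by
    funext y; rw [inner_add_left, inner_sub_left, real_inner_smul_left]
  have j12 : Integrable fun y => inner ℝ (A (y + v)) (B (y + v)) - inner ℝ (A y) (B (y + v)) :=
    i1.sub i2
  have j34 : Integrable fun y => inner ℝ (A (y + v)) (B y) - inner ℝ (A y) (B y) := i3.sub i4
  have j34' : Integrable fun y => inner ℝ (A (y + v)) (B y) - 2 * inner ℝ (A y) (B y) :=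
    i3.sub (i4.const_mul 2)
  rw [e1, e2, integral_sub j12 j34, integral_sub i1 i2, integral_sub i3 i4,
    integral_add j34' i5, integral_sub i3 (i4.const_mul 2),
    integral_const_mul, s1, s2]
  ring

lemma localSize_sq_le (j : ℕ) (y : Fin n → ℝ) :
    localSize H ε j y ^ 2 ≤ 5 ^ n * ∑ k ∈ H (j + 1),
      ({y | NearCube (j + 1) k 2 y} : Set (Fin n → ℝ)).indicator (fun _ => ε (j + 1) k ^ 2) y := by
  classical
  unfold localSize
  refine sq_sum_le_card_mul_sum_sq.trans ?_
  have h1 : ((H (j + 1)).filter fun k => NearCube (j + 1) k 2 y).card ≤ 5 ^ n :=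
    card_nearCube_le (j + 1) y _ 2 fun k hk => by exact_mod_cast (Finset.mem_filter.1 hk).2
  have h2 : ∑ k ∈ (H (j + 1)).filter (fun k => NearCube (j + 1) k 2 y), ε (j + 1) k ^ 2 =
      ∑ k ∈ H (j + 1), ({y | NearCube (j + 1) k 2 y} : Set (Fin n → ℝ)).indicator
        (fun _ => ε (j + 1) k ^ 2) y := by
    rw [Finset.sum_filter]
    rfl
  rw [← h2]
  gcongr
  exact_mod_cast h1

lemma integrable_indicator_nearCube (j : ℕ) (k : Fin n → ℤ) (c e : ℝ) :
    Integrable (({y | NearCube j k c y} : Set (Fin n → ℝ)).indicator fun _ => e) := by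
  have h := isCompact_nearCube j k c
  exact (integrable_indicator_iff h.isClosed.measurableSet).2
    (integrableOn_const h.measure_lt_top.ne)

lemma integral_indicator_nearCube (j : ℕ) (k : Fin n → ℤ) (e : ℝ) :
    ∫ y, ({y | NearCube j k 2 y} : Set (Fin n → ℝ)).indicator (fun _ => e) y =
      4 ^ n * (e * side j ^ n) := by
  have h := isCompact_nearCube j k 2
  rw [integral_indicator_const _ h.isClosed.measurableSet, Measure.real, volume_nearCube _ _ _
    (by norm_num), ENNReal.toReal_ofReal (by have := side_pos j; positivity), smul_eq_mul, mul_pow]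
  norm_num
  ring

/-- The increase of the energy in one generation. -/
lemma diffEnergy_succ_le {L : ℝ} (hL : 1 ≤ L) (h1 : ∀ t h, |bump (t + h) - bump t| ≤ L * |h|)
    (h2 : ∀ t h, |bump (t + h) - 2 * bump t + bump (t - h)| ≤ L * h ^ 2)
    (hC : Compatible H b ε) {j : ℕ} {h : ℝ} (hh0 : 0 ≤ h)
    (hh : h ≤ 1 / 16 * side (j + 1)) (i : Fin n) :
    diffEnergy (approx H b (j + 1)) (Pi.single i h) ≤ diffEnergy (approx H b j) (Pi.single i h) +
      3 * incrConst n L ^ 2 * 20 ^ n * h ^ 2 * ∑ k ∈ H (j + 1), ε (j + 1) k ^ 2 * side (j + 1) ^ n := by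
  set v : Fin n → ℝ := Pi.single i h with hv
  set A := approx H b j with hA
  set B := corr H b j with hB
  set Q := incrConst n L with hQ
  have hQpos : 0 < Q := incrConst_pos hL
  have hQ1 : 1 ≤ Q := by
    rw [hQ, incrConst]
    have : (1 : ℝ) ≤ 5 ^ n := one_le_pow₀ (by norm_num)
    nlinarith
  have hs := side_pos j
  have cA : Continuous A := continuous_approx j
  have cB : Continuous B := continuous_corr j
  have kA : HasCompactSupport A := hasCompactSupport_approx j
  have kB : HasCompactSupport B := hasCompactSupport_corr j
  set G : (Fin n → ℝ) → ℝ := fun y => ∑ k ∈ H (j + 1),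
    ({y | NearCube (j + 1) k 2 y} : Set (Fin n → ℝ)).indicator (fun _ => ε (j + 1) k ^ 2) y with hG
  have iG : Integrable G := integrable_finsetSum _ fun k _ => integrable_indicator_nearCube _ _ _ _
  have vG : ∫ y, G y = 4 ^ n * ∑ k ∈ H (j + 1), ε (j + 1) k ^ 2 * side (j + 1) ^ n := by
    rw [hG, integral_finsetSum _ fun k _ => integrable_indicator_nearCube _ _ _ _, Finset.mul_sum]
    exact Finset.sum_congr rfl fun k _ => integral_indicator_nearCube _ _ _
  have hsz := fun y => localSize_sq_le (H := H) (ε := ε) j y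
  have bd := fun y => corr_bounds hL h1 h2 hC y hh0 hh i
  have cΔ : ∀ {F : (Fin n → ℝ) → W}, Continuous F → Continuous fun y => F (y + v) - F y := by
    intro F hF; fun_prop
  have kΔ : ∀ {F : (Fin n → ℝ) → W}, HasCompactSupport F →
      HasCompactSupport fun y => F (y + v) - F y := by
    intro F hF
    exact (hF.comp_homeomorph (Homeomorph.addRight v)).sub hF
  have ksq : ∀ {F : (Fin n → ℝ) → W}, Continuous F → HasCompactSupport F →
      Integrable fun y => ‖F y‖ ^ 2 := by
    intro F hF hF'
    refine Continuous.integrable_of_hasCompactSupport (by fun_prop) ?_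
    refine hF'.mono fun y hy hy' => hy ?_
    simp only at hy' ⊢
    rw [hy', norm_zero]; simp
  have iA := ksq (cΔ cA) (kΔ kA)
  have iB := ksq (cΔ cB) (kΔ kB)
  have iAB : Integrable fun y => inner ℝ (A (y + v) - A y) (B (y + v) - B y) := by
    simpa using integrable_inner_translate (cΔ cA) (cΔ cB) (kΔ kB) 0 0
  have e : ∀ y, ‖approx H b (j + 1) (y + v) - approx H b (j + 1) y‖ ^ 2 =
      ‖A (y + v) - A y‖ ^ 2 + 2 * inner ℝ (A (y + v) - A y) (B (y + v) - B y) +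
      ‖B (y + v) - B y‖ ^ 2 := by
    intro y
    rw [approx_succ, approx_succ, ← norm_add_sq_real]
    congr 2
    abel
  unfold diffEnergy
  simp only [e]
  have iA2 : Integrable fun y => ‖A (y + v) - A y‖ ^ 2 +
      2 * inner ℝ (A (y + v) - A y) (B (y + v) - B y) := iA.add (iAB.const_mul 2)
  rw [integral_add iA2 iB, integral_add iA (iAB.const_mul 2),
    integral_const_mul, integral_inner_differences cA cB kB, add_assoc]
  refine add_le_add le_rfl ?_
  have b1 : -∫ y, inner ℝ (A (y + v) - (2 : ℝ) • A y + A (y - v)) (B y) ≤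
      ∫ y, Q ^ 2 * h ^ 2 * 5 ^ n * G y := by
    rw [← integral_neg]
    refine integral_mono ?_ (iG.const_mul _) fun y => ?_
    · have cD : Continuous fun y => A (y + v) - (2 : ℝ) • A y + A (y - v) := by fun_prop
      simpa using (integrable_inner_translate cD cB kB 0 0).neg
    · simp only
      refine (neg_le_abs _).trans ((abs_real_inner_le_norm _ _).trans ?_)
      by_cases h0 : B y = 0
      · rw [h0, norm_zero, mul_zero]
        have : 0 ≤ G y := Finset.sum_nonneg fun k _ => Set.indicator_nonneg
          (fun _ _ => sq_nonneg _) _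
        positivity
      · obtain ⟨a1, -, a3⟩ := bd y
        calc _ ≤ (Q * (h ^ 2 / side j) * localSize H ε j y) * (Q * side j * localSize H ε j y) :=
              mul_le_mul (a3 h0) a1 (norm_nonneg _) ((norm_nonneg _).trans (a3 h0))
          _ = Q ^ 2 * h ^ 2 * localSize H ε j y ^ 2 := by field_simp
          _ ≤ Q ^ 2 * h ^ 2 * (5 ^ n * G y) := by gcongr; exact hsz y
          _ = _ := by ring
  have b2 : ∫ y, ‖B (y + v) - B y‖ ^ 2 ≤ ∫ y, Q ^ 2 * h ^ 2 * 5 ^ n * G y := by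
    refine integral_mono iB (iG.const_mul _) fun y => ?_
    simp only
    obtain ⟨-, a2, -⟩ := bd y
    calc _ ≤ (Q * h * localSize H ε j y) ^ 2 := by gcongr
      _ = Q ^ 2 * h ^ 2 * localSize H ε j y ^ 2 := by ring
      _ ≤ Q ^ 2 * h ^ 2 * (5 ^ n * G y) := by gcongr; exact hsz y
      _ = _ := by ring
  rw [integral_const_mul, vG] at b1 b2
  have e20 : (20 : ℝ) ^ n = 5 ^ n * 4 ^ n := by rw [← mul_pow]; norm_num
  rw [e20]
  linarith

/-- The energy of the approximation is controlled by the sizes of all increments. -/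
lemma diffEnergy_le {L : ℝ} (hL : 1 ≤ L) (h1 : ∀ t h, |bump (t + h) - bump t| ≤ L * |h|)
    (h2 : ∀ t h, |bump (t + h) - 2 * bump t + bump (t - h)| ≤ L * h ^ 2)
    (hC : Compatible H b ε) (J : ℕ) {h : ℝ} (hh0 : 0 ≤ h)
    (hh : h ≤ 1 / 16 * side J) (i : Fin n) :
    diffEnergy (approx H b J) (Pi.single i h) ≤
      3 * incrConst n L ^ 2 * 20 ^ n * h ^ 2 * ∑ j ∈ Finset.range J, ∑ k ∈ H (j + 1),
        ε (j + 1) k ^ 2 * side (j + 1) ^ n := by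
  induction J with
  | zero => simp [diffEnergy, approx]
  | succ J ih =>
    have hs := side_succ J
    have hsp := side_pos J
    rw [Finset.sum_range_succ, mul_add]
    exact (diffEnergy_succ_le hL h1 h2 hC hh0 hh i).trans
      (add_le_add (ih (by linarith)) le_rfl)

end Energy

section Steep

variable {n : ℕ} {W : Type*} [NormedAddCommGroup W] [InnerProductSpace ℝ W]
  {H : ℕ → Finset (Fin n → ℤ)} {b : ℕ → (Fin n → ℤ) → ((Fin n → ℝ) →ᵃ[ℝ] W)}
  {ε : ℕ → (Fin n → ℤ) → ℝ}

lemma setOf_inBox (j : ℕ) (k : Fin n → ℤ) (lo hi : ℝ) : {y : Fin n → ℝ | InBox j k lo hi y} =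
    Set.univ.pi fun i => Set.Icc ((k i + lo) * side j) ((k i + hi) * side j) := by
  ext y
  simp only [Set.mem_ofPred_eq, Set.mem_univ_pi, InBox, Set.mem_Icc]
  refine forall_congr' fun i => ?_
  rw [side, ← div_eq_mul_inv, ← div_eq_mul_inv, div_le_iff₀ (by positivity),
    le_div_iff₀ (by positivity)]
  constructor <;> rintro ⟨h1, h2⟩ <;> constructor <;> linarith

lemma measurableSet_inBox (j : ℕ) (k : Fin n → ℤ) (lo hi : ℝ) :
    MeasurableSet {y : Fin n → ℝ | InBox j k lo hi y} := by
  rw [setOf_inBox]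
  exact MeasurableSet.univ_pi fun i => measurableSet_Icc

lemma volume_inBox (j : ℕ) (k : Fin n → ℤ) {lo hi : ℝ} (h : lo ≤ hi) :
    volume {y : Fin n → ℝ | InBox j k lo hi y} = ENNReal.ofReal (((hi - lo) * side j) ^ n) := by
  rw [setOf_inBox, volume_pi_pi]
  simp only [Real.volume_Icc]
  rw [Finset.prod_congr rfl fun i _ => by
    rw [show (k i + hi) * side j - (k i + lo) * side j = (hi - lo) * side j by ring]]
  rw [Finset.prod_const, Finset.card_univ, Fintype.card_fin, ENNReal.ofReal_pow]
  exact mul_nonneg (by linarith) (side_pos j).le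

lemma side_anti {j J : ℕ} (h : j ≤ J) : side J ≤ side j := by
  unfold side
  gcongr
  norm_num

lemma approx_eq_add_sum {j J : ℕ} (h : j ≤ J) (y : Fin n → ℝ) :
    approx H b J y = approx H b j y + ∑ m ∈ Finset.Ico j J, corr H b m y := by
  induction J, h using Nat.le_induction with
  | base => simp
  | succ J hJ ih =>
    rw [approx_succ, ih, Finset.sum_Ico_succ_top hJ, add_assoc]

lemma localSize_le {e : ℝ} (he : 0 ≤ e) (hε : ∀ j, ∀ k ∈ H j, ε j k ≤ e) (j : ℕ)
    (y : Fin n → ℝ) : localSize H ε j y ≤ 5 ^ n * e := by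
  classical
  unfold localSize
  refine (Finset.sum_le_card_nsmul _ _ e fun k hk => hε _ _ (Finset.mem_filter.1 hk).1).trans ?_
  rw [nsmul_eq_mul]
  have : ((H (j + 1)).filter fun k => NearCube (j + 1) k 2 y).card ≤ 5 ^ n :=
    card_nearCube_le (j + 1) y _ 2 fun k hk => by exact_mod_cast (Finset.mem_filter.1 hk).2
  gcongr
  exact_mod_cast this

/-- If the affine map attached to a cube is steep and the construction stops there, then the
final approximation has a large difference over the middle of the cube. -/
lemma le_norm_difference {L : ℝ} (hL : 1 ≤ L) (h1 : ∀ t h, |bump (t + h) - bump t| ≤ L * |h|)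
    (h2 : ∀ t h, |bump (t + h) - 2 * bump t + bump (t - h)| ≤ L * h ^ 2)
    (hC : Compatible H b ε) {e : ℝ} (he : 0 ≤ e) (hε : ∀ j, ∀ k ∈ H j, ε j k ≤ e)
    (hsmall : 5 * 5 ^ n * incrConst n L * e ≤ 1 / 4) {j J : ℕ} (hJ : j ≤ J) (i : Fin n)
    {f : (Fin n → ℝ) →ᵃ[ℝ] W} (hf : 1 / 2 ≤ ‖f.linear (Pi.single i 1)‖) {y : Fin n → ℝ} {h : ℝ}
    (hh0 : 0 ≤ h) (hh : h ≤ 1 / 16 * side J)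
    (hact : ∀ k, cbump j k y ≠ 0 → k ∈ H j)
    (hact' : ∀ k, cbump j k (y + Pi.single i h) ≠ 0 → k ∈ H j)
    (hcl : ∀ k ∈ H j, NearCube j k 2 y → SlopeLE (f - b j k) e ∧ ‖(f - b j k) y‖ ≤ e * side j)
    (hz : ∀ m, j + 4 ≤ m → ∀ k ∈ H (m + 1),
      cbump (m + 1) k y = 0 ∧ cbump (m + 1) k (y + Pi.single i h) = 0) :
    h / 4 ≤ ‖approx H b J (y + Pi.single i h) - approx H b J y‖ := by
  have hsj : h ≤ 1 / 16 * side j := hh.trans (by have := side_anti hJ; linarith)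
  obtain ⟨-, a⟩ := affine_sub_approx_differences hL h1 h2 hC.zero he f hcl hh0 hsj i hact
  obtain ⟨a, -⟩ := a hact'
  set Q := incrConst n L with hQ
  have hQp : 0 < Q := incrConst_pos hL
  have ha : ‖(f (y + Pi.single i h) - approx H b j (y + Pi.single i h)) -
      (f y - approx H b j y)‖ ≤ Q * e * h := by
    refine a.trans ?_
    rw [hQ, incrConst]
    calc 5 ^ n * ((L + 1) * e * h) = 5 ^ n * (L + 1) * e * h := by ring
      _ ≤ 5 ^ n * (3 * L + 1) * e * h := by gcongr; linarith
  have hsum : ‖∑ m ∈ Finset.Ico j J, (corr H b m (y + Pi.single i h) - corr H b m y)‖ ≤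
      (4 : ℕ) * (Q * h * (5 ^ n * e)) := by
    refine norm_sum_le_card_mul (Finset.Ico j J) ((Finset.Ico j J).filter (· < j + 4)) _ ?_
      (by positivity) ?_ ?_ (Finset.filter_subset _ _)
    · have : (Finset.Ico j J).filter (· < j + 4) ⊆ Finset.Ico j (j + 4) := by
        intro m hm
        rw [Finset.mem_filter, Finset.mem_Ico] at hm
        exact Finset.mem_Ico.2 ⟨hm.1.1, hm.2⟩
      simpa using Finset.card_le_card this
    · intro m hm hm'
      have hm4 : j + 4 ≤ m := by
        by_contra hc
        exact hm' (Finset.mem_filter.2 ⟨hm, by omega⟩)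
      unfold corr
      rw [Finset.sum_eq_zero fun k hk => by rw [(hz m hm4 k hk).2, zero_smul],
        Finset.sum_eq_zero fun k hk => by rw [(hz m hm4 k hk).1, zero_smul], sub_zero]
    · intro m hm
      have hmJ := (Finset.mem_Ico.1 (Finset.mem_filter.1 hm).1).2
      have hm1 : h ≤ 1 / 16 * side (m + 1) := hh.trans (by
        have := side_anti (show m + 1 ≤ J from hmJ)
        linarith)
      refine (corr_bounds hL h1 h2 hC y hh0 hm1 i).2.1.trans ?_
      gcongr
      exact localSize_le he hε m y
  rw [affine_add_single] at ha
  rw [approx_eq_add_sum hJ, approx_eq_add_sum hJ]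
  rw [Finset.sum_sub_distrib] at hsum
  set F := h • f.linear (Pi.single i 1) with hF
  have hFn : h / 2 ≤ ‖F‖ := by
    rw [hF, norm_smul, Real.norm_eq_abs, abs_of_nonneg hh0]
    nlinarith
  set S := ∑ m ∈ Finset.Ico j J, corr H b m y
  set S' := ∑ m ∈ Finset.Ico j J, corr H b m (y + Pi.single i h)
  have hdec : F = (approx H b j (y + Pi.single i h) + S' - (approx H b j y + S)) - (S' - S) +
      ((f y + F - approx H b j (y + Pi.single i h)) - (f y - approx H b j y)) := by abel
  have h3 : ‖F‖ ≤ ‖approx H b j (y + Pi.single i h) + S' - (approx H b j y + S)‖ + ‖S' - S‖ +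
      ‖(f y + F - approx H b j (y + Pi.single i h)) - (f y - approx H b j y)‖ := by
    conv_lhs => rw [hdec]
    exact (norm_add_le _ _).trans (add_le_add (norm_sub_le _ _) le_rfl)
  have h5 : (1 : ℝ) ≤ 5 ^ n := one_le_pow₀ (by norm_num)
  have h6 : Q * e * h ≤ 5 ^ n * (Q * e * h) := le_mul_of_one_le_left (by positivity) h5
  have h7 : 5 * 5 ^ n * Q * e * h ≤ 1 / 4 * h := by gcongr
  push_cast at hsum
  nlinarith

/-- The steep cubes where the construction stops are controlled by the sizes of the increments. -/
lemma sum_steep_le {L : ℝ} (hL : 1 ≤ L) (h1 : ∀ t h, |bump (t + h) - bump t| ≤ L * |h|)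
    (h2 : ∀ t h, |bump (t + h) - 2 * bump t + bump (t - h)| ≤ L * h ^ 2)
    (hC : Compatible H b ε) {e : ℝ} (he : 0 ≤ e) (hε : ∀ j, ∀ k ∈ H j, ε j k ≤ e)
    (hsmall : 5 * 5 ^ n * incrConst n L * e ≤ 1 / 4) {J : ℕ} (i : Fin n)
    (T : Finset (ℕ × (Fin n → ℤ))) (hTJ : ∀ s ∈ T, s.1 + 1 ≤ J)
    (hT : ∀ s ∈ T, ∃ f : (Fin n → ℝ) →ᵃ[ℝ] W, 1 / 2 ≤ ‖f.linear (Pi.single i 1)‖ ∧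
      ∀ y, InBox (s.1 + 1) s.2 (3 / 16) (13 / 16) y →
        (∀ k, cbump s.1 k y ≠ 0 → k ∈ H s.1) ∧
        (∀ k ∈ H s.1, NearCube s.1 k 2 y →
          SlopeLE (f - b s.1 k) e ∧ ‖(f - b s.1 k) y‖ ≤ e * side s.1) ∧
        ∀ m, s.1 + 4 ≤ m → ∀ k ∈ H (m + 1), cbump (m + 1) k y = 0)
    (hdisj : ∀ s ∈ T, ∀ s' ∈ T, ∀ y, InBox (s.1 + 1) s.2 (1 / 4) (3 / 4) y →
      InBox (s'.1 + 1) s'.2 (1 / 4) (3 / 4) y → s = s') :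
    ∑ s ∈ T, side (s.1 + 1) ^ n ≤ 48 * incrConst n L ^ 2 * 40 ^ n *
      ∑ j ∈ Finset.range J, ∑ k ∈ H (j + 1), ε (j + 1) k ^ 2 * side (j + 1) ^ n := by
  classical
  set h : ℝ := 1 / 16 * side J with hh
  have hhp : 0 < h := by have := side_pos J; positivity
  set v : Fin n → ℝ := Pi.single i h with hv
  set A := approx H b J with hA
  have hE := diffEnergy_le hL h1 h2 hC J hhp.le hh.le i
  have cA : Continuous A := continuous_approx J
  have kA : HasCompactSupport A := hasCompactSupport_approx J
  have iA : Integrable fun y => ‖A (y + v) - A y‖ ^ 2 := by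
    refine Continuous.integrable_of_hasCompactSupport (by fun_prop) ?_
    refine ((kA.comp_homeomorph (Homeomorph.addRight v)).sub kA).mono fun y hy hy' => hy ?_
    have hy'' : A (y + v) - A y = 0 := hy'
    simp only
    rw [hy'', norm_zero]; simp
  let box : ℕ × (Fin n → ℤ) → Set (Fin n → ℝ) :=
    fun s => {y | InBox (s.1 + 1) s.2 (1 / 4) (3 / 4) y}
  have hvol : ∀ s, volume (box s) = ENNReal.ofReal ((1 / 2 * side (s.1 + 1)) ^ n) := by
    intro s
    rw [volume_inBox _ _ (by norm_num)]
    norm_num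
  have hmeas : ∀ s, MeasurableSet (box s) := fun s => measurableSet_inBox _ _ _ _
  have ibox : ∀ s, Integrable ((box s).indicator fun _ => (h / 4) ^ 2) := fun s =>
    (integrable_indicator_iff (hmeas s)).2
      (integrableOn_const (by rw [hvol]; exact ENNReal.ofReal_ne_top))
  have hpt : ∀ y, ∑ s ∈ T, (box s).indicator (fun _ => (h / 4) ^ 2) y ≤ ‖A (y + v) - A y‖ ^ 2 := by
    intro y
    by_cases hy : ∃ s ∈ T, y ∈ box s
    · obtain ⟨s, hs, hys⟩ := hy
      rw [Finset.sum_eq_single_of_mem s hs, Set.indicator_of_mem hys]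
      · have hbox : InBox (s.1 + 1) s.2 (1 / 4) (3 / 4) y := hys
        have hside := side_anti (hTJ s hs)
        have hbox' := hbox.add_single (d := 1 / 16) (h := h)
          (by rw [abs_of_pos hhp, hh]; gcongr) i
        obtain ⟨f, hf, hfy⟩ := hT s hs
        obtain ⟨c1, c2, c3⟩ := hfy y (hbox.mono (by norm_num) (by norm_num))
        obtain ⟨d1, -, d3⟩ := hfy (y + Pi.single i h) (hbox'.mono (by norm_num) (by norm_num))
        have := le_norm_difference hL h1 h2 hC he hε hsmall
          (show s.1 ≤ J by have := hTJ s hs; omega) i hf hhp.le hh.le c1 d1 c2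
          fun m hm k hk => ⟨c3 m hm k hk, d3 m hm k hk⟩
        gcongr
      · intro s' hs' hne
        refine Set.indicator_of_notMem (fun hys' => hne ?_) _
        exact hdisj s' hs' s hs y hys' hys
    · rw [Finset.sum_eq_zero]
      · positivity
      · intro s hs
        exact Set.indicator_of_notMem (fun hys => hy ⟨s, hs, hys⟩) _
  have hintegral : ∑ s ∈ T, (1 / 2 * side (s.1 + 1)) ^ n * (h / 4) ^ 2 ≤ diffEnergy A v := by
    unfold diffEnergy
    have hm := integral_mono (integrable_finsetSum T fun s _ => ibox s) iA hpt
    rw [integral_finsetSum _ fun s _ => ibox s] at hm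
    refine le_trans (le_of_eq (Finset.sum_congr rfl fun s _ => ?_)) hm
    rw [integral_indicator_const _ (hmeas s), Measure.real, hvol, ENNReal.toReal_ofReal, smul_eq_mul]
    have := side_pos (s.1 + 1)
    positivity
  have hfin := hintegral.trans hE
  set R := ∑ j ∈ Finset.range J, ∑ k ∈ H (j + 1), ε (j + 1) k ^ 2 * side (j + 1) ^ n
  have e1 : ∑ s ∈ T, (1 / 2 * side (s.1 + 1)) ^ n * (h / 4) ^ 2 =
      (h ^ 2 * (1 / 16 * (1 / 2) ^ n)) * ∑ s ∈ T, side (s.1 + 1) ^ n := by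
    rw [Finset.mul_sum]
    refine Finset.sum_congr rfl fun s _ => ?_
    rw [mul_pow]; ring
  rw [e1] at hfin
  have h3 : h ^ 2 * (1 / 16 * (1 / 2) ^ n) * ∑ s ∈ T, side (s.1 + 1) ^ n ≤
      h ^ 2 * (1 / 16 * (1 / 2) ^ n) * (48 * incrConst n L ^ 2 * 40 ^ n * R) := by
    refine hfin.trans (le_of_eq ?_)
    have : (40 : ℝ) ^ n = 20 ^ n * 2 ^ n := by rw [← mul_pow]; norm_num
    rw [this, one_div_pow]
    field_simp
    ring
  exact le_of_mul_le_mul_left h3 (by positivity)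

end Steep

section Tree

variable {N n : ℕ} {W : Type*} [NormedAddCommGroup W] [NormedSpace ℝ W]

/-- `b` is a good continuation, on the cube `(j, k)`, of the affine map `a` of its parent. -/
structure Good (S : Splitting N n W) (μ : Measure (EuclideanSpace ℝ (Fin N)))
    (e : ℕ → (Fin n → ℤ) → ℝ) (δ τ ε₀ : ℝ) (j : ℕ) (k : Fin n → ℤ)
    (a b : (Fin n → ℝ) →ᵃ[ℝ] W) : Prop where
  dens : ENNReal.ofReal (δ * side j ^ n) ≤ μ (win S a (2 * τ * side j) j k)
  le_eps : e j k ≤ ε₀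
  fit : ∀ x ∈ win S a (2 * τ * side j) j k, ∫⁻ w in closedBall x (20 * n * side j),
    ENNReal.ofReal (‖S.q w - b (S.p w)‖ ^ 2) ∂μ ≤
      ENNReal.ofReal (e j k ^ 2 * side j ^ 2 * side j ^ n)
  slope : SlopeLE b 1
  near : ∀ y, idx j y = k → ‖b y - a y‖ ≤ side j

open scoped Classical in
/-- The affine map attached to a cube. -/
def amap (S : Splitting N n W) (μ : Measure (EuclideanSpace ℝ (Fin N)))
    (e : ℕ → (Fin n → ℤ) → ℝ) (δ τ ε₀ : ℝ) : ℕ → (Fin n → ℤ) → ((Fin n → ℝ) →ᵃ[ℝ] W)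
  | 0, _ => 0
  | j + 1, k =>
    if h : ∃ b, Good S μ e δ τ ε₀ (j + 1) k (amap S μ e δ τ ε₀ j (par k)) b then h.choose else 0

/-- The cubes at which the construction has not stopped. -/
def InTree (S : Splitting N n W) (μ : Measure (EuclideanSpace ℝ (Fin N)))
    (e : ℕ → (Fin n → ℤ) → ℝ) (δ τ ε₀ : ℝ) : ℕ → (Fin n → ℤ) → Prop
  | 0, k => ∀ i, |k i| ≤ 6
  | j + 1, k => InTree S μ e δ τ ε₀ j (par k) ∧
      ∃ b, Good S μ e δ τ ε₀ (j + 1) k (amap S μ e δ τ ε₀ j (par k)) b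

/-- The standing assumptions of the stopping time construction. -/
structure Setup (S : Splitting N n W) (μ : Measure (EuclideanSpace ℝ (Fin N)))
    (e : ℕ → (Fin n → ℤ) → ℝ) (C₀ δ τ ε₀ : ℝ) (M : ℕ) : Prop where
  one_le : 1 ≤ n
  C₀_nonneg : 0 ≤ C₀
  growth : ∀ c r, 0 ≤ r → μ (closedBall c r) ≤ ENNReal.ofReal (C₀ * (2 * r) ^ n)
  M_pos : 0 < M
  δ_pos : 0 < δ
  δ_le : δ ≤ 1
  slab : slabConst n C₀ / M ≤ δ / (2 * (n + 1))
  τ_pos : 0 < τ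
  τ_le : 2 * (n + 1) * n * M * (2 * τ) ≤ 1
  e_nonneg : ∀ j k, 0 ≤ e j k
  e_zero_le : ∀ k, e 0 k ≤ ε₀
  fit_zero : ∀ k, (∀ i, |k i| ≤ 6) →
    ∫⁻ w, ENNReal.ofReal (‖S.q w‖ ^ 2) ∂μ ≤ ENNReal.ofReal (e 0 k ^ 2)
  exists_fit : ∀ j k, ∀ a : (Fin n → ℝ) →ᵃ[ℝ] W, SlopeLE a 1 →
    ENNReal.ofReal (δ * side (j + 1) ^ n) ≤ μ (win S a (2 * τ * side (j + 1)) (j + 1) k) →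
    ∃ b : (Fin n → ℝ) →ᵃ[ℝ] W, (∀ x ∈ win S a (2 * τ * side (j + 1)) (j + 1) k,
      ∫⁻ w in closedBall x (20 * n * side (j + 1)), ENNReal.ofReal (‖S.q w - b (S.p w)‖ ^ 2) ∂μ ≤
        ENNReal.ofReal (e (j + 1) k ^ 2 * side (j + 1) ^ 2 * side (j + 1) ^ n)) ∧
      ∀ y, idx (j + 1) y = k → ‖b y - a y‖ ≤ side (j + 1)
  small : cmpConst n M δ * (1 + 2 ^ (n + 1) * 17 ^ n) * ε₀ ≤ 1 / 16

/-- The window over the cube `(j, k)` around the graph of the map of the parent. -/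
def pwin (S : Splitting N n W) (μ : Measure (EuclideanSpace ℝ (Fin N)))
    (e : ℕ → (Fin n → ℤ) → ℝ) (δ τ ε₀ : ℝ) (j : ℕ) (k : Fin n → ℤ) :
    Set (EuclideanSpace ℝ (Fin N)) :=
  win S (amap S μ e δ τ ε₀ j (par k)) (2 * τ * side (j + 1)) (j + 1) k

variable {S : Splitting N n W} {μ : Measure (EuclideanSpace ℝ (Fin N))}
  {e : ℕ → (Fin n → ℤ) → ℝ} {C₀ δ τ ε₀ : ℝ} {M : ℕ}

lemma InTree.good {j : ℕ} {k : Fin n → ℤ} (h : InTree S μ e δ τ ε₀ (j + 1) k) :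
    Good S μ e δ τ ε₀ (j + 1) k (amap S μ e δ τ ε₀ j (par k)) (amap S μ e δ τ ε₀ (j + 1) k) := by
  have h' : ∃ b, Good S μ e δ τ ε₀ (j + 1) k (amap S μ e δ τ ε₀ j (par k)) b := h.2
  have : amap S μ e δ τ ε₀ (j + 1) k = h'.choose := by
    rw [amap, dif_pos h']
  rw [this]
  exact h'.choose_spec

lemma slopeLE_zero : SlopeLE (0 : (Fin n → ℝ) →ᵃ[ℝ] W) 1 := by
  intro i
  simp

lemma slopeLE_amap (j : ℕ) (k : Fin n → ℤ) : SlopeLE (amap S μ e δ τ ε₀ j k) 1 := by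
  cases j with
  | zero => exact slopeLE_zero
  | succ j =>
    rw [amap]
    split_ifs with h
    · exact h.choose_spec.slope
    · exact slopeLE_zero

lemma InTree.mono {j j' : ℕ} (h : j' ≤ j) {y : Fin n → ℝ}
    (hy : InTree S μ e δ τ ε₀ j (idx j y)) : InTree S μ e δ τ ε₀ j' (idx j' y) := by
  induction j, h using Nat.le_induction with
  | base => exact hy
  | succ j hj ih =>
    apply ih
    rw [← par_idx]
    exact hy.1

lemma InTree.bounds {j : ℕ} {k : Fin n → ℤ} (h : InTree S μ e δ τ ε₀ j k) (i : Fin n) :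
    -(7 * 2 ^ j) ≤ k i ∧ k i < 7 * 2 ^ j := by
  induction j generalizing k with
  | zero =>
    have h' := abs_le.1 (h i)
    constructor <;> norm_num <;> omega
  | succ j ih =>
    have := ih h.1
    simp only [par] at this
    rw [pow_succ]
    constructor <;> omega

lemma finite_inTree (j : ℕ) : {k | InTree S μ e δ τ ε₀ j k}.Finite := by
  refine (Fintype.piFinset fun _ : Fin n =>
    Finset.Icc (-(7 * 2 ^ j) : ℤ) (7 * 2 ^ j)).finite_toSet.subset fun k hk => ?_
  have hk' : InTree S μ e δ τ ε₀ j k := hk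
  rw [Finset.mem_coe, Fintype.mem_piFinset]
  exact fun i => Finset.mem_Icc.2 ⟨(hk'.bounds i).1, (hk'.bounds i).2.le⟩

namespace Setup

lemma one_le_real (D : Setup S μ e C₀ δ τ ε₀ M) : (1 : ℝ) ≤ n := by exact_mod_cast D.one_le

lemma τ_le_eighth (D : Setup S μ e C₀ δ τ ε₀ M) : 2 * τ ≤ 1 / 4 := by
  have hn := D.one_le_real
  have hM : (1 : ℝ) ≤ M := by exact_mod_cast D.M_pos
  have h1 : (2 : ℝ) * (1 + 1) * 1 * 1 * (2 * τ) ≤ 2 * (n + 1) * n * M * (2 * τ) := by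
    have := D.τ_pos
    gcongr
  linarith [D.τ_le]

lemma radius_le (D : Setup S μ e C₀ δ τ ε₀ M) (j : ℕ) : 2 * τ * side j ≤ side j / M := by
  have hn := D.one_le_real
  have hM : (1 : ℝ) ≤ M := by exact_mod_cast D.M_pos
  have hτ := D.τ_pos
  have h1 : (2 : ℝ) * (0 + 1) * 1 * M * (2 * τ) ≤ 2 * (n + 1) * n * M * (2 * τ) := by
    gcongr; linarith
  rw [le_div_iff₀ (by linarith)]
  have h2 : 2 * τ * M ≤ 1 := by nlinarith [D.τ_le]
  nlinarith [side_pos j]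

lemma slab_half (D : Setup S μ e C₀ δ τ ε₀ M) : slabConst n C₀ / M ≤ δ / 2 := by
  refine D.slab.trans ?_
  have hn := D.one_le_real
  have := D.δ_pos
  gcongr
  linarith

lemma cmpConst_pos (D : Setup S μ e C₀ δ τ ε₀ M) : 0 < cmpConst n M δ := by
  unfold cmpConst
  have := D.δ_pos
  positivity

lemma ε₀_nonneg (D : Setup S μ e C₀ δ τ ε₀ M) : 0 ≤ ε₀ :=
  (D.e_nonneg 0 0).trans (D.e_zero_le 0)

lemma e_le (D : Setup S μ e C₀ δ τ ε₀ M) {j : ℕ} {k : Fin n → ℤ}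
    (hk : InTree S μ e δ τ ε₀ j k) : e j k ≤ ε₀ := by
  cases j with
  | zero => exact D.e_zero_le k
  | succ j => exact hk.good.le_eps

lemma cmp_small (D : Setup S μ e C₀ δ τ ε₀ M) {s t : ℝ} (hs : s ≤ ε₀) (ht : t ≤ ε₀) :
    cmpConst n M δ * (s + t) ≤ 1 / 16 := by
  refine le_trans ?_ D.small
  rw [mul_assoc]
  have h0 := D.ε₀_nonneg
  have h1 : (1 : ℝ) ≤ 2 ^ (n + 1) * 17 ^ n :=
    one_le_mul_of_one_le_of_one_le (one_le_pow₀ (by norm_num)) (one_le_pow₀ (by norm_num))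
  refine mul_le_mul_of_nonneg_left ?_ D.cmpConst_pos.le
  nlinarith

/-- The map of a tree cube fits the measure near the cube. -/
lemma lintegral_near_le (D : Setup S μ e C₀ δ τ ε₀ M) {j : ℕ} {k : Fin n → ℤ}
    (hk : InTree S μ e δ τ ε₀ j k) {c : (Fin n → ℝ) →ᵃ[ℝ] W} (hc : SlopeLE c 1)
    (hgap : ∀ m, j = m + 1 → ∀ x ∈ pwin S μ e δ τ ε₀ m k,
      ‖S.q x - c (S.p x)‖ ≤ 3 / 2 * side j)
    {E : Set (EuclideanSpace ℝ (Fin N))}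
    (hE : ∀ x ∈ E, (∀ i, |idx j (S.p x) i - k i| ≤ 8) ∧ ‖S.q x - c (S.p x)‖ ≤ 1 / 2 * side j) :
    ∫⁻ x in E, ENNReal.ofReal (‖S.q x - amap S μ e δ τ ε₀ j k (S.p x)‖ ^ 2) ∂μ ≤
      ENNReal.ofReal (e j k ^ 2 * side j ^ 2 * side j ^ n) := by
  cases j with
  | zero =>
    have h0 := D.fit_zero k hk
    refine (setLIntegral_le_lintegral _ _).trans ?_
    simpa [amap, side] using h0
  | succ j =>
    have hg := hk.good
    have hne : (pwin S μ e δ τ ε₀ j k).Nonempty := by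
      by_contra hcon
      have h0 := hg.dens
      rw [Set.not_nonempty_iff_eq_empty] at hcon
      rw [show win S (amap S μ e δ τ ε₀ j (par k)) (2 * τ * side (j + 1)) (j + 1) k = ∅ from hcon,
        measure_empty, nonpos_iff_eq_zero, ENNReal.ofReal_eq_zero] at h0
      have := D.δ_pos
      have := side_pos (j + 1)
      have : 0 < δ * side (j + 1) ^ n := by positivity
      linarith
    obtain ⟨x', hx'⟩ := hne
    refine le_trans (lintegral_mono_set fun x hx => ?_) (hg.fit x' hx')
    obtain ⟨h1, h2⟩ := hE x hx
    have h3 := hgap j rfl x' hx'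
    have hidx : idx (j + 1) (S.p x') = k := hx'.1
    rw [mem_closedBall, dist_eq_norm]
    refine (norm_sub_le_of_gap S hc h2 h3).trans ?_
    have h4 := norm_sub_le_of_idx_near (d := 8) (j := j + 1) (y := S.p x) (z := S.p x')
      (by rw [hidx]; exact_mod_cast h1)
    have hn := D.one_le_real
    have hs := side_pos (j + 1)
    push_cast at h4
    calc 2 * n * ‖S.p x - S.p x'‖ + 1 / 2 * side (j + 1) + 3 / 2 * side (j + 1) ≤
          2 * n * ((8 + 1) * side (j + 1)) + 1 / 2 * side (j + 1) + 3 / 2 * side (j + 1) := by gcongr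
      _ ≤ 20 * n * side (j + 1) := by nlinarith

end Setup

end Tree

section Compat

variable {N n : ℕ} {W : Type*} [NormedAddCommGroup W] [NormedSpace ℝ W]
  {S : Splitting N n W} {μ : Measure (EuclideanSpace ℝ (Fin N))}
  {e : ℕ → (Fin n → ℤ) → ℝ} {C₀ δ τ ε₀ : ℝ} {M : ℕ}

lemma abs_par_sub_le {k k' : Fin n → ℤ} {i : Fin n} {d : ℤ} (h : |k i - k' i| ≤ d) :
    2 * |par k i - par k' i| ≤ d + 1 := by
  simp only [par]
  rw [abs_le] at h
  rcases abs_cases (k i / 2 - k' i / 2) with h' | h' <;> omega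

namespace Setup

/-- Maps of neighbouring tree cubes of the same generation are close to each other. -/
lemma compare_same [IsFiniteMeasure μ] (D : Setup S μ e C₀ δ τ ε₀ M) {j : ℕ} {k k' : Fin n → ℤ}
    (hk : InTree S μ e δ τ ε₀ j k) (hk' : InTree S μ e δ τ ε₀ j k') (hkk : ∀ i, |k i - k' i| ≤ 8) :
    SlopeLE (amap S μ e δ τ ε₀ j k - amap S μ e δ τ ε₀ j k') (cmpConst n M δ * (e j k + e j k')) ∧
      ∀ y, NearCube j k 20 y → ‖amap S μ e δ τ ε₀ j k y - amap S μ e δ τ ε₀ j k' y‖ ≤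
        cmpConst n M δ * (e j k + e j k') * side j := by
  induction j generalizing k k' with
  | zero =>
    have h0 : 0 ≤ cmpConst n M δ * (e 0 k + e 0 k') :=
      mul_nonneg D.cmpConst_pos.le (add_nonneg (D.e_nonneg _ _) (D.e_nonneg _ _))
    constructor
    · intro i
      simpa [amap] using h0
    · intro y _
      simpa [amap] using mul_nonneg h0 (side_pos 0).le
  | succ j ih =>
    have hs := side_pos (j + 1)
    have hss := side_succ j
    have hτ := D.τ_le_eighth
    have hpp : ∀ i, |par k i - par k' i| ≤ 8 := fun i => by
      have := abs_par_sub_le (hkk i)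
      omega
    have hpar := (ih hk.1 hk'.1 hpp).2
    have hsmall := D.cmp_small (D.e_le hk.1) (D.e_le hk'.1)
    have hwin : ∀ (k : Fin n → ℤ), ∀ x ∈ pwin S μ e δ τ ε₀ j k,
        ‖S.q x - amap S μ e δ τ ε₀ j (par k) (S.p x)‖ ≤ 1 / 4 * side (j + 1) := fun k x hx => by
      refine hx.2.trans ?_
      gcongr
    have hfit : ∫⁻ x in pwin S μ e δ τ ε₀ j k,
        ENNReal.ofReal (‖S.q x - amap S μ e δ τ ε₀ (j + 1) k (S.p x)‖ ^ 2) ∂μ ≤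
        ENNReal.ofReal (e (j + 1) k ^ 2 * side (j + 1) ^ 2 * side (j + 1) ^ n) := by
      refine D.lintegral_near_le hk (c := amap S μ e δ τ ε₀ j (par k)) (slopeLE_amap j (par k)) ?_ ?_
      · rintro m hm x hx
        obtain rfl : j = m := by omega
        linarith [hwin k x hx]
      · intro x hx
        have hx1 : idx (j + 1) (S.p x) = k := hx.1
        refine ⟨fun i => by simp [hx1], by linarith [hwin k x hx]⟩
    have hfit' : ∫⁻ x in pwin S μ e δ τ ε₀ j k,
        ENNReal.ofReal (‖S.q x - amap S μ e δ τ ε₀ (j + 1) k' (S.p x)‖ ^ 2) ∂μ ≤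
        ENNReal.ofReal (e (j + 1) k' ^ 2 * side (j + 1) ^ 2 * side (j + 1) ^ n) := by
      refine D.lintegral_near_le hk' (c := amap S μ e δ τ ε₀ j (par k')) (slopeLE_amap j (par k')) ?_ ?_
      · rintro m hm x hx
        obtain rfl : j = m := by omega
        linarith [hwin k' x hx]
      · intro x hx
        have hx1 : idx (j + 1) (S.p x) = k := hx.1
        refine ⟨fun i => by rw [hx1]; exact hkk i, ?_⟩
        have hnear : NearCube j (par k) 20 (S.p x) := by
          have h1 : idx j (S.p x) = par k := by rw [← par_idx, hx1]
          exact fun i => (nearCube_of_idx h1 i).trans (by norm_num)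
        have h2 := hpar _ hnear
        have h3 := norm_sub_le_norm_sub_add_norm_sub (S.q x)
          (amap S μ e δ τ ε₀ j (par k) (S.p x)) (amap S μ e δ τ ε₀ j (par k') (S.p x))
        have h4 := hwin k x hx
        have h5 := mul_le_mul_of_nonneg_right hsmall (side_pos j).le
        linarith
    exact compare_affine D.one_le S D.C₀_nonneg D.growth (slopeLE_amap j (par k)) D.M_pos
      (D.radius_le (j + 1)) D.δ_pos D.δ_le D.slab_half hk.good.dens (D.e_nonneg _ _)
      (D.e_nonneg _ _) hfit hfit'

lemma lintegral_pwin_le [IsFiniteMeasure μ] (D : Setup S μ e C₀ δ τ ε₀ M) {j : ℕ}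
    {k m : Fin n → ℤ} (hk : InTree S μ e δ τ ε₀ j (par k)) (hm : InTree S μ e δ τ ε₀ j m)
    (hkm : ∀ i, |par k i - m i| ≤ 8) :
    ∫⁻ x in pwin S μ e δ τ ε₀ j k,
      ENNReal.ofReal (‖S.q x - amap S μ e δ τ ε₀ j m (S.p x)‖ ^ 2) ∂μ ≤
      ENNReal.ofReal ((2 ^ (n + 1) * e j m) ^ 2 * side (j + 1) ^ 2 * side (j + 1) ^ n) := by
  have hss := side_succ j
  have hs := side_pos j
  have hτ := D.τ_le_eighth
  have hτ0 := D.τ_pos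
  refine (D.lintegral_near_le hm (c := amap S μ e δ τ ε₀ j m) (slopeLE_amap j m) ?_ ?_).trans ?_
  · rintro i rfl x hx
    have h1 := hm.good.near (S.p x) hx.1
    have h2 : ‖S.q x - amap S μ e δ τ ε₀ i (par m) (S.p x)‖ ≤ 2 * τ * side (i + 1) := hx.2
    have h3 := norm_sub_le_norm_sub_add_norm_sub (S.q x)
      (amap S μ e δ τ ε₀ i (par m) (S.p x)) (amap S μ e δ τ ε₀ (i + 1) m (S.p x))
    rw [norm_sub_rev (amap S μ e δ τ ε₀ i (par m) (S.p x))] at h3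
    nlinarith
  · intro x hx
    have h1 : idx j (S.p x) = par k := by
      have hx1 : idx (j + 1) (S.p x) = k := hx.1
      rw [← par_idx, hx1]
    refine ⟨fun i => by rw [h1]; exact hkm i, ?_⟩
    have hnear : NearCube j (par k) 20 (S.p x) :=
      fun i => (nearCube_of_idx h1 i).trans (by norm_num)
    have h2 := (D.compare_same hk hm hkm).2 _ hnear
    have h3 := norm_sub_le_norm_sub_add_norm_sub (S.q x)
      (amap S μ e δ τ ε₀ j (par k) (S.p x)) (amap S μ e δ τ ε₀ j m (S.p x))
    have h4 : ‖S.q x - amap S μ e δ τ ε₀ j (par k) (S.p x)‖ ≤ 2 * τ * side (j + 1) := hx.2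
    have h5 := mul_le_mul_of_nonneg_right (D.cmp_small (D.e_le hk) (D.e_le hm)) hs.le
    nlinarith
  · refine ENNReal.ofReal_le_ofReal ?_
    have h1 : side j = 2 * side (j + 1) := by rw [hss]; ring
    have h2 : (2 : ℝ) ^ n ≤ (2 ^ n) ^ 2 := by
      rw [sq]; exact le_mul_of_one_le_left (by positivity) (one_le_pow₀ (by norm_num))
    have hs1 := side_pos (j + 1)
    calc e j m ^ 2 * side j ^ 2 * side j ^ n
        = 2 ^ n * (4 * e j m ^ 2 * side (j + 1) ^ 2 * side (j + 1) ^ n) := by rw [h1]; ring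
      _ ≤ (2 ^ n) ^ 2 * (4 * e j m ^ 2 * side (j + 1) ^ 2 * side (j + 1) ^ n) := by gcongr
      _ = (2 ^ (n + 1) * e j m) ^ 2 * side (j + 1) ^ 2 * side (j + 1) ^ n := by ring

/-- A map fitting the measure near a dense window is close to the maps of the tree cubes next to
the parent. -/
lemma compare_parent [IsFiniteMeasure μ] (D : Setup S μ e C₀ δ τ ε₀ M) {j : ℕ}
    {k m : Fin n → ℤ} (hk : InTree S μ e δ τ ε₀ j (par k)) (hm : InTree S μ e δ τ ε₀ j m)
    (hkm : ∀ i, |par k i - m i| ≤ 8)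
    (hdens : ENNReal.ofReal (δ * side (j + 1) ^ n) ≤ μ (pwin S μ e δ τ ε₀ j k))
    {b : (Fin n → ℝ) →ᵃ[ℝ] W}
    (hb : ∀ x ∈ pwin S μ e δ τ ε₀ j k, ∫⁻ w in closedBall x (20 * n * side (j + 1)),
      ENNReal.ofReal (‖S.q w - b (S.p w)‖ ^ 2) ∂μ ≤
        ENNReal.ofReal (e (j + 1) k ^ 2 * side (j + 1) ^ 2 * side (j + 1) ^ n)) :
    SlopeLE (b - amap S μ e δ τ ε₀ j m)
        (cmpConst n M δ * (e (j + 1) k + 2 ^ (n + 1) * e j m)) ∧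
      ∀ y, NearCube (j + 1) k 20 y → ‖b y - amap S μ e δ τ ε₀ j m y‖ ≤
        cmpConst n M δ * (e (j + 1) k + 2 ^ (n + 1) * e j m) * side (j + 1) := by
  have he := D.e_nonneg j m
  refine compare_affine D.one_le S D.C₀_nonneg D.growth (slopeLE_amap j (par k)) D.M_pos
    (D.radius_le (j + 1)) D.δ_pos D.δ_le D.slab_half hdens (D.e_nonneg _ _)
    (by positivity) ?_ (D.lintegral_pwin_le hk hm hkm)
  rcases Set.eq_empty_or_nonempty (pwin S μ e δ τ ε₀ j k) with h0 | ⟨x', hx'⟩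
  · rw [show win S (amap S μ e δ τ ε₀ j (par k)) (2 * τ * side (j + 1)) (j + 1) k = ∅ from h0]
    simp
  · refine le_trans (lintegral_mono_set fun x hx => ?_) (hb x' hx')
    rw [mem_closedBall, dist_eq_norm]
    refine (norm_sub_le_of_gap S (slopeLE_amap j (par k)) hx.2 hx'.2).trans ?_
    have h1 : idx (j + 1) (S.p x) = k := hx.1
    have h2 : idx (j + 1) (S.p x') = k := hx'.1
    have h4 := norm_sub_le_of_idx_near (d := 0) (j := j + 1) (y := S.p x) (z := S.p x')
      (by rw [h1, h2]; simp)
    have hn := D.one_le_real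
    have hs := side_pos (j + 1)
    have hτ := D.τ_le_eighth
    push_cast at h4
    calc 2 * n * ‖S.p x - S.p x'‖ + 2 * τ * side (j + 1) + 2 * τ * side (j + 1) ≤
          2 * n * ((0 + 1) * side (j + 1)) + 1 / 4 * side (j + 1) + 1 / 4 * side (j + 1) := by
          gcongr
      _ ≤ 20 * n * side (j + 1) := by nlinarith

end Setup

end Compat

section Hull

variable {N n : ℕ} {W : Type*} [NormedAddCommGroup W] [InnerProductSpace ℝ W]

/-- The tree cubes of generation `j`. -/
def treeCubes (S : Splitting N n W) (μ : Measure (EuclideanSpace ℝ (Fin N)))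
    (e : ℕ → (Fin n → ℤ) → ℝ) (δ τ ε₀ : ℝ) (j : ℕ) : Finset (Fin n → ℤ) :=
  (finite_inTree (S := S) (μ := μ) (e := e) (δ := δ) (τ := τ) (ε₀ := ε₀) j).toFinset

/-- The cubes adjacent to `k`. -/
def adjacent (k : Fin n → ℤ) : Finset (Fin n → ℤ) :=
  Fintype.piFinset fun i => Finset.Icc (k i - 1) (k i + 1)

open scoped Classical in
/-- The tree cubes of generation `j` and their neighbours. -/
def hull (S : Splitting N n W) (μ : Measure (EuclideanSpace ℝ (Fin N)))
    (e : ℕ → (Fin n → ℤ) → ℝ) (δ τ ε₀ : ℝ) (j : ℕ) : Finset (Fin n → ℤ) :=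
  (treeCubes S μ e δ τ ε₀ j).biUnion adjacent

open scoped Classical in
/-- A tree cube of generation `j` next to the cube `k`. -/
def nbr (S : Splitting N n W) (μ : Measure (EuclideanSpace ℝ (Fin N)))
    (e : ℕ → (Fin n → ℤ) → ℝ) (δ τ ε₀ : ℝ) (j : ℕ) (k : Fin n → ℤ) : Fin n → ℤ :=
  if h : ∃ c, InTree S μ e δ τ ε₀ j c ∧ ∀ i, |k i - c i| ≤ 1 then h.choose else 0

open scoped Classical in
/-- The tree cubes of generation `j` that lie near the cube `m`. -/
def treeNear (S : Splitting N n W) (μ : Measure (EuclideanSpace ℝ (Fin N)))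
    (e : ℕ → (Fin n → ℤ) → ℝ) (δ τ ε₀ : ℝ) (j : ℕ) (m : Fin n → ℤ) : Finset (Fin n → ℤ) :=
  (treeCubes S μ e δ τ ε₀ j).filter fun c => ∀ i, |m i - c i| ≤ 8

/-- The map attached to a cube of the hull. -/
def hmap (S : Splitting N n W) (μ : Measure (EuclideanSpace ℝ (Fin N)))
    (e : ℕ → (Fin n → ℤ) → ℝ) (δ τ ε₀ : ℝ) (j : ℕ) (k : Fin n → ℤ) : (Fin n → ℝ) →ᵃ[ℝ] W :=
  amap S μ e δ τ ε₀ j (nbr S μ e δ τ ε₀ j k)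

/-- The error attached to a tree cube and its surroundings in the previous generation. -/
def terr (S : Splitting N n W) (μ : Measure (EuclideanSpace ℝ (Fin N)))
    (e : ℕ → (Fin n → ℤ) → ℝ) (δ τ ε₀ : ℝ) (M : ℕ) (j : ℕ) (c : Fin n → ℤ) : ℝ :=
  cmpConst n M δ * (e (j + 1) c + 2 ^ (n + 1) * ∑ m ∈ treeNear S μ e δ τ ε₀ j (par c), e j m)

/-- The error attached to a cube of the hull. -/
def herr (S : Splitting N n W) (μ : Measure (EuclideanSpace ℝ (Fin N)))
    (e : ℕ → (Fin n → ℤ) → ℝ) (δ τ ε₀ : ℝ) (M : ℕ) : ℕ → (Fin n → ℤ) → ℝ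
  | 0, _ => 0
  | j + 1, k => terr S μ e δ τ ε₀ M j (nbr S μ e δ τ ε₀ (j + 1) k)

variable {S : Splitting N n W} {μ : Measure (EuclideanSpace ℝ (Fin N))}
  {e : ℕ → (Fin n → ℤ) → ℝ} {C₀ δ τ ε₀ : ℝ} {M : ℕ}

lemma mem_treeCubes {j : ℕ} {k : Fin n → ℤ} :
    k ∈ treeCubes S μ e δ τ ε₀ j ↔ InTree S μ e δ τ ε₀ j k := by
  simp [treeCubes]

lemma mem_adjacent {k c : Fin n → ℤ} : k ∈ adjacent c ↔ ∀ i, |k i - c i| ≤ 1 := by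
  simp only [adjacent, Fintype.mem_piFinset, Finset.mem_Icc, abs_le]
  exact forall_congr' fun i => by omega

lemma mem_hull {j : ℕ} {k : Fin n → ℤ} : k ∈ hull S μ e δ τ ε₀ j ↔
    ∃ c, InTree S μ e δ τ ε₀ j c ∧ ∀ i, |k i - c i| ≤ 1 := by
  simp [hull, mem_treeCubes, mem_adjacent]

lemma mem_treeNear {j : ℕ} {m c : Fin n → ℤ} : c ∈ treeNear S μ e δ τ ε₀ j m ↔
    InTree S μ e δ τ ε₀ j c ∧ ∀ i, |m i - c i| ≤ 8 := by
  simp [treeNear, mem_treeCubes]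

lemma nbr_spec {j : ℕ} {k : Fin n → ℤ} (hk : k ∈ hull S μ e δ τ ε₀ j) :
    InTree S μ e δ τ ε₀ j (nbr S μ e δ τ ε₀ j k) ∧
      ∀ i, |k i - nbr S μ e δ τ ε₀ j k i| ≤ 1 := by
  have h := mem_hull.1 hk
  rw [nbr, dif_pos h]
  exact h.choose_spec

lemma card_le_of_abs_sub_le (T : Finset (Fin n → ℤ)) (m : Fin n → ℤ) (d : ℕ)
    (h : ∀ k ∈ T, ∀ i, |m i - k i| ≤ d) : T.card ≤ (2 * d + 1) ^ n := by
  refine card_nearCube_le 0 (fun i => (m i : ℝ)) T d fun k hk i => ?_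
  have := h k hk i
  change |(2 : ℝ) ^ 0 * (m i : ℝ) - k i| ≤ d
  rw [pow_zero, one_mul]
  exact_mod_cast this

lemma card_treeNear_le (j : ℕ) (m : Fin n → ℤ) : (treeNear S μ e δ τ ε₀ j m).card ≤ 17 ^ n :=
  card_le_of_abs_sub_le _ m 8 fun _ hk i => (mem_treeNear.1 hk).2 i

lemma abs_two_pow_sub_par_le {j : ℕ} {k : Fin n → ℤ} {y : Fin n → ℝ} {lo hi : ℝ}
    (h : InBox (j + 1) k lo hi y) : InBox j (par k) (lo / 2) ((hi + 1) / 2) y := by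
  intro i
  obtain ⟨h1, h2⟩ := h i
  rw [pow_succ] at h1 h2
  have a1 : 2 * (par k i) ≤ k i := by simp only [par]; omega
  have a2 : k i ≤ 2 * (par k i) + 1 := by simp only [par]; omega
  have b1 : (2 : ℝ) * (par k i) ≤ k i := by exact_mod_cast a1
  have b2 : (k i : ℝ) ≤ 2 * (par k i) + 1 := by exact_mod_cast a2
  constructor <;> linarith

lemma InBox.of_adjacent {j : ℕ} {k c : Fin n → ℤ} {y : Fin n → ℝ} {lo hi : ℝ}
    (h : InBox j k lo hi y) (hkc : ∀ i, |k i - c i| ≤ 1) : InBox j c (lo - 1) (hi + 1) y := by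
  intro i
  obtain ⟨h1, h2⟩ := h i
  have h3 : |(k i : ℝ) - c i| ≤ 1 := by exact_mod_cast hkc i
  rw [abs_le] at h3
  constructor <;> linarith

lemma NearCube.inBox {j : ℕ} {k : Fin n → ℤ} {y : Fin n → ℝ} {c : ℝ} (h : NearCube j k c y) :
    InBox j k (-c) c y :=
  fun i => abs_le.1 (h i)

namespace Setup

lemma terr_nonneg (D : Setup S μ e C₀ δ τ ε₀ M) (j : ℕ) (c : Fin n → ℤ) :
    0 ≤ terr S μ e δ τ ε₀ M j c :=
  mul_nonneg D.cmpConst_pos.le (add_nonneg (D.e_nonneg _ _)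
    (mul_nonneg (by positivity) (Finset.sum_nonneg fun _ _ => D.e_nonneg _ _)))

lemma terr_le (D : Setup S μ e C₀ δ τ ε₀ M) {j : ℕ} {c : Fin n → ℤ}
    (hc : InTree S μ e δ τ ε₀ (j + 1) c) :
    terr S μ e δ τ ε₀ M j c ≤ cmpConst n M δ * (1 + 2 ^ (n + 1) * 17 ^ n) * ε₀ := by
  have h1 : ∑ m ∈ treeNear S μ e δ τ ε₀ j (par c), e j m ≤ 17 ^ n * ε₀ := by
    refine (Finset.sum_le_card_nsmul _ _ ε₀ fun m hm => D.e_le (mem_treeNear.1 hm).1).trans ?_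
    rw [nsmul_eq_mul]
    refine mul_le_mul_of_nonneg_right ?_ D.ε₀_nonneg
    exact_mod_cast card_treeNear_le j (par c)
  rw [terr, mul_assoc]
  refine mul_le_mul_of_nonneg_left ?_ D.cmpConst_pos.le
  have h2 := D.e_le hc
  have h3 := mul_le_mul_of_nonneg_left h1 (by positivity : (0 : ℝ) ≤ 2 ^ (n + 1))
  linarith

lemma herr_le (D : Setup S μ e C₀ δ τ ε₀ M) (j : ℕ) (k : Fin n → ℤ)
    (hk : k ∈ hull S μ e δ τ ε₀ j) :
    herr S μ e δ τ ε₀ M j k ≤ cmpConst n M δ * (1 + 2 ^ (n + 1) * 17 ^ n) * ε₀ := by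
  cases j with
  | zero =>
    have := D.cmpConst_pos
    have := D.ε₀_nonneg
    rw [herr]; positivity
  | succ j => exact D.terr_le (nbr_spec hk).1

lemma mem_hull_of_inBox {j : ℕ} {c k : Fin n → ℤ}
    (hc : InTree S μ e δ τ ε₀ j c) {y : Fin n → ℝ} (hy : InBox j c (-(3 / 4)) (7 / 4) y)
    (hk : cbump j k y ≠ 0) : k ∈ hull S μ e δ τ ε₀ j := by
  refine mem_hull.2 ⟨c, hc, fun i => ?_⟩
  obtain ⟨h1, h2⟩ := mem_of_cbump_ne_zero hk i
  obtain ⟨h3, h4⟩ := hy i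
  have a1 : ((k i - c i : ℤ) : ℝ) < (2 : ℤ) := by push_cast; linarith
  have a2 : ((-2 : ℤ) : ℝ) < (k i - c i : ℤ) := by push_cast; linarith
  have b1 := Int.cast_lt.1 a1
  have b2 := Int.cast_lt.1 a2
  rw [abs_le]
  omega

lemma abs_sub_nbr_le {j : ℕ} {c k : Fin n → ℤ} {y : Fin n → ℝ}
    (hk : k ∈ hull S μ e δ τ ε₀ j) (hc : NearCube j c 2 y) (hy : NearCube j k 2 y) (i : Fin n) :
    |c i - nbr S μ e δ τ ε₀ j k i| ≤ 8 := by
  have h1 := abs_le.1 (hc i)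
  have h2 := abs_le.1 (hy i)
  have h3 := abs_le.1 ((nbr_spec hk).2 i)
  have a1 : ((c i - k i : ℤ) : ℝ) ≤ (4 : ℤ) := by push_cast; linarith
  have a2 : ((-4 : ℤ) : ℝ) ≤ (c i - k i : ℤ) := by push_cast; linarith
  have b1 := Int.cast_le.1 a1
  have b2 := Int.cast_le.1 a2
  rw [abs_le]
  omega

lemma compatible [IsFiniteMeasure μ] (D : Setup S μ e C₀ δ τ ε₀ M) :
    Compatible (hull S μ e δ τ ε₀) (hmap S μ e δ τ ε₀) (herr S μ e δ τ ε₀ M) where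
  zero k := rfl
  nonneg j k := by
    cases j with
    | zero => exact le_rfl
    | succ j => exact D.terr_nonneg j _
  active j k hk y hy k' hk' := by
    obtain ⟨hc, hkc⟩ := nbr_spec hk
    refine mem_hull_of_inBox hc.1 ?_ hk'
    exact (abs_two_pow_sub_par_le (hy.of_adjacent hkc)).mono (by norm_num) (by norm_num)
  close j k hk k' hk' y hy hy' := by
    obtain ⟨hc, hkc⟩ := nbr_spec hk
    obtain ⟨hc', -⟩ := nbr_spec hk'
    set c := nbr S μ e δ τ ε₀ (j + 1) k
    have hbox := hy.inBox.of_adjacent hkc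
    have hpar : NearCube j (par c) 2 y :=
      (abs_two_pow_sub_par_le hbox).nearCube (by norm_num) (by norm_num)
    have hnear := abs_sub_nbr_le hk' hpar hy'
    have hcmp := D.compare_parent hc.1 hc' hnear hc.good.dens hc.good.fit
    have hle : cmpConst n M δ * (e (j + 1) c + 2 ^ (n + 1) * e j (nbr S μ e δ τ ε₀ j k')) ≤
        herr S μ e δ τ ε₀ M (j + 1) k := by
      refine mul_le_mul_of_nonneg_left ?_ D.cmpConst_pos.le
      gcongr
      exact Finset.single_le_sum (f := fun m => e j m) (fun _ _ => D.e_nonneg _ _)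
        (mem_treeNear.2 ⟨hc', hnear⟩)
    refine ⟨fun i => (hcmp.1 i).trans hle, ?_⟩
    have h1 := hcmp.2 y (hbox.nearCube (by norm_num) (by norm_num))
    refine h1.trans ?_
    have h2 : side (j + 1) ≤ side j := by rw [side_succ]; linarith [side_pos j]
    have h3 : 0 ≤ herr S μ e δ τ ε₀ M (j + 1) k := D.terr_nonneg j _
    exact mul_le_mul hle h2 (side_pos _).le h3

end Setup

end Hull

section Counting

variable {N n : ℕ} {W : Type*} [NormedAddCommGroup W] [InnerProductSpace ℝ W]
  {S : Splitting N n W} {μ : Measure (EuclideanSpace ℝ (Fin N))}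
  {e : ℕ → (Fin n → ℤ) → ℝ} {δ τ ε₀ : ℝ} {M : ℕ}

/-- The constant in the summation of the errors over the hull. -/
def herrConst (n M : ℕ) (δ : ℝ) : ℝ :=
  2 * cmpConst n M δ ^ 2 * 3 ^ n * (1 + 4 ^ (n + 1) * 17 ^ n * 35 ^ n)

lemma sum_hull_le {F : (Fin n → ℤ) → ℝ} (hF : ∀ c, 0 ≤ F c) (j : ℕ) :
    ∑ k ∈ hull S μ e δ τ ε₀ j, F (nbr S μ e δ τ ε₀ j k) ≤
      3 ^ n * ∑ c ∈ treeCubes S μ e δ τ ε₀ j, F c := by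
  classical
  rw [← Finset.sum_fiberwise_of_maps_to (s := hull S μ e δ τ ε₀ j)
    (t := treeCubes S μ e δ τ ε₀ j) (g := nbr S μ e δ τ ε₀ j)
    (fun k hk => mem_treeCubes.2 (nbr_spec hk).1), Finset.mul_sum]
  refine Finset.sum_le_sum fun c _ => ?_
  have h1 : ∀ k ∈ (hull S μ e δ τ ε₀ j).filter fun k => nbr S μ e δ τ ε₀ j k = c,
      F (nbr S μ e δ τ ε₀ j k) ≤ F c := fun k hk => by
    rw [(Finset.mem_filter.1 hk).2]
  refine (Finset.sum_le_card_nsmul _ _ _ h1).trans ?_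
  rw [nsmul_eq_mul]
  refine mul_le_mul_of_nonneg_right ?_ (hF c)
  have h2 := card_le_of_abs_sub_le
    ((hull S μ e δ τ ε₀ j).filter fun k => nbr S μ e δ τ ε₀ j k = c) c 1 fun k hk i => by
      obtain ⟨h3, rfl⟩ := Finset.mem_filter.1 hk
      rw [abs_sub_comm]
      exact_mod_cast (nbr_spec h3).2 i
  exact_mod_cast h2

lemma sum_treeNear_le {F : (Fin n → ℤ) → ℝ} (hF : ∀ c, 0 ≤ F c) (j : ℕ) :
    ∑ c ∈ treeCubes S μ e δ τ ε₀ (j + 1), ∑ m ∈ treeNear S μ e δ τ ε₀ j (par c), F m ≤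
      35 ^ n * ∑ m ∈ treeCubes S μ e δ τ ε₀ j, F m := by
  classical
  rw [Finset.sum_comm' (t' := treeCubes S μ e δ τ ε₀ j)
    (s' := fun m => (treeCubes S μ e δ τ ε₀ (j + 1)).filter fun c => ∀ i, |par c i - m i| ≤ 8)
    (fun c m => by rw [Finset.mem_filter, mem_treeNear, mem_treeCubes, mem_treeCubes]; tauto),
    Finset.mul_sum]
  refine Finset.sum_le_sum fun m _ => ?_
  rw [Finset.sum_const, nsmul_eq_mul]
  refine mul_le_mul_of_nonneg_right ?_ (hF m)
  have h2 := card_le_of_abs_sub_le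
    ((treeCubes S μ e δ τ ε₀ (j + 1)).filter fun c => ∀ i, |par c i - m i| ≤ 8)
    (fun i => 2 * m i) 17 fun k hk i => by
      have h3 := abs_le.1 ((Finset.mem_filter.1 hk).2 i)
      simp only [par] at h3
      rw [abs_le]
      push_cast
      constructor <;> omega
  exact_mod_cast h2

lemma sum_scales_le {Θ : ℝ} (hΘ : ∀ T : Finset (ℕ × (Fin n → ℤ)),
      ∑ t ∈ T, e t.1 t.2 ^ 2 * side t.1 ^ n ≤ Θ) (A : Finset ℕ) (B : ℕ → Finset (Fin n → ℤ)) :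
    ∑ j ∈ A, ∑ k ∈ B j, e j k ^ 2 * side j ^ n ≤ Θ := by
  rw [Finset.sum_sigma']
  have h := hΘ ((A.sigma B).map (Equiv.sigmaEquivProd ℕ (Fin n → ℤ)).toEmbedding)
  rw [Finset.sum_map] at h
  exact h

lemma terr_sq_le (j : ℕ) (c : Fin n → ℤ) :
    terr S μ e δ τ ε₀ M j c ^ 2 ≤ 2 * cmpConst n M δ ^ 2 * (e (j + 1) c ^ 2 +
      4 ^ (n + 1) * 17 ^ n * ∑ m ∈ treeNear S μ e δ τ ε₀ j (par c), e j m ^ 2) := by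
  have h1 : (∑ m ∈ treeNear S μ e δ τ ε₀ j (par c), e j m) ^ 2 ≤
      17 ^ n * ∑ m ∈ treeNear S μ e δ τ ε₀ j (par c), e j m ^ 2 := by
    refine sq_sum_le_card_mul_sum_sq.trans ?_
    refine mul_le_mul_of_nonneg_right ?_ (Finset.sum_nonneg fun _ _ => sq_nonneg _)
    exact_mod_cast card_treeNear_le j (par c)
  have h4 : (4 : ℝ) ^ (n + 1) = (2 ^ (n + 1)) ^ 2 := by
    rw [← pow_mul, mul_comm, pow_mul]; norm_num
  rw [terr, mul_pow]
  set s := ∑ m ∈ treeNear S μ e δ τ ε₀ j (par c), e j m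
  set q := ∑ m ∈ treeNear S μ e δ τ ε₀ j (par c), e j m ^ 2
  have h5 : (e (j + 1) c + 2 ^ (n + 1) * s) ^ 2 ≤
      2 * (e (j + 1) c ^ 2 + 4 ^ (n + 1) * s ^ 2) := by
    rw [h4]; nlinarith [sq_nonneg (e (j + 1) c - 2 ^ (n + 1) * s)]
  calc cmpConst n M δ ^ 2 * (e (j + 1) c + 2 ^ (n + 1) * s) ^ 2
      ≤ cmpConst n M δ ^ 2 * (2 * (e (j + 1) c ^ 2 + 4 ^ (n + 1) * (17 ^ n * q))) := by
        gcongr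
        refine h5.trans ?_
        gcongr
    _ = _ := by ring

lemma sum_herr_le {Θ : ℝ}
    (hΘ : ∀ T : Finset (ℕ × (Fin n → ℤ)), ∑ t ∈ T, e t.1 t.2 ^ 2 * side t.1 ^ n ≤ Θ) (J : ℕ) :
    ∑ j ∈ Finset.range J, ∑ k ∈ hull S μ e δ τ ε₀ (j + 1),
      herr S μ e δ τ ε₀ M (j + 1) k ^ 2 * side (j + 1) ^ n ≤ herrConst n M δ * Θ := by
  have hstep : ∀ j, ∑ k ∈ hull S μ e δ τ ε₀ (j + 1),
      herr S μ e δ τ ε₀ M (j + 1) k ^ 2 * side (j + 1) ^ n ≤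
      2 * cmpConst n M δ ^ 2 * 3 ^ n *
        (∑ c ∈ treeCubes S μ e δ τ ε₀ (j + 1), e (j + 1) c ^ 2 * side (j + 1) ^ n +
          4 ^ (n + 1) * 17 ^ n * 35 ^ n *
            ∑ m ∈ treeCubes S μ e δ τ ε₀ j, e j m ^ 2 * side j ^ n) := by
    intro j
    have hs := side_pos (j + 1)
    have hs' : side (j + 1) ^ n ≤ side j ^ n := by
      refine pow_le_pow_left₀ hs.le ?_ n
      rw [side_succ]; linarith [side_pos j]
    calc _ ≤ 3 ^ n * ∑ c ∈ treeCubes S μ e δ τ ε₀ (j + 1),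
          terr S μ e δ τ ε₀ M j c ^ 2 * side (j + 1) ^ n :=
        sum_hull_le (F := fun c => terr S μ e δ τ ε₀ M j c ^ 2 * side (j + 1) ^ n)
          (fun c => by positivity) (j + 1)
      _ ≤ 3 ^ n * ∑ c ∈ treeCubes S μ e δ τ ε₀ (j + 1), (2 * cmpConst n M δ ^ 2 *
          (e (j + 1) c ^ 2 + 4 ^ (n + 1) * 17 ^ n *
            ∑ m ∈ treeNear S μ e δ τ ε₀ j (par c), e j m ^ 2)) * side (j + 1) ^ n := by
        gcongr with c
        exact terr_sq_le j c
      _ = 2 * cmpConst n M δ ^ 2 * 3 ^ n *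
          (∑ c ∈ treeCubes S μ e δ τ ε₀ (j + 1), e (j + 1) c ^ 2 * side (j + 1) ^ n +
          4 ^ (n + 1) * 17 ^ n * (∑ c ∈ treeCubes S μ e δ τ ε₀ (j + 1),
            ∑ m ∈ treeNear S μ e δ τ ε₀ j (par c), e j m ^ 2) * side (j + 1) ^ n) := by
        simp only [Finset.mul_sum, Finset.sum_mul, ← Finset.sum_add_distrib, mul_add, add_mul]
        refine Finset.sum_congr rfl fun c _ => ?_
        congr 1
        · ring
        · exact Finset.sum_congr rfl fun m _ => by ring
      _ ≤ _ := by
        refine mul_le_mul_of_nonneg_left (add_le_add le_rfl ?_) (by positivity)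
        rw [← Finset.sum_mul, mul_assoc, mul_assoc _ (35 ^ n : ℝ)]
        refine mul_le_mul_of_nonneg_left ?_ (by positivity)
        refine (mul_le_mul (sum_treeNear_le (fun c => sq_nonneg (e j c)) j) hs' (by positivity)
          (mul_nonneg (by positivity) (Finset.sum_nonneg fun _ _ => sq_nonneg _))).trans_eq ?_
        ring
  refine (Finset.sum_le_sum fun j _ => hstep j).trans ?_
  rw [← Finset.mul_sum, Finset.sum_add_distrib, ← Finset.mul_sum, herrConst, mul_assoc _ _ Θ]
  have h1 := sum_scales_le hΘ (Finset.range J) (treeCubes S μ e δ τ ε₀)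
  have h2 : ∑ j ∈ Finset.range J, ∑ c ∈ treeCubes S μ e δ τ ε₀ (j + 1),
      e (j + 1) c ^ 2 * side (j + 1) ^ n ≤ Θ := by
    have := sum_scales_le hΘ ((Finset.range J).map (addRightEmbedding 1))
      (treeCubes S μ e δ τ ε₀)
    rw [Finset.sum_map] at this
    exact this
  refine mul_le_mul_of_nonneg_left ?_ (by positivity)
  rw [add_mul, one_mul]
  exact add_le_add h2 (mul_le_mul_of_nonneg_left h1 (by positivity))

end Counting

section Steep

variable {N n : ℕ} {W : Type*} [NormedAddCommGroup W] [InnerProductSpace ℝ W]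

/-- The maximal cubes outside the tree; `s = (j, k)` stands for the cube `k` of generation
`j + 1`. -/
def Stopped (S : Splitting N n W) (μ : Measure (EuclideanSpace ℝ (Fin N)))
    (e : ℕ → (Fin n → ℤ) → ℝ) (δ τ ε₀ : ℝ) (s : ℕ × (Fin n → ℤ)) : Prop :=
  InTree S μ e δ τ ε₀ s.1 (par s.2) ∧ ¬ InTree S μ e δ τ ε₀ (s.1 + 1) s.2

variable {S : Splitting N n W} {μ : Measure (EuclideanSpace ℝ (Fin N))}
  {e : ℕ → (Fin n → ℤ) → ℝ} {C₀ δ τ ε₀ : ℝ} {M : ℕ}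

lemma Stopped.eq {s t : ℕ × (Fin n → ℤ)} (hs : Stopped S μ e δ τ ε₀ s)
    (ht : Stopped S μ e δ τ ε₀ t) {y : Fin n → ℝ} (hsy : idx (s.1 + 1) y = s.2)
    (hty : idx (t.1 + 1) y = t.2) : s = t := by
  wlog hst : s.1 ≤ t.1 generalizing s t
  · exact (this ht hs hty hsy (by omega)).symm
  rcases hst.eq_or_lt with h | h
  · exact Prod.ext h (by rw [← hsy, ← hty, h])
  · exfalso
    apply hs.2
    rw [← hsy]
    refine InTree.mono (j := t.1) h ?_
    rw [← par_idx, hty]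
    exact ht.1

lemma InBox.idx_eq {j : ℕ} {k : Fin n → ℤ} {lo hi : ℝ} {y : Fin n → ℝ} (h : InBox j k lo hi y)
    (h0 : 0 ≤ lo) (h1 : hi < 1) : idx j y = k := by
  funext i
  obtain ⟨h2, h3⟩ := h i
  rw [idx, Int.floor_eq_iff]
  constructor <;> linarith

lemma Stopped.cbump_eq_zero {s : ℕ × (Fin n → ℤ)} (hs : Stopped S μ e δ τ ε₀ s) {y : Fin n → ℝ}
    (hy : InBox (s.1 + 1) s.2 (3 / 16) (13 / 16) y) {m : ℕ} (hm : s.1 + 4 ≤ m) {k : Fin n → ℤ}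
    (hk : k ∈ hull S μ e δ τ ε₀ (m + 1)) : cbump (m + 1) k y = 0 := by
  by_contra hne
  obtain ⟨hc, hkc⟩ := nbr_spec hk
  set c := nbr S μ e δ τ ε₀ (m + 1) k
  have hbox := (inBox_of_cbump hne).of_adjacent hkc
  obtain ⟨d, rfl⟩ := Nat.exists_eq_add_of_le hm
  let z : Fin n → ℝ := fun i => side (s.1 + 4 + d + 1) * c i
  have hz : ∀ i, (2 : ℝ) ^ (s.1 + 4 + d + 1) * z i = c i := fun i => by
    rw [← mul_assoc, two_pow_mul_side, one_mul]
  have hzc : idx (s.1 + 4 + d + 1) z = c := by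
    funext i
    rw [idx, hz, Int.floor_intCast]
  have hzs : InBox (s.1 + 1) s.2 (3 / 64) (61 / 64) z := by
    intro i
    obtain ⟨h1, h2⟩ := hbox i
    obtain ⟨h3, h4⟩ := hy i
    rw [← hz i, ← mul_sub, show s.1 + 4 + d + 1 = s.1 + 1 + (4 + d) by ring, pow_add,
      mul_comm ((2 : ℝ) ^ (s.1 + 1)), mul_assoc] at h1 h2
    have hd : (16 : ℝ) ≤ 2 ^ (4 + d) := by
      rw [pow_add]
      have : (1 : ℝ) ≤ 2 ^ d := one_le_pow₀ (by norm_num)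
      linarith
    set t := (2 : ℝ) ^ (s.1 + 1) * (y i - z i) with ht
    have h5 : -(9 / 64) ≤ t ∧ t ≤ 9 / 64 := by
      constructor <;> by_contra hcon <;> push Not at hcon <;> nlinarith
    have h6 : (2 : ℝ) ^ (s.1 + 1) * z i = 2 ^ (s.1 + 1) * y i - t := by rw [ht]; ring
    rw [h6]
    constructor <;> linarith [h5.1, h5.2]
  apply hs.2
  rw [← hzs.idx_eq (by norm_num) (by norm_num)]
  refine InTree.mono (j := s.1 + 4 + d + 1) (by omega) ?_
  rw [hzc]
  exact hc

namespace Setup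

/-- A dense stopped cube with small error stops because its map is steep. -/
lemma exists_steep [IsFiniteMeasure μ] (D : Setup S μ e C₀ δ τ ε₀ M) {s : ℕ × (Fin n → ℤ)}
    (hs : Stopped S μ e δ τ ε₀ s)
    (hdens : ENNReal.ofReal (δ * side (s.1 + 1) ^ n) ≤ μ (pwin S μ e δ τ ε₀ s.1 s.2))
    (he : e (s.1 + 1) s.2 ≤ ε₀) :
    ∃ i, 1 / 2 ≤ ‖(amap S μ e δ τ ε₀ s.1 (par s.2)).linear (Pi.single i 1)‖ := by
  obtain ⟨b, hb, hnear⟩ := D.exists_fit s.1 s.2 _ (slopeLE_amap s.1 (par s.2)) hdens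
  have hslope : ¬ SlopeLE b 1 := fun h => hs.2 ⟨hs.1, b, hdens, he, hb, h, hnear⟩
  simp only [SlopeLE, not_forall, not_le] at hslope
  obtain ⟨i, hi⟩ := hslope
  have hcmp := (D.compare_parent hs.1 hs.1 (fun i => by simp) hdens hb).1 i
  have hsmall : cmpConst n M δ * (e (s.1 + 1) s.2 + 2 ^ (n + 1) * e s.1 (par s.2)) ≤ 1 / 16 := by
    refine le_trans ?_ D.small
    rw [mul_assoc]
    refine mul_le_mul_of_nonneg_left ?_ D.cmpConst_pos.le
    have h1 := D.e_le hs.1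
    have h2 := D.ε₀_nonneg
    have h3 : (1 : ℝ) ≤ 17 ^ n := one_le_pow₀ (by norm_num)
    calc e (s.1 + 1) s.2 + 2 ^ (n + 1) * e s.1 (par s.2) ≤ ε₀ + 2 ^ (n + 1) * 1 * ε₀ := by
          rw [mul_one]; gcongr
      _ ≤ ε₀ + 2 ^ (n + 1) * 17 ^ n * ε₀ := by gcongr
      _ = (1 + 2 ^ (n + 1) * 17 ^ n) * ε₀ := by ring
  refine ⟨i, ?_⟩
  rw [AffineMap.sub_linear, LinearMap.sub_apply] at hcmp
  have h4 := norm_sub_norm_le (b.linear (Pi.single i 1))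
    ((amap S μ e δ τ ε₀ s.1 (par s.2)).linear (Pi.single i 1))
  linarith

/-- The total volume of stopped cubes that are steep in direction `i` is controlled by the
errors. -/
lemma sum_stopped_le [IsFiniteMeasure μ] (D : Setup S μ e C₀ δ τ ε₀ M) {L : ℝ} (hL : 1 ≤ L)
    (h1 : ∀ t h, |bump (t + h) - bump t| ≤ L * |h|)
    (h2 : ∀ t h, |bump (t + h) - 2 * bump t + bump (t - h)| ≤ L * h ^ 2)
    (hsmall : 5 * 5 ^ n * incrConst n L * (cmpConst n M δ * (1 + 2 ^ (n + 1) * 17 ^ n) * ε₀) ≤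
      1 / 4) {Θ : ℝ}
    (hΘ : ∀ T : Finset (ℕ × (Fin n → ℤ)), ∑ t ∈ T, e t.1 t.2 ^ 2 * side t.1 ^ n ≤ Θ)
    (i : Fin n) (T : Finset (ℕ × (Fin n → ℤ))) (hT : ∀ s ∈ T, Stopped S μ e δ τ ε₀ s ∧
      1 / 2 ≤ ‖(amap S μ e δ τ ε₀ s.1 (par s.2)).linear (Pi.single i 1)‖) :
    ∑ s ∈ T, side (s.1 + 1) ^ n ≤
      48 * incrConst n L ^ 2 * 40 ^ n * (herrConst n M δ * Θ) := by
  have hε := D.ε₀_nonneg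
  have hκ := D.cmpConst_pos
  refine (sum_steep_le hL h1 h2 D.compatible (e := cmpConst n M δ * (1 + 2 ^ (n + 1) * 17 ^ n) * ε₀)
    (by positivity) D.herr_le hsmall (J := T.sup fun s => s.1 + 1) i T
    (fun s hs => Finset.le_sup (f := fun s : ℕ × (Fin n → ℤ) => s.1 + 1) hs) ?_ ?_).trans ?_
  · intro s hs
    obtain ⟨hst, hi⟩ := hT s hs
    refine ⟨amap S μ e δ τ ε₀ s.1 (par s.2), hi, fun y hy => ?_⟩
    have hpar := abs_two_pow_sub_par_le hy
    refine ⟨fun k hk => mem_hull_of_inBox hst.1 (hpar.mono (by norm_num) (by norm_num)) hk,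
      fun k hk hky => ?_, fun m hm k hk => hst.cbump_eq_zero hy hm hk⟩
    have hnear : NearCube s.1 (par s.2) 2 y := hpar.nearCube (by norm_num) (by norm_num)
    obtain ⟨hc, -⟩ := nbr_spec hk
    have hcmp := D.compare_same hst.1 hc (abs_sub_nbr_le hk hnear hky)
    have hle : cmpConst n M δ * (e s.1 (par s.2) + e s.1 (nbr S μ e δ τ ε₀ s.1 k)) ≤
        cmpConst n M δ * (1 + 2 ^ (n + 1) * 17 ^ n) * ε₀ := by
      rw [mul_assoc]
      refine mul_le_mul_of_nonneg_left ?_ hκ.le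
      have h3 : (1 : ℝ) ≤ 2 ^ (n + 1) * 17 ^ n :=
        one_le_mul_of_one_le_of_one_le (one_le_pow₀ (by norm_num)) (one_le_pow₀ (by norm_num))
      nlinarith [D.e_le hst.1, D.e_le hc]
    refine ⟨fun i => (hcmp.1 i).trans hle, ?_⟩
    refine (hcmp.2 y fun i => (hnear i).trans (by norm_num)).trans ?_
    exact mul_le_mul_of_nonneg_right hle (side_pos _).le
  · intro s hs t ht y hsy hty
    exact (hT s hs).1.eq (hT t ht).1 (hsy.idx_eq (by norm_num) (by norm_num))
      (hty.idx_eq (by norm_num) (by norm_num))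
  · have := (lt_of_lt_of_le one_pos hL).le
    refine mul_le_mul_of_nonneg_left (sum_herr_le hΘ _) (by positivity)

end Setup

end Steep

lemma measure_biUnion_le_ofReal {ι α : Type*} [Countable ι] [MeasurableSpace α] {μ : Measure α}
    {I : Set ι} {A : ι → Set α} {f : ι → ℝ} {C : ℝ} (hf0 : ∀ i, 0 ≤ f i)
    (hf : ∀ i ∈ I, μ (A i) ≤ ENNReal.ofReal (f i))
    (h : ∀ T : Finset ι, (∀ i ∈ T, i ∈ I) → ∑ i ∈ T, f i ≤ C) :
    μ (⋃ i ∈ I, A i) ≤ ENNReal.ofReal C := by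
  refine (measure_biUnion_le μ I.to_countable A).trans ?_
  rw [ENNReal.tsum_eq_iSup_sum]
  refine iSup_le fun T => ?_
  calc ∑ i ∈ T, μ (A i) ≤ ∑ i ∈ T, ENNReal.ofReal (f i) :=
        Finset.sum_le_sum fun i _ => hf i i.2
    _ = ENNReal.ofReal (∑ i ∈ T, f i) :=
      (ENNReal.ofReal_sum_of_nonneg fun (i : I) _ => hf0 i).symm
    _ ≤ ENNReal.ofReal C := by
      refine ENNReal.ofReal_le_ofReal ?_
      have := h (T.map (Function.Embedding.subtype _)) fun i hi => by
        obtain ⟨t, -, rfl⟩ := Finset.mem_map.1 hi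
        exact t.2
      rwa [Finset.sum_map] at this

lemma measure_lt_le_ofReal {α : Type*} [MeasurableSpace α] {μ : Measure α} [IsFiniteMeasure μ]
    {V : Set α} (hV : MeasurableSet V) {g : α → ℝ} (hg : Measurable g) {c A : ℝ} (hc : 0 < c)
    (hA : 0 ≤ A) (h : ∫⁻ x in V, ENNReal.ofReal (g x ^ 2) ∂μ ≤ ENNReal.ofReal A) :
    μ (V ∩ {x | c < g x}) ≤ ENNReal.ofReal (A / c ^ 2) := by
  have hU : MeasurableSet (V ∩ {x | c < g x}) := hV.inter (measurableSet_lt measurable_const hg)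
  have h1 := sq_mul_le_of_lintegral_le (m := (μ (V ∩ {x | c < g x})).toReal) inter_subset_left hU
    hc.le hA (fun x hx => le_of_lt hx.2) (by rw [ENNReal.ofReal_toReal (measure_ne_top _ _)]) h
  rw [← ENNReal.ofReal_toReal (measure_ne_top μ (V ∩ {x | c < g x}))]
  refine ENNReal.ofReal_le_ofReal ?_
  rw [le_div_iff₀ (by positivity)]
  linarith

section Loss

variable {N n : ℕ} {W : Type*} [NormedAddCommGroup W] [InnerProductSpace ℝ W]

/-- The points that stay close to the maps of the cubes containing them at all scales. -/
def goodSet (S : Splitting N n W) (μ : Measure (EuclideanSpace ℝ (Fin N)))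
    (e : ℕ → (Fin n → ℤ) → ℝ) (δ τ ε₀ : ℝ) : Set (EuclideanSpace ℝ (Fin N)) :=
  {x | ∀ j, InTree S μ e δ τ ε₀ j (idx j (S.p x)) ∧
    ‖S.q x - amap S μ e δ τ ε₀ j (idx j (S.p x)) (S.p x)‖ ≤ τ * side j}

variable {S : Splitting N n W} {μ : Measure (EuclideanSpace ℝ (Fin N))}
  {e : ℕ → (Fin n → ℤ) → ℝ} {C₀ δ τ ε₀ : ℝ} {M : ℕ}

lemma sum_side_le_of_stopped {T : Finset (ℕ × (Fin n → ℤ))}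
    (hT : ∀ s ∈ T, Stopped S μ e δ τ ε₀ s) : ∑ s ∈ T, side (s.1 + 1) ^ n ≤ 28 ^ n := by
  have hdisj : (T : Set (ℕ × (Fin n → ℤ))).PairwiseDisjoint
      fun s => {y : Fin n → ℝ | InBox (s.1 + 1) s.2 (1 / 4) (3 / 4) y} := by
    intro s hs t ht hst
    refine Set.disjoint_left.2 fun y hy hy' => hst ?_
    have h1 : InBox (s.1 + 1) s.2 (1 / 4) (3 / 4) y := hy
    have h2 : InBox (t.1 + 1) t.2 (1 / 4) (3 / 4) y := hy'
    exact (hT s hs).eq (hT t ht) (h1.idx_eq (by norm_num) (by norm_num))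
      (h2.idx_eq (by norm_num) (by norm_num))
  have hmeas : ∀ s ∈ T, MeasurableSet
      {y : Fin n → ℝ | InBox (s.1 + 1) s.2 (1 / 4) (3 / 4) y} := fun s _ => by
    rw [setOf_inBox]
    exact MeasurableSet.univ_pi fun i => measurableSet_Icc
  have hsub : (⋃ s ∈ T, {y : Fin n → ℝ | InBox (s.1 + 1) s.2 (1 / 4) (3 / 4) y}) ⊆
      {y | InBox 0 0 (-7) 7 y} := by
    refine Set.iUnion₂_subset fun s hs y hy i => ?_
    obtain ⟨h1, h2⟩ := (hy : InBox (s.1 + 1) s.2 (1 / 4) (3 / 4) y) i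
    obtain ⟨h3, h4⟩ := (hT s hs).1.bounds i
    simp only [par] at h3 h4
    have h5 : -(7 * 2 ^ (s.1 + 1)) ≤ s.2 i := by rw [pow_succ]; omega
    have h6 : s.2 i + 1 ≤ 7 * 2 ^ (s.1 + 1) := by rw [pow_succ]; omega
    have h5' : -(7 * 2 ^ (s.1 + 1)) ≤ (s.2 i : ℝ) := by exact_mod_cast h5
    have h6' : (s.2 i : ℝ) + 1 ≤ 7 * 2 ^ (s.1 + 1) := by exact_mod_cast h6
    have hp : (0 : ℝ) < 2 ^ (s.1 + 1) := by positivity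
    simp only [pow_zero, one_mul, Pi.zero_apply, Int.cast_zero, sub_zero]
    constructor <;> by_contra hcon <;> push Not at hcon <;> nlinarith
  have h := measure_mono (μ := volume) hsub
  rw [measure_biUnion_finset hdisj hmeas, volume_inBox _ _ (by norm_num),
    Finset.sum_congr rfl fun s _ => volume_inBox _ _ (by norm_num),
    ← ENNReal.ofReal_sum_of_nonneg fun s _ => by have := side_pos (s.1 + 1); positivity,
    ENNReal.ofReal_le_ofReal_iff (by have := side_pos 0; positivity)] at h
  simp only [mul_pow] at h
  rw [← Finset.mul_sum] at h
  have h0 : side 0 = 1 := by simp [side]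
  rw [h0] at h
  have h2 : ((3 : ℝ) / 4 - 1 / 4) ^ n * 2 ^ n = 1 := by rw [← mul_pow]; norm_num
  calc ∑ s ∈ T, side (s.1 + 1) ^ n
      = 2 ^ n * (((3 : ℝ) / 4 - 1 / 4) ^ n * ∑ s ∈ T, side (s.1 + 1) ^ n) := by
        rw [← mul_assoc, mul_comm ((2 : ℝ) ^ n), h2, one_mul]
    _ ≤ 2 ^ n * ((7 - -7) ^ n * 1 ^ n) := by gcongr
    _ = 28 ^ n := by rw [one_pow, mul_one, ← mul_pow]; norm_num

/-- Where the construction loses mass. -/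
lemma subset_losses {x : EuclideanSpace ℝ (Fin N)} (hx : ‖x‖ ≤ 5)
    (hgood : x ∉ goodSet S μ e δ τ ε₀) :
    τ < ‖S.q x‖ ∨ ∃ s : ℕ × (Fin n → ℤ), x ∈ pwin S μ e δ τ ε₀ s.1 s.2 ∧
      (Stopped S μ e δ τ ε₀ s ∨ (InTree S μ e δ τ ε₀ (s.1 + 1) s.2 ∧
        τ * side (s.1 + 1) < ‖S.q x - amap S μ e δ τ ε₀ (s.1 + 1) s.2 (S.p x)‖)) := by
  classical
  by_cases h0 : τ < ‖S.q x‖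
  · exact Or.inl h0
  right
  have hex : ∃ j, ¬ (InTree S μ e δ τ ε₀ j (idx j (S.p x)) ∧
      ‖S.q x - amap S μ e δ τ ε₀ j (idx j (S.p x)) (S.p x)‖ ≤ τ * side j) := by
    simpa [goodSet] using hgood
  have hzero : InTree S μ e δ τ ε₀ 0 (idx 0 (S.p x)) ∧
      ‖S.q x - amap S μ e δ τ ε₀ 0 (idx 0 (S.p x)) (S.p x)‖ ≤ τ * side 0 := by
    constructor
    · intro i
      have h1 : |S.p x i| ≤ 5 := by
        have := (norm_le_pi_norm (S.p x) i).trans ((S.norm_p_le x).trans hx)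
        simpa using this
      rw [abs_le] at h1
      simp only [idx, pow_zero, one_mul]
      have h2 : (-5 : ℤ) ≤ ⌊S.p x i⌋ := Int.le_floor.2 (by push_cast; linarith [h1.1])
      have h3 : ⌊S.p x i⌋ < 6 := Int.floor_lt.2 (by push_cast; linarith [h1.2])
      rw [abs_le]
      omega
    · simpa [amap, side] using h0
  obtain ⟨m, hm⟩ : ∃ m, Nat.find hex = m + 1 := by
    refine Nat.exists_eq_succ_of_ne_zero fun h => ?_
    have := Nat.find_spec hex
    rw [h] at this
    exact this hzero
  have hprev := Nat.find_min hex (m := m) (by omega)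
  rw [not_not] at hprev
  have hfail := Nat.find_spec hex
  rw [hm] at hfail
  have hmem : x ∈ pwin S μ e δ τ ε₀ m (idx (m + 1) (S.p x)) := by
    refine ⟨rfl, ?_⟩
    rw [par_idx]
    refine hprev.2.trans_eq ?_
    rw [side_succ]; ring
  refine ⟨(m, idx (m + 1) (S.p x)), hmem, ?_⟩
  by_cases hT : InTree S μ e δ τ ε₀ (m + 1) (idx (m + 1) (S.p x))
  · right
    refine ⟨hT, ?_⟩
    by_contra hcon
    exact hfail ⟨hT, not_lt.1 hcon⟩
  · left
    refine ⟨?_, hT⟩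
    change InTree S μ e δ τ ε₀ m (par (idx (m + 1) (S.p x)))
    rw [par_idx]
    exact hprev.1

lemma sum_next_scale_le {Θ : ℝ} (hΘ : ∀ T : Finset (ℕ × (Fin n → ℤ)),
      ∑ t ∈ T, e t.1 t.2 ^ 2 * side t.1 ^ n ≤ Θ) (T : Finset (ℕ × (Fin n → ℤ))) :
    ∑ t ∈ T, e (t.1 + 1) t.2 ^ 2 * side (t.1 + 1) ^ n ≤ Θ := by
  have h := hΘ (T.map ((addRightEmbedding 1).prodMap (Function.Embedding.refl _)))
  rw [Finset.sum_map] at h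
  exact h

namespace Setup

lemma pwin_subset_closedBall (D : Setup S μ e C₀ δ τ ε₀ M) {j : ℕ} {k : Fin n → ℤ}
    {x : EuclideanSpace ℝ (Fin N)} (hx : x ∈ pwin S μ e δ τ ε₀ j k) :
    pwin S μ e δ τ ε₀ j k ⊆ closedBall x (3 * n * side (j + 1)) := by
  intro z hz
  rw [mem_closedBall, dist_eq_norm]
  refine (norm_sub_le_of_gap S (slopeLE_amap j (par k)) hz.2 hx.2).trans ?_
  have h1 : idx (j + 1) (S.p z) = k := hz.1
  have h2 : idx (j + 1) (S.p x) = k := hx.1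
  have h4 := norm_sub_le_of_idx_near (d := 0) (j := j + 1) (y := S.p z) (z := S.p x)
    (by rw [h1, h2]; simp)
  have hn := D.one_le_real
  have hs := side_pos (j + 1)
  have hτ := D.τ_le_eighth
  push_cast at h4
  calc 2 * n * ‖S.p z - S.p x‖ + 2 * τ * side (j + 1) + 2 * τ * side (j + 1) ≤
        2 * n * ((0 + 1) * side (j + 1)) + 1 / 4 * side (j + 1) + 1 / 4 * side (j + 1) := by
        gcongr
    _ ≤ 3 * n * side (j + 1) := by nlinarith

lemma measure_pwin_le (D : Setup S μ e C₀ δ τ ε₀ M) (j : ℕ) (k : Fin n → ℤ) :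
    μ (pwin S μ e δ τ ε₀ j k) ≤ ENNReal.ofReal (C₀ * (6 * n) ^ n * side (j + 1) ^ n) := by
  rcases Set.eq_empty_or_nonempty (pwin S μ e δ τ ε₀ j k) with h | ⟨x, hx⟩
  · rw [h, measure_empty]; exact zero_le
  · have hs := side_pos (j + 1)
    refine (measure_mono (D.pwin_subset_closedBall hx)).trans
      ((D.growth _ _ (by positivity)).trans_eq ?_)
    rw [mul_assoc C₀, ← mul_pow]
    congr 3
    ring

lemma measure_misfit_le [IsFiniteMeasure μ] (D : Setup S μ e C₀ δ τ ε₀ M) {j : ℕ}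
    {k : Fin n → ℤ} (hk : InTree S μ e δ τ ε₀ (j + 1) k) :
    μ (pwin S μ e δ τ ε₀ j k ∩
      {x | τ * side (j + 1) < ‖S.q x - amap S μ e δ τ ε₀ (j + 1) k (S.p x)‖}) ≤
      ENNReal.ofReal (1 / τ ^ 2 * (e (j + 1) k ^ 2 * side (j + 1) ^ n)) := by
  have hs := side_pos (j + 1)
  have hτ := D.τ_pos
  rcases Set.eq_empty_or_nonempty (pwin S μ e δ τ ε₀ j k) with h | ⟨x, hx⟩
  · rw [h, empty_inter, measure_empty]; exact zero_le
  refine (measure_lt_le_ofReal (A := e (j + 1) k ^ 2 * side (j + 1) ^ 2 * side (j + 1) ^ n)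
    (measurableSet_win ..) ?_ (by positivity) (by positivity) ?_).trans_eq ?_
  · exact (continuous_gap S (amap S μ e δ τ ε₀ (j + 1) k)).measurable
  · refine (lintegral_mono_set ?_).trans (hk.good.fit x hx)
    refine (D.pwin_subset_closedBall hx).trans (closedBall_subset_closedBall ?_)
    gcongr
    norm_num
  · congr 1
    field_simp

end Setup

end Loss

section TotalLoss

variable {N n : ℕ} {W : Type*} [NormedAddCommGroup W] [InnerProductSpace ℝ W]
  {S : Splitting N n W} {μ : Measure (EuclideanSpace ℝ (Fin N))}
  {e : ℕ → (Fin n → ℤ) → ℝ} {C₀ δ τ ε₀ : ℝ} {M : ℕ}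

/-- The constant in the estimate of the lost mass. -/
def lossConst (n M : ℕ) (C₀ δ τ ε₀ L : ℝ) : ℝ :=
  2 / τ ^ 2 + C₀ * (6 * n) ^ n / ε₀ ^ 2 +
    n * (C₀ * (6 * n) ^ n * (48 * incrConst n L ^ 2 * 40 ^ n * herrConst n M δ))

lemma Setup.measure_sdiff_goodSet_le [IsFiniteMeasure μ] (D : Setup S μ e C₀ δ τ ε₀ M)
    (hε₀ : 0 < ε₀) {L : ℝ} (hL : 1 ≤ L)
    (h1 : ∀ t h, |bump (t + h) - bump t| ≤ L * |h|)
    (h2 : ∀ t h, |bump (t + h) - 2 * bump t + bump (t - h)| ≤ L * h ^ 2)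
    (hsmall : 5 * 5 ^ n * incrConst n L * (cmpConst n M δ * (1 + 2 ^ (n + 1) * 17 ^ n) * ε₀) ≤
      1 / 4) {Θ : ℝ}
    (hΘ : ∀ T : Finset (ℕ × (Fin n → ℤ)), ∑ t ∈ T, e t.1 t.2 ^ 2 * side t.1 ^ n ≤ Θ) :
    μ (closedBall 0 5 \ goodSet S μ e δ τ ε₀) ≤
      ENNReal.ofReal (δ * 28 ^ n + lossConst n M C₀ δ τ ε₀ L * Θ) := by
  have hτ := D.τ_pos
  have hδ := D.δ_pos
  have hC₀ := D.C₀_nonneg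
  have hΘ0 : 0 ≤ Θ := by simpa using hΘ ∅
  set cw : ℝ := C₀ * (6 * n) ^ n with hcw
  have hcw0 : 0 ≤ cw := by positivity
  set cs : ℝ := 48 * incrConst n L ^ 2 * 40 ^ n * herrConst n M δ with hcs
  have hcs0 : 0 ≤ cs := by rw [hcs, herrConst]; positivity
  let pw : ℕ × (Fin n → ℤ) → Set (EuclideanSpace ℝ (Fin N)) :=
    fun s => pwin S μ e δ τ ε₀ s.1 s.2
  let Ia : Set (ℕ × (Fin n → ℤ)) := {s | Stopped S μ e δ τ ε₀ s ∧
    μ (pw s) ≤ ENNReal.ofReal (δ * side (s.1 + 1) ^ n)}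
  let Ib : Set (ℕ × (Fin n → ℤ)) := {s | ε₀ < e (s.1 + 1) s.2}
  let Ic : Fin n → Set (ℕ × (Fin n → ℤ)) := fun i => {s | Stopped S μ e δ τ ε₀ s ∧
    1 / 2 ≤ ‖(amap S μ e δ τ ε₀ s.1 (par s.2)).linear (Pi.single i 1)‖}
  let Ig : Set (ℕ × (Fin n → ℤ)) := {s | InTree S μ e δ τ ε₀ (s.1 + 1) s.2}
  let G : ℕ × (Fin n → ℤ) → Set (EuclideanSpace ℝ (Fin N)) := fun s => pw s ∩
    {x | τ * side (s.1 + 1) < ‖S.q x - amap S μ e δ τ ε₀ (s.1 + 1) s.2 (S.p x)‖}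
  have hsub : closedBall 0 5 \ goodSet S μ e δ τ ε₀ ⊆ (univ ∩ {x | τ < ‖S.q x‖}) ∪
      ((⋃ s ∈ Ia, pw s) ∪ ((⋃ s ∈ Ib, pw s) ∪ ((⋃ i, ⋃ s ∈ Ic i, pw s) ∪ ⋃ s ∈ Ig, G s))) := by
    rintro x ⟨hx, hgood⟩
    rw [mem_closedBall, dist_zero_right] at hx
    rcases subset_losses hx hgood with h | ⟨s, hxs, hs | ⟨hs, hgap⟩⟩
    · exact Or.inl ⟨mem_univ _, h⟩
    · right
      by_cases hd : μ (pw s) ≤ ENNReal.ofReal (δ * side (s.1 + 1) ^ n)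
      · exact Or.inl (mem_biUnion (show s ∈ Ia from ⟨hs, hd⟩) hxs)
      · right
        by_cases hb : ε₀ < e (s.1 + 1) s.2
        · exact Or.inl (mem_biUnion (show s ∈ Ib from hb) hxs)
        · right; left
          obtain ⟨i, hi⟩ := D.exists_steep hs (le_of_not_ge hd) (not_lt.1 hb)
          exact mem_iUnion.2 ⟨i, mem_biUnion (show s ∈ Ic i from ⟨hs, hi⟩) hxs⟩
    · exact Or.inr (Or.inr (Or.inr (Or.inr
        (mem_biUnion (show s ∈ Ig from hs) (show x ∈ G s from ⟨hxs, hgap⟩)))))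
  have hside : ∀ j, 0 ≤ side j := fun j => (side_pos j).le
  have m0 : μ (univ ∩ {x | τ < ‖S.q x‖}) ≤ ENNReal.ofReal (1 / τ ^ 2 * Θ) := by
    have he : e 0 0 ^ 2 ≤ Θ := by simpa [side] using hΘ {(0, 0)}
    refine (measure_lt_le_ofReal (A := e 0 0 ^ 2) MeasurableSet.univ
      S.q.continuous.norm.measurable hτ (sq_nonneg _) ?_).trans (ENNReal.ofReal_le_ofReal ?_)
    · rw [Measure.restrict_univ]
      exact D.fit_zero 0 (by simp)
    · rw [div_eq_mul_one_div, mul_comm]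
      gcongr
  have ma : μ (⋃ s ∈ Ia, pw s) ≤ ENNReal.ofReal (δ * 28 ^ n) := by
    refine measure_biUnion_le_ofReal (f := fun s => δ * side (s.1 + 1) ^ n)
      (fun s => by have := hside (s.1 + 1); positivity) (fun s hs => hs.2) fun T hT => ?_
    rw [← Finset.mul_sum]
    exact mul_le_mul_of_nonneg_left (sum_side_le_of_stopped fun s hs => (hT s hs).1) hδ.le
  have mb : μ (⋃ s ∈ Ib, pw s) ≤ ENNReal.ofReal (cw / ε₀ ^ 2 * Θ) := by
    refine measure_biUnion_le_ofReal
      (f := fun s => cw / ε₀ ^ 2 * (e (s.1 + 1) s.2 ^ 2 * side (s.1 + 1) ^ n))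
      (fun s => by have := hside (s.1 + 1); positivity) (fun s hs => ?_) fun T hT => ?_
    · refine (D.measure_pwin_le s.1 s.2).trans (ENNReal.ofReal_le_ofReal ?_)
      have h3 : 1 ≤ e (s.1 + 1) s.2 ^ 2 / ε₀ ^ 2 := by
        rw [one_le_div (by positivity)]
        exact pow_le_pow_left₀ hε₀.le (le_of_lt hs) 2
      have h4 : 0 ≤ cw * side (s.1 + 1) ^ n := by have := hside (s.1 + 1); positivity
      calc cw * side (s.1 + 1) ^ n ≤ cw * side (s.1 + 1) ^ n * (e (s.1 + 1) s.2 ^ 2 / ε₀ ^ 2) :=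
            le_mul_of_one_le_right h4 h3
        _ = _ := by ring
    · rw [← Finset.mul_sum]
      exact mul_le_mul_of_nonneg_left (sum_next_scale_le hΘ T) (by positivity)
  have mc : μ (⋃ i, ⋃ s ∈ Ic i, pw s) ≤ ENNReal.ofReal (n * (cw * cs) * Θ) := by
    refine (measure_iUnion_fintype_le μ _).trans ?_
    have hi : ∀ i, μ (⋃ s ∈ Ic i, pw s) ≤ ENNReal.ofReal (cw * (cs * Θ)) := fun i => by
      refine measure_biUnion_le_ofReal (f := fun s => cw * side (s.1 + 1) ^ n)
        (fun s => by have := hside (s.1 + 1); positivity)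
        (fun s _ => D.measure_pwin_le s.1 s.2) fun T hT => ?_
      rw [← Finset.mul_sum]
      refine mul_le_mul_of_nonneg_left ?_ hcw0
      refine (D.sum_stopped_le hL h1 h2 hsmall hΘ i T hT).trans_eq ?_
      rw [hcs]; ring
    refine (Finset.sum_le_card_nsmul _ _ _ fun i _ => hi i).trans_eq ?_
    rw [Finset.card_univ, Fintype.card_fin, nsmul_eq_mul, ← ENNReal.ofReal_natCast,
      ← ENNReal.ofReal_mul (by positivity)]
    ring_nf
  have mg : μ (⋃ s ∈ Ig, G s) ≤ ENNReal.ofReal (1 / τ ^ 2 * Θ) := by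
    refine measure_biUnion_le_ofReal
      (f := fun s => 1 / τ ^ 2 * (e (s.1 + 1) s.2 ^ 2 * side (s.1 + 1) ^ n))
      (fun s => by have := hside (s.1 + 1); positivity) (fun s hs => D.measure_misfit_le hs)
      fun T _ => ?_
    rw [← Finset.mul_sum]
    exact mul_le_mul_of_nonneg_left (sum_next_scale_le hΘ T) (by positivity)
  refine (measure_mono hsub).trans ?_
  refine (measure_union_le _ _).trans ?_
  refine (add_le_add m0 ((measure_union_le _ _).trans (add_le_add ma ((measure_union_le _ _).trans
    (add_le_add mb ((measure_union_le _ _).trans (add_le_add mc mg))))))).trans_eq ?_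
  rw [← ENNReal.ofReal_add (by positivity) (by positivity),
    ← ENNReal.ofReal_add (by positivity) (by positivity),
    ← ENNReal.ofReal_add (by positivity) (by positivity),
    ← ENNReal.ofReal_add (by positivity) (by positivity), lossConst]
  congr 1
  ring

end TotalLoss

section Graph

variable {N n : ℕ} {W : Type*} [NormedAddCommGroup W] [InnerProductSpace ℝ W]
  {S : Splitting N n W} {μ : Measure (EuclideanSpace ℝ (Fin N))}
  {e : ℕ → (Fin n → ℤ) → ℝ} {C₀ δ τ ε₀ : ℝ} {M : ℕ}

lemma abs_idx_sub_le {j : ℕ} {y z : Fin n → ℝ} (h : ‖y - z‖ ≤ side j) (i : Fin n) :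
    |idx j y i - idx j z i| ≤ 1 := by
  have h1 : |y i - z i| ≤ side j := (norm_le_pi_norm (y - z) i).trans h
  have hp : (0 : ℝ) < 2 ^ j := by positivity
  have h2 : |(2 : ℝ) ^ j * y i - 2 ^ j * z i| ≤ 1 := by
    rw [← mul_sub, abs_mul, abs_of_pos hp, ← two_pow_mul_side j]
    gcongr
  simp only [idx]
  rw [abs_le] at h2
  have a1 := Int.floor_le ((2 : ℝ) ^ j * y i)
  have a2 := Int.lt_floor_add_one ((2 : ℝ) ^ j * y i)
  have a3 := Int.floor_le ((2 : ℝ) ^ j * z i)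
  have a4 := Int.lt_floor_add_one ((2 : ℝ) ^ j * z i)
  have b1 : ((⌊(2 : ℝ) ^ j * y i⌋ - ⌊(2 : ℝ) ^ j * z i⌋ : ℤ) : ℝ) < (2 : ℤ) := by
    push_cast; linarith
  have b2 : ((-2 : ℤ) : ℝ) < (⌊(2 : ℝ) ^ j * y i⌋ - ⌊(2 : ℝ) ^ j * z i⌋ : ℤ) := by
    push_cast; linarith
  have c1 := Int.cast_lt.1 b1
  have c2 := Int.cast_lt.1 b2
  rw [abs_le]
  omega

lemma Setup.norm_q_sub_le_scale [IsFiniteMeasure μ] (D : Setup S μ e C₀ δ τ ε₀ M)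
    {x z : EuclideanSpace ℝ (Fin N)} (hx : x ∈ goodSet S μ e δ τ ε₀)
    (hz : z ∈ goodSet S μ e δ τ ε₀) {j : ℕ} (hj : ‖S.p x - S.p z‖ ≤ side j) :
    ‖S.q x - S.q z‖ ≤ n * ‖S.p x - S.p z‖ + 1 / 2 * side j := by
  obtain ⟨hxT, hxg⟩ := hx j
  obtain ⟨hzT, hzg⟩ := hz j
  set k := idx j (S.p x)
  set m := idx j (S.p z)
  set a := amap S μ e δ τ ε₀ j k
  set b := amap S μ e δ τ ε₀ j m
  have hkm : ∀ i, |k i - m i| ≤ 8 := fun i => (abs_idx_sub_le hj i).trans (by norm_num)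
  have hmk : ∀ i, |m i - k i| ≤ 8 := fun i => by rw [abs_sub_comm]; exact hkm i
  have h1 : ‖a (S.p x) - a (S.p z)‖ ≤ n * ‖S.p x - S.p z‖ := by
    have := norm_apply_sub_le (slopeLE_amap (S := S) (μ := μ) (e := e) (δ := δ) (τ := τ)
      (ε₀ := ε₀) j k) (S.p x) (S.p z)
    rwa [mul_one] at this
  have h2 := (D.compare_same hzT hxT hmk).2 (S.p z)
    fun i => (nearCube_of_idx rfl i).trans (by norm_num)
  have h3 := mul_le_mul_of_nonneg_right (D.cmp_small (D.e_le hzT) (D.e_le hxT)) (side_pos j).le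
  have hτ := mul_le_mul_of_nonneg_right D.τ_le_eighth (side_pos j).le
  have h4 : S.q x - S.q z = (S.q x - a (S.p x)) + (a (S.p x) - a (S.p z)) -
      (b (S.p z) - a (S.p z)) - (S.q z - b (S.p z)) := by abel
  rw [h4]
  refine (norm_sub_le _ _).trans ((add_le_add_left ((norm_sub_le _ _).trans
    (add_le_add_left (norm_add_le _ _) _)) _).trans ?_)
  have := side_pos j
  linarith

lemma Setup.norm_q_sub_le [IsFiniteMeasure μ] (D : Setup S μ e C₀ δ τ ε₀ M)
    {x z : EuclideanSpace ℝ (Fin N)} (hx : x ∈ goodSet S μ e δ τ ε₀)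
    (hz : z ∈ goodSet S μ e δ τ ε₀) : ‖S.q x - S.q z‖ ≤ (n + 1) * ‖S.p x - S.p z‖ := by
  set d := ‖S.p x - S.p z‖ with hd
  have hd0 : 0 ≤ d := norm_nonneg _
  have hside : ∀ j, side j = (1 / 2 : ℝ) ^ j := fun j => by rw [side, one_div, inv_pow]
  rcases hd0.eq_or_lt with h0 | hpos
  · have h1 : ∀ j, ‖S.q x - S.q z‖ ≤ (1 / 2 : ℝ) ^ j := fun j => by
      have := D.norm_q_sub_le_scale hx hz (j := j) (by rw [← hd, ← h0]; exact (side_pos j).le)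
      rw [← hd, ← h0, mul_zero, zero_add] at this
      rw [← hside]
      linarith [side_pos j]
    have h2 := ge_of_tendsto' (tendsto_pow_atTop_nhds_zero_of_lt_one (r := (1 / 2 : ℝ))
      (by norm_num) (by norm_num)) h1
    rwa [← h0, mul_zero]
  · by_cases h1 : d ≤ 1
    · obtain ⟨j, hj1, hj2⟩ := exists_nat_pow_near_of_lt_one hpos h1
        (by norm_num : (0 : ℝ) < 1 / 2) (by norm_num)
      rw [← hside] at hj1 hj2
      rw [side_succ] at hj1
      have := D.norm_q_sub_le_scale hx hz (j := j) hj2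
      rw [← hd] at this
      linarith
    · have h2 : ‖S.q x‖ ≤ τ := by simpa [amap, side] using (hx 0).2
      have h3 : ‖S.q z‖ ≤ τ := by simpa [amap, side] using (hz 0).2
      have h4 := norm_sub_le (S.q x) (S.q z)
      have h5 := D.τ_le_eighth
      have h6 : 0 ≤ n * d := by positivity
      push Not at h1
      linarith

end Graph

section FitErr

variable {N n : ℕ} {W : Type*} [NormedAddCommGroup W] [InnerProductSpace ℝ W]

open scoped Classical in
/-- The errors of the affine fits: a prescribed one at the top level, below it the normalized
energy of the cube. -/
def fitErr (S : Splitting N n W) (C : ℝ) (K : (Fin (n + 2) → EuclideanSpace ℝ (Fin N)) → ℝ)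
    (μ : Measure (EuclideanSpace ℝ (Fin N))) (F e₀ : ℝ) : ℕ → (Fin n → ℤ) → ℝ
  | 0, k => if ∀ i, |k i| ≤ 6 then e₀ else 0
  | j + 1, k => √(F * (cubeEnergy S C K μ (j + 1) k).toReal / side (j + 1) ^ n)

variable {S : Splitting N n W} {C : ℝ} {K : (Fin (n + 2) → EuclideanSpace ℝ (Fin N)) → ℝ}
  {μ : Measure (EuclideanSpace ℝ (Fin N))} {F e₀ : ℝ}

lemma fitErr_nonneg (he₀ : 0 ≤ e₀) (j : ℕ) (k : Fin n → ℤ) : 0 ≤ fitErr S C K μ F e₀ j k := by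
  cases j with
  | zero => rw [fitErr]; split_ifs <;> simp [he₀]
  | succ j => exact Real.sqrt_nonneg _

lemma fitErr_succ_sq (hF : 0 ≤ F) (j : ℕ) (k : Fin n → ℤ) :
    fitErr S C K μ F e₀ (j + 1) k ^ 2 * side (j + 1) ^ n =
      F * (cubeEnergy S C K μ (j + 1) k).toReal := by
  have h := pow_pos (side_pos (j + 1)) n
  rw [fitErr, Real.sq_sqrt (by positivity)]
  field_simp

lemma cubeEnergy_le (hn : 1 ≤ n) (hC : 0 < C) {m : ℕ} (hm : C ^ 2 < 2 ^ m)
    (hK : AEMeasurable K (Measure.pi fun _ : Fin (n + 2) => μ)) (j : ℕ) (k : Fin n → ℤ) :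
    cubeEnergy S C K μ j k ≤ m * MengerEnergy N n 2 K μ := by
  simpa using sum_cubeEnergy_le hn S hC hm hK {(j, k)}

lemma sum_fitErr_sq_le (hn : 1 ≤ n) (hC : 0 < C) {m : ℕ} (hm : C ^ 2 < 2 ^ m)
    (hK : AEMeasurable K (Measure.pi fun _ : Fin (n + 2) => μ)) (hF : 0 ≤ F) {η : ℝ} (hη : 0 ≤ η)
    (hE : MengerEnergy N n 2 K μ ≤ ENNReal.ofReal η) (T : Finset (ℕ × (Fin n → ℤ))) :
    ∑ t ∈ T, fitErr S C K μ F e₀ t.1 t.2 ^ 2 * side t.1 ^ n ≤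
      13 ^ n * e₀ ^ 2 + F * (m * η) := by
  classical
  have hfin : ∀ t : ℕ × (Fin n → ℤ), cubeEnergy S C K μ t.1 t.2 ≠ ⊤ := fun t =>
    ne_top_of_le_ne_top (ENNReal.mul_ne_top (ENNReal.natCast_ne_top m)
      (ne_top_of_le_ne_top ENNReal.ofReal_ne_top hE)) (cubeEnergy_le hn hC hm hK t.1 t.2)
  have hterm : ∀ t ∈ T, fitErr S C K μ F e₀ t.1 t.2 ^ 2 * side t.1 ^ n ≤
      (if t.1 = 0 ∧ ∀ i, |t.2 i| ≤ 6 then e₀ ^ 2 else 0) +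
        F * (cubeEnergy S C K μ t.1 t.2).toReal := by
    rintro ⟨j, k⟩ -
    cases j with
    | zero =>
      have h0 : (0 : ℝ) ≤ F * (cubeEnergy S C K μ 0 k).toReal := by positivity
      have h1 : side 0 = 1 := by simp [side]
      by_cases h : ∀ i, |k i| ≤ 6
      · simpa [fitErr, h, h1] using h0
      · simpa [fitErr, h, h1] using h0
    | succ j => rw [fitErr_succ_sq hF]; simp
  refine (Finset.sum_le_sum hterm).trans ?_
  rw [Finset.sum_add_distrib, ← Finset.mul_sum, ← ENNReal.toReal_sum fun t _ => hfin t]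
  refine add_le_add ?_ (mul_le_mul_of_nonneg_left ?_ hF)
  · rw [← Finset.sum_filter, Finset.sum_const, nsmul_eq_mul]
    refine mul_le_mul_of_nonneg_right ?_ (sq_nonneg _)
    have hinj : Set.InjOn Prod.snd
        ((T.filter fun t => t.1 = 0 ∧ ∀ i, |t.2 i| ≤ 6 : Finset _) : Set (ℕ × (Fin n → ℤ))) := by
      rintro ⟨i, k⟩ hi ⟨j, l⟩ hj hkl
      have h1 := (Finset.mem_filter.1 hi).2.1
      have h2 := (Finset.mem_filter.1 hj).2.1
      simp_all
    rw [← Finset.card_image_of_injOn hinj]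
    have := card_le_of_abs_sub_le
      ((T.filter fun t => t.1 = 0 ∧ ∀ i, |t.2 i| ≤ 6).image Prod.snd) 0 6 (by
        intro k hk i
        obtain ⟨t, ht, rfl⟩ := Finset.mem_image.1 hk
        simpa using (Finset.mem_filter.1 ht).2.2 i)
    exact_mod_cast this
  · refine ENNReal.toReal_le_of_le_ofReal (by positivity) ?_
    rw [ENNReal.ofReal_mul (by positivity), ENNReal.ofReal_natCast]
    exact (sum_cubeEnergy_le hn S hC hm hK T).trans (by gcongr)

lemma setup_fitErr [IsFiniteMeasure μ] (hn : 1 ≤ n) {C₀ : ℝ} (hC₀ : 0 ≤ C₀)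
    (hμ : ∀ c r, 0 ≤ r → μ (closedBall c r) ≤ ENNReal.ofReal (C₀ * (2 * r) ^ n))
    (hK : AEMeasurable K (Measure.pi fun _ : Fin (n + 2) => μ)) {c lam : ℝ} (hc : 0 ≤ c)
    (hprop : ∀ t : ℝ, 0 < t → ∀ C : ℝ, 1 ≤ C → ∀ x : EuclideanSpace ℝ (Fin N),
      ∀ y : Fin (n + 1) → EuclideanSpace ℝ (Fin N),
        IsHSimplex N (t / C) y →
        convexHull ℝ (Set.range y) ⊆ Metric.closedBall x (C * t) →
        ∀ w ∈ Metric.closedBall x (C * t),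
          (Metric.infDist w (affineSpan ℝ (Set.range y) : Set (EuclideanSpace ℝ (Fin N))) / t) ^
            (2 : ℝ) ≤ c * C ^ lam * t ^ (n * (n + 1)) * K (Fin.snoc y w) ^ (2 : ℝ))
    {M : ℕ} (hM : 0 < M) {δ τ ε₀ : ℝ} (hδ : 0 < δ) (hδ1 : δ ≤ 1)
    (hslab : slabConst n C₀ / M ≤ δ / (2 * (n + 1))) (hτ : 0 < τ)
    (hτ1 : 2 * (n + 1) * n * M * (2 * τ) ≤ 1)
    (hsmall : cmpConst n M δ * (1 + 2 ^ (n + 1) * 17 ^ n) * ε₀ ≤ 1 / 16)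
    {m : ℕ} (hm : ratio n M ^ 2 < 2 ^ m) (hE : MengerEnergy N n 2 K μ ≠ ⊤)
    (he₀ : 0 ≤ e₀) (he₀ε : e₀ ≤ ε₀)
    (hq : ∫⁻ w, ENNReal.ofReal (‖S.q w‖ ^ 2) ∂μ ≤ ENNReal.ofReal (e₀ ^ 2)) :
    Setup S μ (fitErr S (ratio n M) K μ (fitConst n M δ c lam) e₀) C₀ δ τ ε₀ M where
  one_le := hn
  C₀_nonneg := hC₀
  growth := hμ
  M_pos := hM
  δ_pos := hδ
  δ_le := hδ1
  slab := hslab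
  τ_pos := hτ
  τ_le := hτ1
  e_nonneg := fitErr_nonneg he₀
  e_zero_le := fun k => by
    rw [fitErr]
    split_ifs
    exacts [he₀ε, he₀.trans he₀ε]
  fit_zero := fun k hk => by rwa [fitErr, if_pos hk]
  exists_fit := fun j k a ha hdens => by
    have hr : 2 * (n + 1) * n * M * (2 * τ * side (j + 1)) ≤ side (j + 1) := by
      have := mul_le_mul_of_nonneg_right hτ1 (side_pos (j + 1)).le
      linarith
    have hs := side_pos (j + 1)
    have hR : 0 < ratio n M := by rw [ratio]; positivity
    have hF : 0 ≤ fitConst n M δ c lam := by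
      have : 0 ≤ ratio n M ^ lam := Real.rpow_nonneg hR.le _
      rw [fitConst]; positivity
    obtain ⟨b, hb, hb'⟩ := exists_fit hn S hC₀ hμ hK hc hprop ha hM (by positivity) hr hδ hslab hdens
    refine ⟨b, fun x hx => (hb x hx).trans_eq ?_, hb'⟩
    have hfin : cubeEnergy S (ratio n M) K μ (j + 1) k ≠ ⊤ :=
      ne_top_of_le_ne_top (ENNReal.mul_ne_top (ENNReal.natCast_ne_top m) hE)
        (cubeEnergy_le hn hR hm hK (j + 1) k)
    rw [mul_right_comm, fitErr_succ_sq hF, mul_right_comm,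
      ENNReal.ofReal_mul (p := fitConst n M δ c lam * side (j + 1) ^ 2) (by positivity),
      ENNReal.ofReal_toReal hfin]
  small := hsmall

end FitErr

section Final

variable {N n : ℕ}

lemma exists_splitting (P : Submodule ℝ (EuclideanSpace ℝ (Fin N)))
    (hP : Module.finrank ℝ P = n) :
    ∃ S : Splitting N n Pᗮ, (∀ x, S.q x = Pᗮ.orthogonalProjectionOnto x) ∧
      ∀ x, ‖S.p x‖ ≤ ‖P.orthogonalProjectionOnto x‖ := by
  set b : OrthonormalBasis (Fin n) ℝ P := (stdOrthonormalBasis ℝ P).reindex (finCongr hP)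
  set p : EuclideanSpace ℝ (Fin N) →L[ℝ] (Fin n → ℝ) :=
    ContinuousLinearMap.pi fun i => (innerSL ℝ (b i)).comp P.orthogonalProjectionOnto
  have hp : ∀ x i, p x i = inner ℝ (b i) (P.orthogonalProjectionOnto x) := fun x i => rfl
  have hpP : ∀ x, ‖p x‖ ≤ ‖P.orthogonalProjectionOnto x‖ := fun x => by
    refine (pi_norm_le_iff_of_nonneg (norm_nonneg _)).2 fun i => ?_
    rw [hp]
    simpa using norm_inner_le_norm (𝕜 := ℝ) (b i) (P.orthogonalProjectionOnto x)
  refine ⟨⟨p, Pᗮ.orthogonalProjectionOnto,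
    fun x => (hpP x).trans (P.norm_orthogonalProjectionOnto_apply_le x),
    Pᗮ.norm_orthogonalProjectionOnto_apply_le, fun x => ?_⟩, fun x => rfl, hpP⟩
  have h1 : ‖P.orthogonalProjectionOnto x‖ ≤ n * ‖p x‖ := by
    rw [← b.sum_repr' (P.orthogonalProjectionOnto x)]
    refine (norm_sum_le _ _).trans ?_
    have : ∀ i ∈ Finset.univ, ‖inner ℝ (b i) (P.orthogonalProjectionOnto x) • b i‖ ≤ ‖p x‖ := by
      intro i _
      rw [norm_smul, b.norm_eq_one, mul_one, ← hp]
      exact norm_le_pi_norm (p x) i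
    simpa using Finset.sum_le_card_nsmul _ _ _ this
  have h2 : ‖x‖ ≤ ‖P.orthogonalProjectionOnto x‖ + ‖Pᗮ.orthogonalProjectionOnto x‖ := by
    conv_lhs => rw [← P.starProjection_add_starProjection_orthogonal x]
    exact norm_add_le _ _
  linarith

/-- The second moment of the distance to a subspace is controlled by the first `β`-number. -/
lemma lintegral_sq_le_of_betaP {μ : Measure (EuclideanSpace ℝ (Fin N))}
    (hμ : μ (closedBall (0 : EuclideanSpace ℝ (Fin N)) 5)ᶜ = 0)
    {P : Submodule ℝ (EuclideanSpace ℝ (Fin N))} {η : ℝ}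
    (hβ : betaP N n 1 3 μ (P : Set (EuclideanSpace ℝ (Fin N))) 0 5 ≤ ENNReal.ofReal η) :
    ∫⁻ w, ENNReal.ofReal (‖Pᗮ.orthogonalProjectionOnto w‖ ^ 2) ∂μ ≤
      ENNReal.ofReal (5 ^ (n + 2) * η) := by
  have hq : ∀ w : EuclideanSpace ℝ (Fin N),
      ‖Pᗮ.orthogonalProjectionOnto w‖ ≤ infDist w (P : Set (EuclideanSpace ℝ (Fin N))) := fun w => by
    refine (le_infDist ⟨0, P.zero_mem⟩).2 fun y hy => ?_
    have h0 : Pᗮ.orthogonalProjectionOnto y = 0 :=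
      Submodule.orthogonalProjectionOnto_apply_of_mem_orthogonal
        (P.le_orthogonal_orthogonal hy)
    rw [← sub_zero (Pᗮ.orthogonalProjectionOnto w), ← h0, ← map_sub, dist_eq_norm]
    exact Pᗮ.norm_orthogonalProjectionOnto_apply_le _
  have hae : ∀ᵐ w ∂μ, w ∈ closedBall (0 : EuclideanSpace ℝ (Fin N)) 5 := by
    rw [ae_iff]; exact hμ
  have hres : μ.restrict (closedBall (0 : EuclideanSpace ℝ (Fin N)) (3 * 5)) = μ :=
    Measure.restrict_eq_self_of_ae_mem (hae.mono fun w hw =>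
      closedBall_subset_closedBall (by norm_num) hw)
  have h5 : (0 : ℝ) < 5 ^ n := by positivity
  have hβ' : ∫⁻ y, ENNReal.ofReal (infDist y (P : Set (EuclideanSpace ℝ (Fin N))) / 5) ∂μ ≤
      ENNReal.ofReal (5 ^ n) * ENNReal.ofReal η := by
    rw [betaP, hres] at hβ
    simp only [Real.rpow_one, div_one, ENNReal.rpow_one] at hβ
    rwa [ENNReal.inv_mul_le_iff (by simp) ENNReal.ofReal_ne_top] at hβ
  calc ∫⁻ w, ENNReal.ofReal (‖Pᗮ.orthogonalProjectionOnto w‖ ^ 2) ∂μ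
      ≤ ∫⁻ w, ENNReal.ofReal 25 *
          ENNReal.ofReal (infDist w (P : Set (EuclideanSpace ℝ (Fin N))) / 5) ∂μ := by
        refine lintegral_mono_ae (hae.mono fun w hw => ?_)
        rw [← ENNReal.ofReal_mul (by norm_num)]
        refine ENNReal.ofReal_le_ofReal ?_
        have h1 := hq w
        have h2 : ‖Pᗮ.orthogonalProjectionOnto w‖ ≤ 5 :=
          (Pᗮ.norm_orthogonalProjectionOnto_apply_le w).trans (mem_closedBall_zero_iff.1 hw)
        nlinarith [norm_nonneg (Pᗮ.orthogonalProjectionOnto w)]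
    _ = ENNReal.ofReal 25 *
          ∫⁻ w, ENNReal.ofReal (infDist w (P : Set (EuclideanSpace ℝ (Fin N))) / 5) ∂μ :=
        lintegral_const_mul' _ _ ENNReal.ofReal_ne_top
    _ ≤ ENNReal.ofReal 25 * (ENNReal.ofReal (5 ^ n) * ENNReal.ofReal η) := by gcongr
    _ = ENNReal.ofReal (5 ^ (n + 2) * η) := by
        rw [← ENNReal.ofReal_mul h5.le, ← ENNReal.ofReal_mul (by norm_num)]
        congr 1; ring

/-- A set on which the projection to `P` has a Lipschitz inverse lies in a Lipschitz graph. -/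
lemma exists_graph_of_lipschitz (P : Submodule ℝ (EuclideanSpace ℝ (Fin N)))
    {G : Set (EuclideanSpace ℝ (Fin N))} {Λ : ℝ≥0}
    (hG : ∀ x ∈ G, ∀ z ∈ G, ‖Pᗮ.orthogonalProjectionOnto x - Pᗮ.orthogonalProjectionOnto z‖ ≤
      Λ * ‖P.orthogonalProjectionOnto x - P.orthogonalProjectionOnto z‖) :
    ∃ (A : P → Pᗮ) (L : ℝ≥0), LipschitzWith L A ∧
      G ⊆ Set.range fun u : P => (u : EuclideanSpace ℝ (Fin N)) + (A u : EuclideanSpace ℝ (Fin N)) := by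
  classical
  set s : Set P := P.orthogonalProjectionOnto '' G
  set f : P → Pᗮ := fun u =>
    if h : ∃ x ∈ G, P.orthogonalProjectionOnto x = u then Pᗮ.orthogonalProjectionOnto h.choose else 0
  have hf : ∀ x ∈ G, f (P.orthogonalProjectionOnto x) = Pᗮ.orthogonalProjectionOnto x := by
    intro x hx
    have h : ∃ y ∈ G, P.orthogonalProjectionOnto y = P.orthogonalProjectionOnto x := ⟨x, hx, rfl⟩
    have h1 := hG _ h.choose_spec.1 x hx
    rw [h.choose_spec.2, sub_self, norm_zero, mul_zero] at h1
    simp only [f, dif_pos h]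
    exact sub_eq_zero.1 (norm_le_zero_iff.1 h1)
  have hlip : LipschitzOnWith Λ f s := by
    refine LipschitzOnWith.of_dist_le_mul ?_
    rintro _ ⟨x, hx, rfl⟩ _ ⟨z, hz, rfl⟩
    rw [hf x hx, hf z hz, dist_eq_norm, dist_eq_norm]
    exact hG x hx z hz
  obtain ⟨A, hA, hAf⟩ := hlip.extend_finite_dimension
  refine ⟨A, _, hA, fun x hx => ⟨P.orthogonalProjectionOnto x, ?_⟩⟩
  simp only
  rw [← hAf (Set.mem_image_of_mem _ hx), hf x hx]
  exact P.starProjection_add_starProjection_orthogonal x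

lemma cmpConst_pos {M : ℕ} {δ : ℝ} (hδ : 0 < δ) : 0 < cmpConst n M δ := by
  rw [cmpConst]; positivity

/-- If the energy and the initial error are small enough, the stopping time construction loses
little mass. -/
lemma exists_setup (hn : 1 ≤ n) {K : (Fin (n + 2) → EuclideanSpace ℝ (Fin N)) → ℝ} {C₀ : ℝ}
    (hC₀ : 0 ≤ C₀) {c lam : ℝ} (hc : 0 ≤ c)
    (hprop : ∀ t : ℝ, 0 < t → ∀ C : ℝ, 1 ≤ C → ∀ x : EuclideanSpace ℝ (Fin N),
      ∀ y : Fin (n + 1) → EuclideanSpace ℝ (Fin N),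
        IsHSimplex N (t / C) y →
        convexHull ℝ (Set.range y) ⊆ Metric.closedBall x (C * t) →
        ∀ w ∈ Metric.closedBall x (C * t),
          (Metric.infDist w (affineSpan ℝ (Set.range y) : Set (EuclideanSpace ℝ (Fin N))) / t) ^
            (2 : ℝ) ≤ c * C ^ lam * t ^ (n * (n + 1)) * K (Fin.snoc y w) ^ (2 : ℝ)) :
    ∃ η₀ : ℝ, 0 < η₀ ∧ ∃ (δ τ ε₀ : ℝ) (M : ℕ), ∀ η, 0 ≤ η → η ≤ η₀ →
      ∀ (P : Submodule ℝ (EuclideanSpace ℝ (Fin N))) (S : Splitting N n Pᗮ)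
        (μ : Measure (EuclideanSpace ℝ (Fin N))) [IsFiniteMeasure μ],
        (∀ c r, 0 ≤ r → μ (closedBall c r) ≤ ENNReal.ofReal (C₀ * (2 * r) ^ n)) →
        AEMeasurable K (Measure.pi fun _ : Fin (n + 2) => μ) →
        MengerEnergy N n 2 K μ ≤ ENNReal.ofReal η →
        ∫⁻ w, ENNReal.ofReal (‖S.q w‖ ^ 2) ∂μ ≤ ENNReal.ofReal (5 ^ (n + 2) * η) →
        ∃ e, Setup S μ e C₀ δ τ ε₀ M ∧
          μ (closedBall 0 5 \ goodSet S μ e δ τ ε₀) ≤ ENNReal.ofReal (1 / 100) := by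
  obtain ⟨L, hL, hL1, hL2⟩ := exists_bump_bounds
  have hn1 : (1 : ℝ) ≤ n := by exact_mod_cast hn
  set δ : ℝ := 1 / (200 * 28 ^ n) with hδdef
  have hδ : 0 < δ := by positivity
  have h28 : δ * 28 ^ n = 1 / 200 := by rw [hδdef]; field_simp
  have hδ1 : δ ≤ 1 := by
    have : (1 : ℝ) ≤ 28 ^ n := one_le_pow₀ (by norm_num)
    nlinarith
  have hσ : 0 ≤ slabConst n C₀ := by rw [slabConst]; positivity
  obtain ⟨M₀, hM₀⟩ := exists_nat_ge (slabConst n C₀ / (δ / (2 * (n + 1))))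
  set M := M₀ + 1
  have hM : 0 < M := Nat.succ_pos _
  have hM' : (0 : ℝ) < M := by exact_mod_cast hM
  have hslab : slabConst n C₀ / M ≤ δ / (2 * (n + 1)) := by
    rw [div_le_iff₀ (by positivity)] at hM₀
    rw [div_le_iff₀ hM', mul_comm]
    refine hM₀.trans ?_
    gcongr
    exact Nat.le_succ _
  set τ : ℝ := 1 / (4 * (n + 1) * n * M) with hτdef
  have hτ : 0 < τ := by positivity
  have hτ1 : 2 * (n + 1) * n * M * (2 * τ) ≤ 1 := by
    rw [hτdef]
    apply le_of_eq
    field_simp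
    norm_num
  set B := cmpConst n M δ * (1 + 2 ^ (n + 1) * 17 ^ n) with hB
  have hB0 : 0 < B := mul_pos (cmpConst_pos hδ) (by positivity)
  set I := 5 * 5 ^ n * incrConst n L with hI
  have hI0 : 0 < I := mul_pos (by positivity) (incrConst_pos hL)
  set ε₀ : ℝ := 1 / (16 * B * (1 + I)) with hε
  have hε₀ : 0 < ε₀ := by positivity
  have hBε : B * ε₀ = 1 / (16 * (1 + I)) := by rw [hε]; field_simp
  have hsmall : B * ε₀ ≤ 1 / 16 := by
    rw [hBε]
    exact one_div_le_one_div_of_le (by norm_num) (by linarith)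
  have hsmall2 : I * (B * ε₀) ≤ 1 / 4 := by
    rw [hBε, mul_one_div, div_le_div_iff₀ (by positivity) (by norm_num)]
    linarith
  have hR : 0 < ratio n M := by rw [ratio]; positivity
  obtain ⟨m, hm⟩ := pow_unbounded_of_one_lt (ratio n M ^ 2) (one_lt_two (α := ℝ))
  set F := fitConst n M δ c lam with hFdef
  have hF : 0 ≤ F := by
    have : 0 ≤ ratio n M ^ lam := Real.rpow_nonneg hR.le _
    rw [hFdef, fitConst]; positivity
  set Z := |lossConst n M C₀ δ τ ε₀ L| * (13 ^ n * 5 ^ (n + 2) + F * m) with hZ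
  have hZ0 : 0 ≤ Z := by positivity
  refine ⟨min (ε₀ ^ 2 / 5 ^ (n + 2)) (1 / (200 * (Z + 1))), by positivity, δ, τ, ε₀, M, ?_⟩
  intro η hη hηle P S μ _ hμ hK hE hq
  have hη1 : 5 ^ (n + 2) * η ≤ ε₀ ^ 2 := by
    have := hηle.trans (min_le_left _ _)
    rw [le_div_iff₀ (by positivity)] at this
    linarith
  have hη2 : Z * η ≤ 1 / 200 := by
    have := hηle.trans (min_le_right _ _)
    rw [le_div_iff₀ (by positivity)] at this
    nlinarith
  set e₀ := √(5 ^ (n + 2) * η) with he₀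
  have he₀sq : e₀ ^ 2 = 5 ^ (n + 2) * η := Real.sq_sqrt (by positivity)
  have he₀ε : e₀ ≤ ε₀ := by
    rw [he₀, Real.sqrt_le_left hε₀.le]; exact hη1
  have D := setup_fitErr hn hC₀ hμ hK hc hprop hM hδ hδ1 hslab hτ hτ1 hsmall hm
    (ne_top_of_le_ne_top ENNReal.ofReal_ne_top hE) (Real.sqrt_nonneg _) he₀ε
    (by rwa [he₀sq])
  refine ⟨_, D, (D.measure_sdiff_goodSet_le hε₀ hL hL1 hL2 hsmall2
    (sum_fitErr_sq_le hn hR hm hK hF hη hE)).trans (ENNReal.ofReal_le_ofReal ?_)⟩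
  have h1 : lossConst n M C₀ δ τ ε₀ L * (13 ^ n * e₀ ^ 2 + F * (m * η)) ≤ Z * η := by
    rw [he₀sq, hZ]
    have h2 : 0 ≤ 13 ^ n * (5 ^ (n + 2) * η) + F * (m * η) := by positivity
    calc _ ≤ |lossConst n M C₀ δ τ ε₀ L| * (13 ^ n * (5 ^ (n + 2) * η) + F * (m * η)) :=
          mul_le_mul_of_nonneg_right (le_abs_self _) h2
      _ = _ := by ring
  linarith

lemma unitBallVol_pos (m : ℕ) : 0 < unitBallVol m :=
  ENNReal.toReal_pos (measure_closedBall_pos volume _ one_pos).ne' measure_closedBall_lt_top.ne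

end Final

end MengerGraph

/-- **Theorem (construction of a Lipschitz graph).** Let `1 ≤ n < N` and
`K : (ℝ^N)^{n+2} → [0,∞)`.  There exists `k > 2` such that for every `C₀ ≥ 10` there is
`η ∈ (0, ω_n 2^{-(2n+2)}]` with the following property: if `μ` is a Borel measure on `ℝ^N`
with compact support such that `K` is symmetric, `K²` is a `μ`-proper integrand and
(A) `μ(B(0,5)) ≥ 1`, `μ(ℝ^N ∖ B(0,5)) = 0`, (B) `μ(B) ≤ C₀ (diam B)^n` for every closed
ball `B`, (C) `M_{K²}(μ) ≤ η`, (D) `β_{1;k;μ}^{P₀}(0,5) ≤ η` for some `n`-dimensional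
linear subspace `P₀`, then there is a Lipschitz map `A : P₀ → P₀ᗮ` whose graph `G(A)`
satisfies `μ(G(A)) ≥ (99/100)·μ(ℝ^N)`. -/
theorem exists_lipschitz_graph {N n : ℕ} (hn : 1 ≤ n) (hnN : n < N)
    (K : (Fin (n + 2) → EuclideanSpace ℝ (Fin N)) → ℝ) (hK0 : ∀ z, 0 ≤ K z) :
    ∃ k : ℝ, 2 < k ∧
      ∀ C₀ : ℝ, 10 ≤ C₀ →
        ∃ η : ℝ, (0 < η ∧ η ≤ unitBallVol n / 2 ^ (2 * n + 2)) ∧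
          ∀ μ : Measure (EuclideanSpace ℝ (Fin N)),
            IsCompact (msupport N μ) →
            SymmetricKernel N n K →
            MuProperIntegrand N n 2 K μ →
            1 ≤ μ (Metric.closedBall (0 : EuclideanSpace ℝ (Fin N)) 5) →
            μ (Metric.closedBall (0 : EuclideanSpace ℝ (Fin N)) 5)ᶜ = 0 →
            (∀ (c : EuclideanSpace ℝ (Fin N)) (r : ℝ),
              μ (Metric.closedBall c r)
                ≤ ENNReal.ofReal (C₀ * Metric.diam (Metric.closedBall c r) ^ n)) →
            MengerEnergy N n 2 K μ ≤ ENNReal.ofReal η →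
            ∀ P₀ : Submodule ℝ (EuclideanSpace ℝ (Fin N)),
              Module.finrank ℝ P₀ = n →
              betaP N n 1 k μ (P₀ : Set (EuclideanSpace ℝ (Fin N))) 0 5
                  ≤ ENNReal.ofReal η →
              ∃ (A : P₀ → P₀ᗮ) (L : ℝ≥0), LipschitzWith L A ∧
                (99 / 100 : ℝ≥0∞) * μ Set.univ
                  ≤ μ (Set.range fun u : P₀ =>
                      (u : EuclideanSpace ℝ (Fin N)) + ((A u : P₀ᗮ) : EuclideanSpace ℝ (Fin N))) := by
  refine ⟨3, by norm_num, fun C₀ hC₀ => ?_⟩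
  have hω : 0 < unitBallVol n / 2 ^ (2 * n + 2) := by
    have := MengerGraph.unitBallVol_pos n
    positivity
  by_cases hex : ∃ c : ℝ, 1 ≤ c ∧ ∃ l : ℝ, 1 ≤ l ∧
      ∀ t : ℝ, 0 < t → ∀ C : ℝ, 1 ≤ C → ∀ x : EuclideanSpace ℝ (Fin N),
        ∀ y : Fin (n + 1) → EuclideanSpace ℝ (Fin N),
          IsHSimplex N (t / C) y →
          convexHull ℝ (Set.range y) ⊆ Metric.closedBall x (C * t) →
          ∀ w ∈ Metric.closedBall x (C * t),
            (Metric.infDist w (affineSpan ℝ (Set.range y) : Set (EuclideanSpace ℝ (Fin N))) / t) ^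
              (2 : ℝ) ≤ c * C ^ l * t ^ (n * (n + 1)) * K (Fin.snoc y w) ^ (2 : ℝ)
  swap
  · exact ⟨_, ⟨hω, le_rfl⟩, fun μ _ _ hpr => absurd hpr.2.2.1 hex⟩
  obtain ⟨c, hc, l, -, hprop⟩ := hex
  obtain ⟨η₀, hη₀, δ, τ, ε₀, M, hmain⟩ := MengerGraph.exists_setup hn (C₀ := C₀) (by linarith)
    (by linarith : (0 : ℝ) ≤ c) hprop
  refine ⟨min η₀ (unitBallVol n / 2 ^ (2 * n + 2)), ⟨lt_min hη₀ hω, min_le_right _ _⟩, ?_⟩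
  intro μ _ _ hpr hone hcompl hgrow hE P₀ hP₀ hβ
  have huniv : μ univ ≤ μ (closedBall (0 : EuclideanSpace ℝ (Fin N)) 5) := by
    rw [← union_compl_self (closedBall (0 : EuclideanSpace ℝ (Fin N)) 5)]
    exact (measure_union_le _ _).trans (by rw [hcompl, add_zero])
  have : IsFiniteMeasure μ :=
    ⟨huniv.trans_lt ((hgrow 0 5).trans_lt ENNReal.ofReal_lt_top)⟩
  obtain ⟨S, hq, hp⟩ := MengerGraph.exists_splitting P₀ hP₀
  obtain ⟨e, D, hloss⟩ := hmain _ (lt_min hη₀ hω).le (min_le_left _ _) P₀ S μ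
    (fun c r hr => (hgrow c r).trans (ENNReal.ofReal_le_ofReal (by
      have := diam_closedBall (x := c) hr
      have : 0 ≤ C₀ := by linarith
      gcongr)))
    hpr.2.1 hE (by simpa only [hq] using MengerGraph.lintegral_sq_le_of_betaP hcompl hβ)
  obtain ⟨A, L, hA, hG⟩ := MengerGraph.exists_graph_of_lipschitz P₀
    (G := MengerGraph.goodSet S μ e δ τ ε₀) (Λ := n + 1) fun x hx z hz => by
      have h1 := D.norm_q_sub_le hx hz
      rw [hq, hq, ← map_sub S.p] at h1
      refine h1.trans ?_
      push_cast
      gcongr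
      rw [← map_sub]
      exact hp _
  refine ⟨A, L, hA, le_trans ?_ (measure_mono hG)⟩
  set G := MengerGraph.goodSet S μ e δ τ ε₀
  have h1 : μ univ ≤ μ G + ENNReal.ofReal (1 / 100) := by
    refine huniv.trans ((measure_mono fun x hx => ?_).trans
      ((measure_union_le G (closedBall 0 5 \ G)).trans (by gcongr)))
    by_cases h : x ∈ G
    exacts [Or.inl h, Or.inr ⟨hx, h⟩]
  have h2 : 1 ≤ μ univ := hone.trans (measure_mono (subset_univ _))
  lift μ univ to ℝ≥0 using measure_ne_top μ univ with a
  lift μ G to ℝ≥0 using measure_ne_top μ G with g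
  have h3 : (99 / 100 : ℝ≥0∞) = ENNReal.ofReal (99 / 100) := by
    rw [ENNReal.ofReal_div_of_pos (by norm_num)]; simp
  rw [h3, ← ENNReal.ofReal_coe_nnreal, ← ENNReal.ofReal_coe_nnreal,
    ← ENNReal.ofReal_mul (by norm_num)]
  rw [← ENNReal.ofReal_coe_nnreal, ← ENNReal.ofReal_coe_nnreal,
    ← ENNReal.ofReal_add (by positivity) (by positivity),
    ENNReal.ofReal_le_ofReal_iff (by positivity)] at h1
  have h4 : (1 : ℝ) ≤ a := by exact_mod_cast h2
  exact ENNReal.ofReal_le_ofReal (by linarith)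

end
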